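/- Let T : X → X be either a piecewise expanding unimodal map or an S-unimodal map satisfying the Collet–Eckmann condition on a compact interval X. Then there exists a constant C > 0 such that for every Lipschitz function φ : X → ℝ, γ(φ) := sup_{n≥1, x∈X} (S_n φ(x) - n β(φ)) ≤ C · lip(φ). -/

import Mathlib

open MeasureTheory Set

/-- invariant probability measures carried by `[a,b]`, and the maximal
ergodic average of `φ` among them -/
noncomputable def betaOn (T : ℝ → ℝ) (a b : ℝ) (φ : ℝ → ℝ) : ℝ :=
  sSup ((fun μ : Measure ℝ => ∫ x, φ x ∂μ) ''
    {μ : Measure ℝ | IsProbabilityMeasure μ ∧ μ.map T = μ ∧ μ (Icc a b)ᶜ = 0})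

/-- `T` is a unimodal map of `[a,b]` with turning point `c` -/
structure IsUnimodal (T : ℝ → ℝ) (a b c : ℝ) : Prop where
  hac : a < c
  hcb : c < b
  cont : ContinuousOn T (Icc a b)
  maps : MapsTo T (Icc a b) (Icc a b)
  mono1 : StrictMonoOn T (Icc a c) ∨ StrictAntiOn T (Icc a c)
  mono2 : StrictMonoOn T (Icc c b) ∨ StrictAntiOn T (Icc c b)
  notmono : ¬ (MonotoneOn T (Icc a b) ∨ AntitoneOn T (Icc a b))
  ends : T a ∈ ({a, b} : Set ℝ) ∧ T b ∈ ({a, b} : Set ℝ)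

/-- piecewise expanding: `T` is Lipschitz and `|T^n J| ≥ C λ^n |J|` on intervals
of monotonicity of `T^n` -/
def PiecewiseExpanding (T : ℝ → ℝ) (a b : ℝ) : Prop :=
  (∃ K : NNReal, LipschitzOnWith K T (Icc a b)) ∧
  ∃ C : ℝ, 0 < C ∧ ∃ lam : ℝ, 1 < lam ∧
    ∀ n : ℕ, 1 ≤ n → ∀ J : Set ℝ, J ⊆ Icc a b → J.OrdConnected →
      (StrictMonoOn (T^[n]) J ∨ StrictAntiOn (T^[n]) J) →
      ENNReal.ofReal (C * lam ^ n) * volume J ≤ volume (T^[n] '' J)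

/-- S-unimodal: `C²`, `|T'|^{-1/2}` convex off the critical point, non-flat
critical point, repelling fixed endpoint -/
def SUnimodal (T : ℝ → ℝ) (a b c : ℝ) : Prop :=
  ContDiffOn ℝ 2 T (Icc a b) ∧
  ConvexOn ℝ (Ioo a c) (fun x => |deriv T x| ^ (-(1 : ℝ) / 2)) ∧
  ConvexOn ℝ (Ioo c b) (fun x => |deriv T x| ^ (-(1 : ℝ) / 2)) ∧
  -- non-flat critical point of finite order `α`
  (∃ α : ℝ, 1 < α ∧ ∃ K₁ K₂ : ℝ, 0 < K₁ ∧ ∀ x ∈ Icc a b,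
    K₁ * |x - c| ^ (α - 1) ≤ |deriv T x| ∧ |deriv T x| ≤ K₂ * |x - c| ^ (α - 1)) ∧
  T a = a ∧ 1 < deriv T a

/-- Collet–Eckmann condition: `|(T^n)'(Tc)| ≥ C λ^n` -/
def ColletEckmann (T : ℝ → ℝ) (c : ℝ) : Prop :=
  ∃ C : ℝ, 0 < C ∧ ∃ lam : ℝ, 1 < lam ∧
    ∀ n : ℕ, 1 ≤ n → C * lam ^ n ≤ |deriv (T^[n]) (T c)|



variable {T : ℝ → ℝ} {a b c : ℝ}

/-- closed same side of `c` -/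
def SS (c x y : ℝ) : Prop := (x ≤ c ∧ y ≤ c) ∨ (c ≤ x ∧ c ≤ y)

/-- `T^n` is monotone on the hull of `x,y` -/
def URel (T : ℝ → ℝ) (c : ℝ) (n : ℕ) (x y : ℝ) : Prop :=
  ∀ k < n, SS c (T^[k] x) (T^[k] y)

/-- level -/
noncomputable def lev (T : ℝ → ℝ) (c x : ℝ) : ℝ := |T x - T c|


theorem SS.symm {x y : ℝ} (h : SS c x y) : SS c y x := by
  unfold SS at *; tauto

theorem SS.of_between {x y z : ℝ} (h : SS c x y) (hz : z ∈ uIcc x y) : SS c x z := by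
  unfold SS at *; rw [mem_uIcc] at hz; grind

theorem SS.refl (x : ℝ) : SS c x x := by
  unfold SS; rcases le_total x c with h | h <;> simp [h]

theorem SS.self_c (x : ℝ) : SS c x c := by
  unfold SS; rcases le_total x c with h | h <;> simp [h]

theorem uIcc_sub_Icc {x y z : ℝ} (hx : x ∈ Icc a b) (hy : y ∈ Icc a b) (hz : z ∈ uIcc x y) :
    z ∈ Icc a b := by
  rw [mem_uIcc] at hz; simp only [mem_Icc] at *; grind

theorem mem_uIcc_trans {x y z w : ℝ} (hz : z ∈ uIcc x y) (hw : w ∈ uIcc x z) : w ∈ uIcc x y := by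
  rw [mem_uIcc] at *; grind

theorem mem_uIcc_trans' {x y z w : ℝ} (hz : z ∈ uIcc x y) (hw : w ∈ uIcc z y) : w ∈ uIcc x y := by
  rw [mem_uIcc] at *; grind

theorem mem_uIcc_mid {x y z w : ℝ} (hz : z ∈ uIcc x y) (hw : w ∈ uIcc x z) : z ∈ uIcc w y := by
  rw [mem_uIcc] at *; grind

theorem uIcc_comm' {x y z : ℝ} (hz : z ∈ uIcc x y) : z ∈ uIcc y x := by
  rwa [uIcc_comm]

namespace IsUnimodal

variable (h : IsUnimodal T a b c)
include h

theorem orient : (StrictMonoOn T (Icc a c) ∧ StrictAntiOn T (Icc c b)) ∨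
    (StrictAntiOn T (Icc a c) ∧ StrictMonoOn T (Icc c b)) := by
  have hac := h.hac
  have hcb := h.hcb
  have hun : Icc a c ∪ Icc c b = Icc a b := Icc_union_Icc_eq_Icc hac.le hcb.le
  have g1 : IsGreatest (Icc a c) c := ⟨⟨hac.le, le_refl _⟩, fun x hx => hx.2⟩
  have g2 : IsLeast (Icc c b) c := ⟨⟨le_refl _, hcb.le⟩, fun x hx => hx.1⟩
  rcases h.mono1 with h1 | h1 <;> rcases h.mono2 with h2 | h2
  · exact absurd (Or.inl (hun ▸ (h1.union h2 g1 g2).monotoneOn)) h.notmono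
  · exact Or.inl ⟨h1, h2⟩
  · exact Or.inr ⟨h1, h2⟩
  · exact absurd (Or.inr (hun ▸ (h1.union h2 g1 g2).antitoneOn)) h.notmono

theorem amem : a ∈ Icc a b := ⟨le_refl _, (h.hac.trans h.hcb).le⟩
theorem bmem : b ∈ Icc a b := ⟨(h.hac.trans h.hcb).le, le_refl _⟩
theorem cmem : c ∈ Icc a b := ⟨h.hac.le, h.hcb.le⟩

theorem Tab : T a = T b := by
  have hac := h.hac
  have hcb := h.hcb
  have hc := h.maps h.cmem
  have ha : a ∈ Icc a c := ⟨le_refl _, hac.le⟩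
  have hc1 : c ∈ Icc a c := ⟨hac.le, le_refl _⟩
  have hc2 : c ∈ Icc c b := ⟨le_refl _, hcb.le⟩
  have hb : b ∈ Icc c b := ⟨hcb.le, le_refl _⟩
  have e1 := h.ends.1
  have e2 := h.ends.2
  simp only [mem_insert_iff, mem_singleton_iff] at e1 e2
  rcases h.orient with ⟨h1, h2⟩ | ⟨h1, h2⟩
  · have := h1 ha hc1 hac
    have := h2 hc2 hb hcb
    have := hc.2
    grind
  · have := h1 ha hc1 hac
    have := h2 hc2 hb hcb
    have := hc.1
    grind

theorem iter_mem {x : ℝ} (hx : x ∈ Icc a b) (k : ℕ) : T^[k] x ∈ Icc a b :=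
  h.maps.iterate k hx

theorem ss_inj {x y : ℝ} (hx : x ∈ Icc a b) (hy : y ∈ Icc a b) (hs : SS c x y)
    (he : T x = T y) : x = y := by
  rcases hs with hs | hs
  · rcases h.orient with ⟨h1, -⟩ | ⟨h1, -⟩ <;>
    exact h1.injOn ⟨hx.1, hs.1⟩ ⟨hy.1, hs.2⟩ he
  · rcases h.orient with ⟨-, h1⟩ | ⟨-, h1⟩ <;>
    exact h1.injOn ⟨hs.1, hx.2⟩ ⟨hs.2, hy.2⟩ he

theorem ss_between {x y z : ℝ} (hx : x ∈ Icc a b) (hy : y ∈ Icc a b) (hs : SS c x y)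
    (hz : z ∈ uIcc x y) : T z ∈ uIcc (T x) (T y) := by
  have hzI := uIcc_sub_Icc hx hy hz
  have : (MonotoneOn T (uIcc x y)) ∨ AntitoneOn T (uIcc x y) := by
    rcases hs with hs | hs
    · have hsub : uIcc x y ⊆ Icc a c := by
        intro w hw; rw [mem_uIcc] at hw; simp only [mem_Icc] at *; grind
      rcases h.orient with ⟨h1, -⟩ | ⟨h1, -⟩
      · exact Or.inl (h1.monotoneOn.mono hsub)
      · exact Or.inr (h1.antitoneOn.mono hsub)
    · have hsub : uIcc x y ⊆ Icc c b := by
        intro w hw; rw [mem_uIcc] at hw; simp only [mem_Icc] at *; grind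
      rcases h.orient with ⟨-, h1⟩ | ⟨-, h1⟩
      · exact Or.inr (h1.antitoneOn.mono hsub)
      · exact Or.inl (h1.monotoneOn.mono hsub)
  have xm : x ∈ uIcc x y := left_mem_uIcc
  have ym : y ∈ uIcc x y := right_mem_uIcc
  have hz' := hz
  rw [mem_uIcc] at hz' ⊢
  rcases this with hm | hm
  · rcases hz' with ⟨p, q⟩ | ⟨p, q⟩
    · exact Or.inl ⟨hm xm hz p, hm hz ym q⟩
    · exact Or.inr ⟨hm ym hz p, hm hz xm q⟩
  · rcases hz' with ⟨p, q⟩ | ⟨p, q⟩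
    · exact Or.inr ⟨hm hz ym q, hm xm hz p⟩
    · exact Or.inl ⟨hm hz xm q, hm ym hz p⟩

/-- all values lie on one side of `T c` -/
theorem oneside : (∀ x ∈ Icc a b, T x ≤ T c) ∨ (∀ x ∈ Icc a b, T c ≤ T x) := by
  have hac := h.hac
  have hcb := h.hcb
  have hc1 : c ∈ Icc a c := ⟨hac.le, le_refl _⟩
  have hc2 : c ∈ Icc c b := ⟨le_refl _, hcb.le⟩
  rcases h.orient with ⟨h1, h2⟩ | ⟨h1, h2⟩
  · left; intro x hx
    rcases le_total x c with hh | hh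
    · exact h1.monotoneOn ⟨hx.1, hh⟩ hc1 hh
    · exact h2.antitoneOn hc2 ⟨hh, hx.2⟩ hh
  · right; intro x hx
    rcases le_total x c with hh | hh
    · exact h1.antitoneOn ⟨hx.1, hh⟩ hc1 hh
    · exact h2.monotoneOn hc2 ⟨hh, hx.2⟩ hh

theorem lev_between {x y : ℝ} (hx : x ∈ Icc a b) (hy : y ∈ Icc a b)
    (hl : lev T c x ≤ lev T c y) : T x ∈ uIcc (T y) (T c) := by
  unfold lev at hl
  rw [mem_uIcc]
  rcases h.oneside with ho | ho
  · have := ho x hx; have := ho y hy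
    rw [abs_of_nonpos (by linarith), abs_of_nonpos (by linarith)] at hl
    left; constructor <;> linarith
  · have := ho x hx; have := ho y hy
    rw [abs_of_nonneg (by linarith), abs_of_nonneg (by linarith)] at hl
    right; constructor <;> linarith

theorem lev_eq {x y : ℝ} (hx : x ∈ Icc a b) (hy : y ∈ Icc a b)
    (hl : lev T c x = lev T c y) : T x = T y := by
  unfold lev at hl
  rcases h.oneside with ho | ho
  · have := ho x hx; have := ho y hy
    rw [abs_of_nonpos (by linarith), abs_of_nonpos (by linarith)] at hl
    linarith
  · have := ho x hx; have := ho y hy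
    rw [abs_of_nonneg (by linarith), abs_of_nonneg (by linarith)] at hl
    linarith

omit h in
theorem lev_c : lev T c c = 0 := by simp [lev]
omit h in
theorem lev_nonneg (x : ℝ) : 0 ≤ lev T c x := abs_nonneg _

theorem lev_mono {x y : ℝ} (hy : y ∈ Icc a b) (hz : x ∈ uIcc c y) :
    lev T c x ≤ lev T c y := by
  have := h.ss_between h.cmem hy (SS.self_c y).symm hz
  unfold lev
  rw [mem_uIcc] at this
  rw [abs_le]
  rcases this with ⟨p, q⟩ | ⟨p, q⟩
  · rw [abs_of_nonneg (by linarith)]; constructor <;> linarith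
  · rw [abs_of_nonpos (by linarith)]; constructor <;> linarith

theorem lev_eq_ss {x y : ℝ} (hx : x ∈ Icc a b) (hy : y ∈ Icc a b) (hs : SS c x y)
    (hl : lev T c x = lev T c y) : x = y := h.ss_inj hx hy hs (h.lev_eq hx hy hl)

/-- same side: smaller level means closer to `c` -/
theorem mem_of_lev {x y : ℝ} (hx : x ∈ Icc a b) (hy : y ∈ Icc a b) (hs : SS c x y)
    (hl : lev T c x ≤ lev T c y) : x ∈ uIcc c y := by
  by_contra hcon
  have h1 : y ∈ uIcc c x := by
    unfold SS at hs; rw [mem_uIcc] at *; grind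
  have := h.lev_mono hx h1
  have := h.lev_eq_ss hx hy hs (le_antisymm hl this)
  subst this
  exact hcon right_mem_uIcc

theorem lev_zero {x : ℝ} (hx : x ∈ Icc a b) (hl : lev T c x = 0) : x = c :=
  h.lev_eq_ss hx h.cmem (SS.self_c x) (by rw [hl, lev_c])

theorem lev_pos {x : ℝ} (hx : x ∈ Icc a b) (hne : x ≠ c) : 0 < lev T c x :=
  lt_of_le_of_ne (lev_nonneg x) (fun e => hne (h.lev_zero hx e.symm))

theorem lev_ab : lev T c a = lev T c b := by unfold lev; rw [h.Tab]

theorem lev_le_a {x : ℝ} (hx : x ∈ Icc a b) : lev T c x ≤ lev T c a := by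
  rcases le_total x c with hh | hh
  · exact h.lev_mono h.amem (by rw [mem_uIcc]; right; exact ⟨hx.1, hh⟩)
  · rw [h.lev_ab]; exact h.lev_mono h.bmem (by rw [mem_uIcc]; left; exact ⟨hh, hx.2⟩)

theorem lev_le_bd {x e : ℝ} (hx : x ∈ Icc a b) (he : e = a ∨ e = b) : lev T c x ≤ lev T c e := by
  rcases he with rfl | rfl
  · exact h.lev_le_a hx
  · rw [← h.lev_ab]; exact h.lev_le_a hx

theorem bd_mem {e : ℝ} (he : e = a ∨ e = b) : e ∈ Icc a b := by
  rcases he with rfl | rfl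
  · exact h.amem
  · exact h.bmem

theorem bd_iter {e : ℝ} (he : e = a ∨ e = b) (n : ℕ) : T^[n] e = a ∨ T^[n] e = b := by
  induction n with
  | zero => simpa
  | succ n ih =>
    rw [Function.iterate_succ_apply']
    have := h.ends
    simp only [mem_insert_iff, mem_singleton_iff] at this
    rcases ih with ih | ih <;> rw [ih]
    · exact this.1
    · exact this.2

theorem bd_ne_c {e : ℝ} (he : e = a ∨ e = b) : e ≠ c := by
  rcases he with rfl | rfl
  · exact h.hac.ne
  · exact h.hcb.ne'

/-- existence of a point on a given side with the same image -/
theorem mirror {l x : ℝ} (hl : l ∈ Icc a b) (hx : x ∈ Icc a b) :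
    ∃ l' ∈ Icc a b, SS c l' x ∧ T l' = T l := by
  have key : ∀ e, (e = a ∨ e = b) → ∃ l' ∈ uIcc e c, T l' = T l := by
    intro e he
    have hb := h.lev_between hl (h.bd_mem he) (h.lev_le_bd hl he)
    have hc : ContinuousOn T (uIcc e c) :=
      h.cont.mono (fun z hz => uIcc_sub_Icc (h.bd_mem he) h.cmem hz)
    obtain ⟨z, hz, hz'⟩ := intermediate_value_uIcc hc hb
    exact ⟨z, hz, hz'⟩
  have hac := h.hac
  have hcb := h.hcb
  rcases le_total x c with hh | hh
  · obtain ⟨l', h1, h2⟩ := key a (Or.inl rfl)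
    refine ⟨l', uIcc_sub_Icc h.amem h.cmem h1, Or.inl ⟨?_, hh⟩, h2⟩
    rw [mem_uIcc] at h1; grind
  · obtain ⟨l', h1, h2⟩ := key b (Or.inr rfl)
    refine ⟨l', uIcc_sub_Icc h.bmem h.cmem h1, Or.inr ⟨?_, hh⟩, h2⟩
    rw [mem_uIcc] at h1; grind

theorem contIter (n : ℕ) : ContinuousOn (T^[n]) (Icc a b) := h.cont.iterate h.maps n

theorem contLev : ContinuousOn (lev T c) (Icc a b) := by
  unfold lev
  exact (h.cont.sub continuousOn_const).abs

end IsUnimodal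

namespace URel

theorem symm {n : ℕ} {x y : ℝ} (r : URel T c n x y) : URel T c n y x := fun k hk => (r k hk).symm

theorem mono {m n : ℕ} {x y : ℝ} (r : URel T c n x y) (hmn : m ≤ n) : URel T c m x y :=
  fun k hk => r k (lt_of_lt_of_le hk hmn)

theorem zero (x y : ℝ) : URel T c 0 x y := fun k hk => absurd hk (Nat.not_lt_zero k)

theorem refl (n : ℕ) (x : ℝ) : URel T c n x x := fun _ _ => SS.refl _

theorem add_iff {m n : ℕ} {x y : ℝ} :
    URel T c (m + n) x y ↔ URel T c m x y ∧ URel T c n (T^[m] x) (T^[m] y) := by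
  constructor
  · intro r
    refine ⟨r.mono (Nat.le_add_right _ _), fun k hk => ?_⟩
    rw [← Function.iterate_add_apply, ← Function.iterate_add_apply]
    exact r _ (by omega)
  · rintro ⟨r1, r2⟩ k hk
    rcases lt_or_ge k m with hh | hh
    · exact r1 k hh
    · have := r2 (k - m) (by omega)
      rw [← Function.iterate_add_apply, ← Function.iterate_add_apply] at this
      rwa [Nat.sub_add_cancel hh] at this

theorem one_iff {x y : ℝ} : URel T c 1 x y ↔ SS c x y := by
  constructor
  · intro r; exact r 0 (by omega)
  · intro r k hk; obtain rfl : k = 0 := by omega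
    exact r

theorem succ_iff {n : ℕ} {x y : ℝ} :
    URel T c (n + 1) x y ↔ SS c x y ∧ URel T c n (T x) (T y) := by
  rw [Nat.add_comm, add_iff, one_iff]; rfl

theorem succ_iff' {n : ℕ} {x y : ℝ} :
    URel T c (n + 1) x y ↔ URel T c n x y ∧ SS c (T^[n] x) (T^[n] y) := by
  rw [add_iff, one_iff]

end URel

namespace IsUnimodal
variable (h : IsUnimodal T a b c)
include h

theorem rel_between {n : ℕ} {x y z : ℝ} (hx : x ∈ Icc a b) (hy : y ∈ Icc a b)
    (r : URel T c n x y) (hz : z ∈ uIcc x y) {k : ℕ} (hk : k ≤ n) :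
    T^[k] z ∈ uIcc (T^[k] x) (T^[k] y) := by
  induction k with
  | zero => exact hz
  | succ k ih =>
    simp only [Function.iterate_succ_apply']
    exact h.ss_between (h.iter_mem hx k) (h.iter_mem hy k) (r k (by omega)) (ih (by omega))

theorem rel_left {n : ℕ} {x y z : ℝ} (hx : x ∈ Icc a b) (hy : y ∈ Icc a b)
    (r : URel T c n x y) (hz : z ∈ uIcc x y) : URel T c n x z := fun k hk =>
  (r k hk).of_between (h.rel_between hx hy r hz hk.le)

theorem rel_right {n : ℕ} {x y z : ℝ} (hx : x ∈ Icc a b) (hy : y ∈ Icc a b)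
    (r : URel T c n x y) (hz : z ∈ uIcc x y) : URel T c n z y :=
  (h.rel_left hy hx r.symm (uIcc_comm' hz)).symm

theorem rel_sub {n : ℕ} {x y z w : ℝ} (hx : x ∈ Icc a b) (hy : y ∈ Icc a b)
    (r : URel T c n x y) (hz : z ∈ uIcc x y) (hw : w ∈ uIcc x y) : URel T c n z w := by
  intro k hk
  have h1 := r k hk
  have h2 := h.rel_between hx hy r hz hk.le
  have h3 := h.rel_between hx hy r hw hk.le
  unfold SS at *
  rw [mem_uIcc] at h2 h3
  grind

theorem rel_inj {n : ℕ} {x y : ℝ} (hx : x ∈ Icc a b) (hy : y ∈ Icc a b)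
    (r : URel T c n x y) {k : ℕ} (hk : k ≤ n) (he : T^[k] x = T^[k] y) : x = y := by
  induction k with
  | zero => exact he
  | succ k ih =>
    simp only [Function.iterate_succ_apply'] at he
    exact ih (by omega) (h.ss_inj (h.iter_mem hx k) (h.iter_mem hy k) (r k (by omega)) he)

/-- IVT for iterates -/
theorem ivt {n : ℕ} {x y v : ℝ} (hx : x ∈ Icc a b) (hy : y ∈ Icc a b)
    (hv : v ∈ uIcc (T^[n] x) (T^[n] y)) : ∃ z ∈ uIcc x y, T^[n] z = v := by
  have hc : ContinuousOn (T^[n]) (uIcc x y) :=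
    (h.contIter n).mono (fun z hz => uIcc_sub_Icc hx hy hz)
  obtain ⟨z, hz, hz'⟩ := intermediate_value_uIcc hc hv
  exact ⟨z, hz, hz'⟩

/-- A4 -/
theorem rel_lev {N : ℕ} {x y : ℝ} (hx : x ∈ Icc a b) (hy : y ∈ Icc a b)
    (hl : lev T c x ≤ lev T c y) (r : URel T c N y c) : URel T c N x c := by
  rcases N with _ | N
  · exact URel.zero _ _
  · rw [URel.succ_iff] at *
    exact ⟨SS.self_c x, h.rel_right (h.maps hy) (h.maps h.cmem) r.2 (h.lev_between hx hy hl)⟩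

/-- A5 -/
theorem extend {n : ℕ} {x y e : ℝ} (hy : y ∈ Icc a b)
    (r : URel T c n x y) (he : e = a ∨ e = b) (hxe : x ∈ uIcc e y) :
    ∃ l ∈ uIcc e x, URel T c n l y ∧ (l = e ∨ ∃ i < n, T^[i] l = c) := by
  have hem := h.bd_mem he
  have hx := uIcc_sub_Icc hem hy hxe
  induction n with
  | zero => exact ⟨e, left_mem_uIcc, URel.zero _ _, Or.inl rfl⟩
  | succ n ih =>
    obtain ⟨l, hl, hr, hor⟩ := ih (r.mono (by omega))
    have hlm := uIcc_sub_Icc hem hx hl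
    by_cases hs : SS c (T^[n] l) (T^[n] y)
    · refine ⟨l, hl, URel.succ_iff'.2 ⟨hr, hs⟩, ?_⟩
      rcases hor with h1 | ⟨i, hi, h1⟩
      · exact Or.inl h1
      · exact Or.inr ⟨i, by omega, h1⟩
    · have h2 := r n (by omega)
      have h3 : c ∈ uIcc (T^[n] l) (T^[n] x) := by
        unfold SS at *; rw [mem_uIcc]; grind
      obtain ⟨l', hl', hc⟩ := h.ivt hlm hx h3
      have : l' ∈ uIcc l y := by rw [mem_uIcc] at *; grind
      refine ⟨l', ?_, URel.succ_iff'.2 ⟨h.rel_right hlm hy hr this, ?_⟩, Or.inr ⟨n, by omega, hc⟩⟩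
      · rw [mem_uIcc] at *; grind
      · rw [hc]; exact (SS.self_c _).symm

omit h in
/-- A7 -/
theorem _root_.URel.via {n : ℕ} {x w z : ℝ} (r1 : URel T c n x w) (r2 : URel T c n x z)
    (hne : ∀ k < n, T^[k] x ≠ c) : URel T c n w z := by
  intro k hk
  have h1 := r1 k hk
  have h2 := r2 k hk
  have h3 := hne k hk
  unfold SS at *; grind

/-- A8 -/
theorem rel_c_c {n : ℕ} {x z : ℝ} (hx : x ∈ Icc a b) (hz : z ∈ Icc a b)
    (r1 : URel T c n x c) (r2 : URel T c n z c) (hs : SS c x z) : URel T c n x z := by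
  have : x ∈ uIcc c z ∨ z ∈ uIcc c x := by
    unfold SS at hs; rw [mem_uIcc, mem_uIcc]; grind
  rcases this with h1 | h1
  · exact h.rel_sub hz h.cmem r2 (uIcc_comm' h1) left_mem_uIcc
  · exact h.rel_sub hx h.cmem r1 left_mem_uIcc (uIcc_comm' h1)

end IsUnimodal


namespace IsUnimodal
variable (h : IsUnimodal T a b c)
include h

theorem bddAbove_beta {φ : ℝ → ℝ} {K : NNReal} (hφ : LipschitzOnWith K φ (Icc a b)) :
    BddAbove ((fun μ : Measure ℝ => ∫ x, φ x ∂μ) ''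
    {μ : Measure ℝ | IsProbabilityMeasure μ ∧ μ.map T = μ ∧ μ (Icc a b)ᶜ = 0}) := by
  refine ⟨|φ c| + K * (b - a), ?_⟩
  rintro _ ⟨μ, ⟨hp, -, hμ⟩, rfl⟩
  have hb : ∀ᵐ x ∂μ, ‖φ x‖ ≤ |φ c| + K * (b - a) := by
    have : ∀ᵐ x ∂μ, x ∈ Icc a b := by
      rw [ae_iff]; exact hμ
    filter_upwards [this] with x hx
    have h1 := hφ.dist_le_mul x hx c h.cmem
    rw [Real.dist_eq, Real.dist_eq] at h1
    have h2 : |x - c| ≤ b - a := by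
      have := h.cmem.1; have := h.cmem.2; have := hx.1; have := hx.2
      rw [abs_le]; constructor <;> linarith
    have h3 : (K:ℝ) * |x - c| ≤ K * (b - a) := mul_le_mul_of_nonneg_left h2 K.2
    have h4 : |φ x| ≤ |φ x - φ c| + |φ c| := by
      calc |φ x| = |(φ x - φ c) + φ c| := by ring_nf
        _ ≤ _ := abs_add_le _ _
    rw [Real.norm_eq_abs]; linarith
  have := norm_integral_le_of_norm_le_const hb
  simp only [probReal_univ, mul_one] at this
  exact (le_abs_self _).trans this

theorem periodic_le {φ : ℝ → ℝ} {K : NNReal} (hφ : LipschitzOnWith K φ (Icc a b))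
    {p : ℝ} (hp : p ∈ Icc a b) {m : ℕ} (hm : 1 ≤ m) (hper : T^[m] p = p) :
    ∑ k ∈ Finset.range m, φ (T^[k] p) ≤ m * betaOn T a b φ := by
  have hm0 : (m : ENNReal) ≠ 0 := by
    simp; omega
  have hmt : (m : ENNReal) ≠ ⊤ := ENNReal.natCast_ne_top m
  set μ : Measure ℝ := (m : ENNReal)⁻¹ • ∑ k ∈ Finset.range m, Measure.dirac (T^[k] p) with hμ
  have hap : ∀ s : Set ℝ, μ s = (m : ENNReal)⁻¹ * ∑ k ∈ Finset.range m, s.indicator 1 (T^[k] p) := by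
    intro s
    simp [hμ, Measure.smul_apply, Measure.finsetSum_apply, Measure.dirac_apply]
  have hae : AEMeasurable T μ := by
    apply AEMeasurable.smul_measure
    have : ∀ n, AEMeasurable T (∑ k ∈ Finset.range n, Measure.dirac (T^[k] p)) := by
      intro n
      induction n with
      | zero => simp
      | succ n ih =>
        rw [Finset.sum_range_succ]
        exact ih.add_measure aemeasurable_dirac
    exact this m
  have hprob : IsProbabilityMeasure μ := by
    constructor
    rw [hap]
    simp
    exact ENNReal.inv_mul_cancel hm0 hmt
  have hmap : μ.map T = μ := by
    ext s hs
    rw [Measure.map_apply_of_aemeasurable hae hs, hap, hap]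
    congr 1
    have e1 : ∀ k, (T ⁻¹' s).indicator (1 : ℝ → ENNReal) (T^[k] p) = s.indicator 1 (T^[k+1] p) := by
      intro k
      rw [Function.iterate_succ_apply']
      rfl
    simp only [e1]
    have e2 := Finset.sum_range_succ (fun k => s.indicator (1 : ℝ → ENNReal) (T^[k] p)) m
    have e3 := Finset.sum_range_succ' (fun k => s.indicator (1 : ℝ → ENNReal) (T^[k] p)) m
    rw [e2] at e3
    simp only [hper, Function.iterate_zero, id] at e3
    have hfin : s.indicator (1 : ℝ → ENNReal) p ≠ ⊤ := by
      by_cases hps : p ∈ s <;> simp [hps]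
    exact ((ENNReal.add_left_inj hfin).1 e3).symm
  have hcar : μ (Icc a b)ᶜ = 0 := by
    rw [hap]
    simp only [mul_eq_zero]
    right
    apply Finset.sum_eq_zero
    intro k _
    have := h.iter_mem hp k
    simp [this]
  have hIntEq : ∫ x, φ x ∂μ = (m:ℝ)⁻¹ * ∑ k ∈ Finset.range m, φ (T^[k] p) := by
    rw [hμ, integral_smul_measure, integral_finsetSum_measure]
    · simp
    · intro k _
      exact integrable_dirac (by simp)
  have := le_csSup (h.bddAbove_beta hφ) ⟨μ, ⟨hprob, hmap, hcar⟩, rfl⟩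
  simp only [hIntEq] at this
  have hmp : (0:ℝ) < m := by exact_mod_cast hm
  unfold betaOn
  calc ∑ k ∈ Finset.range m, φ (T^[k] p) = m * ((m:ℝ)⁻¹ * ∑ k ∈ Finset.range m, φ (T^[k] p)) := by
        field_simp
    _ ≤ _ := mul_le_mul_of_nonneg_left this hmp.le

/-- a level-periodic point yields a periodic point -/
theorem lev_per {m : ℕ} {z : ℝ} (hz : z ∈ Icc a b) (hm : 1 ≤ m)
    (hl : lev T c (T^[m] z) = lev T c z) :
    T^[m] (T^[m] z) = T^[m] z ∧ ∀ k, 1 ≤ k → T^[k] (T^[m] z) = T^[k] z := by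
  have e := h.lev_eq (h.iter_mem hz m) hz hl
  have key : ∀ k, 1 ≤ k → T^[k] (T^[m] z) = T^[k] z := by
    intro k hk
    obtain ⟨j, rfl⟩ : ∃ j, k = j + 1 := ⟨k - 1, by omega⟩
    rw [Function.iterate_succ_apply, Function.iterate_succ_apply, e]
  exact ⟨key m hm, key⟩

end IsUnimodal

/-- exponential shrinking -/
def ExpShrink (T : ℝ → ℝ) (a b c C θ : ℝ) : Prop :=
  ∀ n : ℕ, ∀ x ∈ Icc a b, ∀ y ∈ Icc a b, URel T c n x y → |x - y| ≤ C * θ ^ n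


theorem geom_rev {θ : ℝ} (m : ℕ) :
    (1 - θ) * ∑ k ∈ Finset.range m, θ ^ (m - k) + θ ^ (m + 1) = θ := by
  induction m with
  | zero => simp
  | succ m ih =>
    rw [Finset.sum_range_succ']
    simp only [Nat.add_sub_add_right, Nat.sub_zero]
    linear_combination ih

theorem geom_rev_le {θ : ℝ} (h0 : 0 < θ) (h1 : θ < 1) (m : ℕ) :
    ∑ k ∈ Finset.range m, θ ^ (m - k) ≤ 1 / (1 - θ) := by
  rw [le_div_iff₀ (by linarith)]
  have := geom_rev (θ := θ) m
  have : 0 < θ ^ (m+1) := by positivity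
  linarith

theorem iterate_sub_apply {k m : ℕ} (hk : k ≤ m) (x : ℝ) : T^[m - k] (T^[k] x) = T^[m] x := by
  rw [← Function.iterate_add_apply]; congr 2; omega

theorem URel.shift {m N k : ℕ} (hk : k ≤ m) {x y : ℝ} (r : URel T c m x y)
    (r2 : URel T c N (T^[m] x) (T^[m] y)) : URel T c (m - k + N) (T^[k] x) (T^[k] y) := by
  have : URel T c (k + (m - k + N)) x y := by
    have := URel.add_iff.2 ⟨r, r2⟩
    rwa [show k + (m - k + N) = m + N by omega]
  exact (URel.add_iff.1 this).2

namespace IsUnimodal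
variable (h : IsUnimodal T a b c)
include h

theorem closing {C θ : ℝ} (hC : 0 ≤ C) (h0 : 0 < θ) (h1 : θ < 1) (es : ExpShrink T a b c C θ)
    {φ : ℝ → ℝ} {K : NNReal} (hφ : LipschitzOnWith K φ (Icc a b))
    {x z : ℝ} (hx : x ∈ Icc a b) (hz : z ∈ Icc a b) {m N : ℕ} (hm : 1 ≤ m)
    (r : URel T c m x z) (hl : lev T c (T^[m] z) = lev T c z)
    (rx : URel T c N x c) (ry : URel T c N (T^[m] x) c) (rz : URel T c N z c) :
    ∑ k ∈ Finset.range m, φ (T^[k] x) ≤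
      m * betaOn T a b φ + K * (2 * C * (1 + 1 / (1 - θ))) * θ ^ N := by
  obtain ⟨hp, hk⟩ := h.lev_per hz hm hl
  set p := T^[m] z with hpdef
  have hpm : p ∈ Icc a b := h.iter_mem hz m
  have rp : URel T c N p c := h.rel_lev hpm hz hl.le rz
  have hper := h.periodic_le hφ hpm hm hp
  have d1 : ∀ k, k ≤ m → |T^[k] x - T^[k] z| ≤ 2 * C * θ ^ (m - k + N) := by
    intro k hkm
    by_cases hs : SS c (T^[m] x) p
    · have r2 := h.rel_c_c (h.iter_mem hx m) hpm ry rp hs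
      have := es _ _ (h.iter_mem hx k) _ (h.iter_mem hz k) (r.shift hkm r2)
      have : 0 ≤ C * θ ^ (m - k + N) := by positivity
      linarith
    · have : c ∈ uIcc (T^[m] x) (T^[m] z) := by
        unfold SS at hs; rw [mem_uIcc]; grind
      obtain ⟨l, hl1, hl2⟩ := h.ivt hx hz this
      have hlm := uIcc_sub_Icc hx hz hl1
      have e1 := es _ _ (h.iter_mem hx k) _ (h.iter_mem hlm k)
        ((h.rel_left hx hz r hl1).shift hkm (by rw [hl2]; exact ry))
      have e2 := es _ _ (h.iter_mem hlm k) _ (h.iter_mem hz k)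
        ((h.rel_right hx hz r hl1).shift hkm (by rw [hl2]; exact rp.symm))
      have := abs_sub_le (T^[k] x) (T^[k] l) (T^[k] z)
      linarith
  have d2 : ∀ k ∈ Finset.range m, φ (T^[k] x) ≤ φ (T^[k] p) +
      K * (2 * C * θ ^ N * (θ ^ (m - k) + if k = 0 then 1 else 0)) := by
    intro k hkm
    rw [Finset.mem_range] at hkm
    have l1 := hφ.dist_le_mul _ (h.iter_mem hx k) _ (h.iter_mem hpm k)
    rw [Real.dist_eq, Real.dist_eq] at l1
    have l2 : |T^[k] x - T^[k] p| ≤ 2 * C * θ ^ N * (θ ^ (m - k) + if k = 0 then 1 else 0) := by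
      rcases Nat.eq_zero_or_pos k with rfl | hkp
      · simp only [Function.iterate_zero, id, if_true]
        have e1 := es _ _ hx _ h.cmem rx
        have e2 := es _ _ hpm _ h.cmem rp
        have := abs_sub_le x c p
        rw [abs_sub_comm c p] at this
        have : 0 ≤ 2 * C * θ ^ N * θ ^ (m - 0) := by positivity
        linarith
      · rw [hk k hkp]
        have := d1 k hkm.le
        rw [pow_add] at this
        simp only [hkp.ne', if_false, add_zero]
        linarith
    have := le_abs_self (φ (T^[k] x) - φ (T^[k] p))
    have := mul_le_mul_of_nonneg_left l2 K.2
    simp only [NNReal.val_eq_coe] at this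
    linarith
  have s1 := Finset.sum_le_sum d2
  rw [Finset.sum_add_distrib, ← Finset.mul_sum, ← Finset.mul_sum, Finset.sum_add_distrib] at s1
  have s2 := geom_rev_le h0 h1 m
  have s3 : (∑ k ∈ Finset.range m, if k = 0 then (1:ℝ) else 0) ≤ 1 := by
    rw [Finset.sum_ite_eq' (Finset.range m) 0 (fun _ => (1:ℝ))]
    split_ifs <;> norm_num
  have s4 : (K:ℝ) * (2 * C * θ ^ N * (∑ k ∈ Finset.range m, θ ^ (m - k) +
      ∑ k ∈ Finset.range m, if k = 0 then (1:ℝ) else 0)) ≤ K * (2 * C * θ ^ N * (1 / (1 - θ) + 1)) := by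
    gcongr
  calc _ ≤ _ := s1
    _ ≤ m * betaOn T a b φ + K * (2 * C * θ ^ N * (1 / (1 - θ) + 1)) := by linarith
    _ = _ := by ring

/-- IVT for levels -/
theorem ivt_lev {m : ℕ} {x w : ℝ} (hx : x ∈ Icc a b) (hw : w ∈ Icc a b)
    (h1 : lev T c (T^[m] x) ≤ lev T c x) (h2 : lev T c w ≤ lev T c (T^[m] w)) :
    ∃ z ∈ uIcc x w, lev T c (T^[m] z) = lev T c z := by
  have hsub : uIcc x w ⊆ Icc a b := fun z hz => uIcc_sub_Icc hx hw hz
  have hc : ContinuousOn (fun z => lev T c (T^[m] z) - lev T c z) (uIcc x w) := by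
    apply ContinuousOn.sub
    · exact (h.contLev.comp (h.contIter m) (h.maps.iterate m)).mono hsub
    · exact h.contLev.mono hsub
  have hv : (0:ℝ) ∈ uIcc (lev T c (T^[m] x) - lev T c x) (lev T c (T^[m] w) - lev T c w) := by
    rw [mem_uIcc]; left; constructor <;> linarith
  obtain ⟨z, hz, hz'⟩ := intermediate_value_uIcc hc hv
  exact ⟨z, hz, by simp only at hz'; linarith⟩

theorem exists_preim_c {C θ : ℝ} (h0 : 0 < θ) (h1 : θ < 1)
    (es : ExpShrink T a b c C θ) : ∃ l ∈ Icc a b, T l = c := by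
  by_contra hcon
  push Not at hcon
  have hs : ∀ x ∈ Icc a b, SS c (T a) (T x) := by
    intro x hx
    by_contra hs
    have : c ∈ uIcc (T^[1] a) (T^[1] x) := by
      unfold SS at hs; rw [mem_uIcc]; simp only [Function.iterate_one]; grind
    obtain ⟨z, hz, hz'⟩ := h.ivt h.amem hx this
    exact hcon z (uIcc_sub_Icc h.amem hx hz) hz'
  have hr : ∀ n, URel T c n a c := by
    intro n k hk
    rcases k with _ | k
    · exact SS.self_c a
    · rw [Function.iterate_succ_apply', Function.iterate_succ_apply']
      have e1 := hs _ (h.iter_mem h.amem k)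
      have e2 := hs _ (h.iter_mem h.cmem k)
      have e3 := hcon a h.amem
      unfold SS at *; grind
  have hac := h.hac
  have lim : Filter.Tendsto (fun n => C * θ ^ n) Filter.atTop (nhds (C * 0)) :=
    (tendsto_pow_atTop_nhds_zero_of_lt_one h0.le h1).const_mul C
  have : |a - c| ≤ C * 0 := ge_of_tendsto' lim (fun n => es n a h.amem c h.cmem (hr n))
  simp only [mul_zero] at this
  have := abs_pos.2 (sub_ne_zero.2 hac.ne)
  linarith

end IsUnimodal


theorem sum_split (f : ℕ → ℝ) {u s : ℕ} (hu : u ≤ s) :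
    ∑ k ∈ Finset.range s, f k = ∑ k ∈ Finset.range u, f k + ∑ k ∈ Finset.range (s - u), f (k + u) := by
  have := Finset.sum_range_add f u (s - u)
  rw [show u + (s - u) = s by omega] at this
  rw [this]
  congr 1
  apply Finset.sum_congr rfl
  intro k _
  rw [Nat.add_comm]

theorem birk_split (φ : ℝ → ℝ) (x : ℝ) {u s : ℕ} (hu : u ≤ s) :
    ∑ k ∈ Finset.range s, φ (T^[k] x) =
    ∑ k ∈ Finset.range u, φ (T^[k] x) + ∑ k ∈ Finset.range (s - u), φ (T^[k] (T^[u] x)) := by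
  rw [sum_split _ hu]
  simp only [Function.iterate_add_apply]

namespace IsUnimodal
variable (h : IsUnimodal T a b c)
include h

theorem partV {C θ : ℝ} (hC : 0 ≤ C) (h0 : 0 < θ) (h1 : θ < 1) (es : ExpShrink T a b c C θ)
    {φ : ℝ → ℝ} {K : NNReal} (hφ : LipschitzOnWith K φ (Icc a b)) (s : ℕ) :
    ∀ x ∈ Icc a b, URel T c s x c → ∑ k ∈ Finset.range s, φ (T^[k] x) ≤
      s * betaOn T a b φ + K * (2 * C * (1 + 1 / (1 - θ))) * ∑ i ∈ Finset.range s, θ ^ i := by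
  induction s using Nat.strong_induction_on with
  | _ s ih =>
  intro x hx rx
  rcases Nat.eq_zero_or_pos s with rfl | hs
  · simp
  classical
  let P : ℕ → Prop := fun u => 1 ≤ u ∧ ∃ l ∈ Icc a b, URel T c u l c ∧ T^[u] l = c
  have hP1 : P 1 := by
    obtain ⟨l, hl, hl'⟩ := h.exists_preim_c h0 h1 es
    exact ⟨le_refl _, l, hl, URel.one_iff.2 (SS.self_c l), hl'⟩
  set u := Nat.findGreatest P s with hu
  have hPu : P u := Nat.findGreatest_spec (P := P) hs hP1
  have hus : u ≤ s := Nat.findGreatest_le s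
  have hmax : ∀ v, u < v → v ≤ s → ¬ P v := fun v h1 h2 => Nat.findGreatest_is_greatest h1 h2
  obtain ⟨hu1, l0, hl0, rl0, el0⟩ := hPu
  obtain ⟨l, hl, hsl, hTl⟩ := h.mirror hl0 hx
  have rl : URel T c u l c := h.rel_lev hl hl0 (by unfold lev; rw [hTl]) rl0
  have el : T^[u] l = c := by
    rw [← el0]
    obtain ⟨j, hj⟩ : ∃ j, u = j + 1 := ⟨u - 1, by omega⟩
    rw [hj, Function.iterate_succ_apply, Function.iterate_succ_apply, hTl]
  have hcu := h.iter_mem h.cmem u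
  have rc : ∀ k ≤ s - u, URel T c k (T^[u] c) c := by
    intro k
    induction k with
    | zero => intro _; exact URel.zero _ _
    | succ k ihk =>
      intro hk
      have r0 := ihk (by omega)
      refine URel.succ_iff'.2 ⟨r0, ?_⟩
      by_contra hns
      have hk1 : 1 ≤ k := by
        by_contra h'
        obtain rfl : k = 0 := by omega
        exact hns (SS.self_c _)
      have r2 : URel T c (u + k) l c := URel.add_iff.2 ⟨rl, by rw [el]; exact r0.symm⟩
      have hb : c ∈ uIcc (T^[u + k] l) (T^[u + k] c) := by
        rw [Nat.add_comm u k, Function.iterate_add_apply, Function.iterate_add_apply, el]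
        unfold SS at hns; rw [mem_uIcc]; grind
      obtain ⟨l2, hl2, el2⟩ := h.ivt hl h.cmem hb
      exact hmax (u + k) (by omega) (by omega)
        ⟨by omega, l2, uIcc_sub_Icc hl h.cmem hl2, h.rel_right hl h.cmem r2 hl2, el2⟩
  have rN := rc (s - u) le_rfl
  obtain ⟨z, hz, ez⟩ := h.ivt_lev (m := u) hl h.cmem (by rw [el, lev_c]; exact lev_nonneg _)
    (by rw [lev_c]; exact lev_nonneg _)
  have hzm := uIcc_sub_Icc hl h.cmem hz
  have rz : URel T c (s - u) z c := by
    refine h.rel_lev hzm hcu ?_ rN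
    rw [← ez]
    apply h.lev_mono hcu
    have := h.rel_between hl h.cmem rl hz le_rfl
    rwa [el] at this
  have hcase : x ∈ uIcc l c ∨ l ∈ uIcc x c := by
    unfold SS at hsl; rw [mem_uIcc, mem_uIcc]; grind
  have main : URel T c u x z ∧ URel T c (s - u) (T^[u] x) c := by
    rcases hcase with h2 | h2
    · refine ⟨h.rel_sub hl h.cmem rl h2 hz, ?_⟩
      have := h.rel_between hl h.cmem rl h2 le_rfl
      rw [el] at this
      exact h.rel_right hcu h.cmem rN (uIcc_comm' this)
    · refine ⟨(h.rel_sub hx h.cmem rx left_mem_uIcc ?_).mono hus, ?_⟩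
      · exact mem_uIcc_trans' h2 hz
      · have r3 := h.rel_left hx h.cmem rx h2
        rw [show s = u + (s - u) by omega] at r3
        have := (URel.add_iff.1 r3).2
        rwa [el] at this
  have cc := h.closing hC h0 h1 es hφ hx hzm hu1 main.1 ez (rx.mono (by omega)) main.2 rz
  have vv := ih (s - u) (by omega) _ (h.iter_mem hx u) main.2
  rw [birk_split φ x hus]
  have e1 : ((s - u : ℕ) : ℝ) = s - u := by push_cast [hus]; ring
  rw [e1] at vv
  have e2 : ∑ i ∈ Finset.range (s - u), θ ^ i + θ ^ (s - u) ≤ ∑ i ∈ Finset.range s, θ ^ i := by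
    rw [← Finset.sum_range_succ]
    apply Finset.sum_le_sum_of_subset_of_nonneg
    · intro i hi; rw [Finset.mem_range] at *; omega
    · intros; positivity
  have hK : 0 ≤ (K:ℝ) * (2 * C * (1 + 1 / (1 - θ))) := by
    have : 0 < 1 / (1 - θ) := by apply one_div_pos.2; linarith
    have := K.2
    positivity
  have := mul_le_mul_of_nonneg_left e2 hK
  linarith

theorem both_ext {m : ℕ} {x : ℝ} (hx : x ∈ Icc a b) (hne : ∀ k < m, T^[k] x ≠ c) :
    ∃ l ∈ Icc a b, ∃ r ∈ Icc a b, x ∈ uIcc l r ∧ URel T c m l r ∧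
      ((l = a ∨ l = b) ∨ ∃ i < m, T^[i] l = c) ∧ ((r = a ∨ r = b) ∨ ∃ i < m, T^[i] r = c) := by
  obtain ⟨l, hl, rl, ol⟩ := h.extend (e := a) hx (URel.refl m x) (Or.inl rfl) right_mem_uIcc
  obtain ⟨r, hr, rr, or⟩ := h.extend (e := b) hx (URel.refl m x) (Or.inr rfl) right_mem_uIcc
  refine ⟨l, uIcc_sub_Icc h.amem hx hl, r, uIcc_sub_Icc h.bmem hx hr, ?_, rl.symm.via rr.symm hne, ?_, ?_⟩
  · rw [mem_uIcc] at *; simp only [mem_Icc] at hx; grind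
  · rcases ol with ol | ol
    · exact Or.inl (Or.inl ol)
    · exact Or.inr ol
  · rcases or with ol | ol
    · exact Or.inl (Or.inr ol)
    · exact Or.inr ol

theorem hopOuter {x : ℝ} {m N : ℕ} (hx : x ∈ Icc a b)
    (hne : ∀ k < m, T^[k] x ≠ c) (rx : URel T c N x c) (hlev : lev T c (T^[m] x) ≤ lev T c x)
    (hnot : ∀ i, 0 < i → i < m → ¬ URel T c (N + 1) (T^[i] x) c) :
    ∃ z ∈ Icc a b, URel T c m x z ∧ lev T c (T^[m] z) = lev T c z ∧ URel T c N z c := by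
  rcases le_or_gt m N with hmN | hmN
  · obtain ⟨z, hz, ez⟩ := h.ivt_lev (m := m) hx h.cmem hlev (by rw [lev_c]; exact lev_nonneg _)
    exact ⟨z, uIcc_sub_Icc hx h.cmem hz, (h.rel_left hx h.cmem rx hz).mono hmN, ez,
      h.rel_right hx h.cmem rx hz⟩
  · have key : ∀ w ∈ Icc a b, URel T c m x w → ((w = a ∨ w = b) ∨ ∃ i < m, T^[i] w = c) →
        T^[m] x ∈ uIcc c (T^[m] w) →
        ∃ z ∈ Icc a b, URel T c m x z ∧ lev T c (T^[m] z) = lev T c z ∧ URel T c N z c := by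
      intro w hw rw' ow hy
      have hlw : lev T c w ≤ lev T c (T^[m] w) := by
        rcases ow with ow | ⟨i, hi, ei⟩
        · exact h.lev_le_bd hw (h.bd_iter ow m)
        · rcases Nat.eq_zero_or_pos i with rfl | hip
          · simp only [Function.iterate_zero, id] at ei
            rw [ei, lev_c]; exact lev_nonneg _
          · by_contra hcon
            push Not at hcon
            have r1 : URel T c N w c :=
              (rw'.mono hmN.le).via rx (fun k hk => hne k (by omega))
            have r2 : URel T c N (T^[m] w) c := h.rel_lev (h.iter_mem hw m) hw hcon.le r1
            have r3 := h.rel_left (h.iter_mem hw m) h.cmem r2 (uIcc_comm' hy)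
            have r4 := rw'.shift hi.le r3.symm
            rw [ei] at r4
            exact hnot i hip hi (r4.mono (by omega))
      obtain ⟨z, hz, ez⟩ := h.ivt_lev hx hw hlev hlw
      have r5 := h.rel_left hx hw rw' hz
      exact ⟨z, uIcc_sub_Icc hx hw hz, r5, ez,
        (r5.mono hmN.le).via rx (fun k hk => hne k (by omega))⟩
    obtain ⟨l, hl, r, hr, hxlr, rlr, ol, or⟩ := h.both_ext hx hne
    have hb := h.rel_between hl hr rlr hxlr le_rfl
    have rl := h.rel_left hl hr rlr hxlr
    have rr := h.rel_right hl hr rlr hxlr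
    have : T^[m] x ∈ uIcc c (T^[m] l) ∨ T^[m] x ∈ uIcc c (T^[m] r) := by
      rw [mem_uIcc] at *; rw [mem_uIcc]; grind
    rcases this with h2 | h2
    · exact key l hl rl.symm ol h2
    · exact key r hr rr or h2

theorem exists_maxN {C θ : ℝ} (h0 : 0 < θ) (h1 : θ < 1)
    (es : ExpShrink T a b c C θ) {x : ℝ} (hx : x ∈ Icc a b) (hxc : x ≠ c) :
    ∃ N, URel T c N x c ∧ ¬ URel T c (N + 1) x c := by
  by_contra hcon
  push Not at hcon
  have hr : ∀ n, URel T c n x c := by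
    intro n
    induction n with
    | zero => exact URel.zero _ _
    | succ n ih => exact hcon n ih
  have lim : Filter.Tendsto (fun n => C * θ ^ n) Filter.atTop (nhds (C * 0)) :=
    (tendsto_pow_atTop_nhds_zero_of_lt_one h0.le h1).const_mul C
  have : |x - c| ≤ C * 0 := ge_of_tendsto' lim (fun n => es n x hx c h.cmem (hr n))
  simp only [mul_zero] at this
  have := abs_pos.2 (sub_ne_zero.2 hxc)
  linarith

/-- Stage 2 closing point -/
theorem stage2 {x : ℝ} {n t : ℕ} (hx : x ∈ Icc a b) (htn : t ≤ n)
    (hne : ∀ k < t, T^[k] x ≠ c) (hbd : T^[t] x ≠ a ∧ T^[t] x ≠ b)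
    (ry : URel T c (n - t) (T^[t] x) c)
    (hnot : ∀ i < t, ¬ URel T c (n - i) (T^[i] x) c) :
    ∃ l ∈ Icc a b, URel T c t x l ∧ T^[t] l = c := by
  obtain ⟨l, hl, r, hr, hxlr, rlr, ol, or⟩ := h.both_ext hx hne
  by_cases hc : c ∈ uIcc (T^[t] l) (T^[t] r)
  · obtain ⟨z, hz, ez⟩ := h.ivt hl hr hc
    exact ⟨z, uIcc_sub_Icc hl hr hz, h.rel_sub hl hr rlr hxlr hz, ez⟩
  · exfalso
    have key : ∀ w ∈ Icc a b, URel T c t x w → ((w = a ∨ w = b) ∨ ∃ i < t, T^[i] w = c) →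
        T^[t] w ∈ uIcc c (T^[t] x) → False := by
      intro w hw rw' ow hq
      rcases ow with ow | ⟨i, hi, ei⟩
      · have e1 := h.bd_iter ow t
        have e2 := h.iter_mem hx t
        have := h.hac
        have := h.hcb
        rw [mem_uIcc] at hq
        simp only [mem_Icc] at e2
        grind
      · have r1 := h.rel_left (h.iter_mem hx t) h.cmem ry (uIcc_comm' hq)
        have r2 := rw'.shift hi.le r1
        rw [ei, show t - i + (n - t) = n - i by omega] at r2
        exact hnot i hi r2
    have hb := h.rel_between hl hr rlr hxlr le_rfl
    have rl := h.rel_left hl hr rlr hxlr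
    have rr := h.rel_right hl hr rlr hxlr
    have : T^[t] l ∈ uIcc c (T^[t] x) ∨ T^[t] r ∈ uIcc c (T^[t] x) := by
      rw [mem_uIcc] at *; rw [mem_uIcc]; grind
    rcases this with h2 | h2
    · exact key l hl rl.symm ol h2
    · exact key r hr rr or h2

end IsUnimodal


namespace IsUnimodal
variable (h : IsUnimodal T a b c)
include h

theorem partG {C θ : ℝ} (hC : 0 ≤ C) (h0 : 0 < θ) (h1 : θ < 1) (es : ExpShrink T a b c C θ)
    {φ : ℝ → ℝ} {K : NNReal} (hφ : LipschitzOnWith K φ (Icc a b)) (n : ℕ) :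
    ∀ x ∈ Icc a b, (∀ k ≤ n, T^[k] x ≠ a ∧ T^[k] x ≠ b ∧ T^[k] x ≠ c) →
      ∀ N, URel T c N x c → ¬ URel T c (N + 1) x c →
      ∑ k ∈ Finset.range n, φ (T^[k] x) ≤
      n * betaOn T a b φ + K * (2 * C * (1 + 1 / (1 - θ))) * (θ ^ N * (1 / (1 - θ)) + (1 + 1 / (1 - θ))) := by
  have hth : 0 < 1 / (1 - θ) := by apply one_div_pos.2; linarith
  have hK : 0 ≤ (K:ℝ) * (2 * C * (1 + 1 / (1 - θ))) := by
    have := K.2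
    positivity
  have geo : ∀ s, ∑ i ∈ Finset.range s, θ ^ i ≤ 1 / (1 - θ) := by
    intro s
    rw [le_div_iff₀ (by linarith)]
    have e := mul_neg_geom_sum θ s
    have : 0 < θ ^ s := by positivity
    linarith
  induction n using Nat.strong_induction_on with
  | _ n ih =>
  intro x hx hgood N rx nrx
  classical
  by_cases hex : ∃ m, 0 < m ∧ m < n ∧ URel T c (N + 1) (T^[m] x) c
  · obtain ⟨hm0, hmn, hmr⟩ := Nat.find_spec hex
    have hmin := fun i (hi : i < Nat.find hex) => Nat.find_min hex hi
    set m := Nat.find hex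
    have hy := h.iter_mem hx m
    have hlev : lev T c (T^[m] x) ≤ lev T c x := by
      by_contra hcon
      push Not at hcon
      exact nrx (h.rel_lev hx hy hcon.le hmr)
    obtain ⟨z, hz, rz, ez, rzN⟩ := h.hopOuter hx (fun k hk => (hgood k (by omega)).2.2) rx hlev
      (fun i hi him hr => hmin i him ⟨hi, by omega, hr⟩)
    have cc := h.closing hC h0 h1 es hφ hx hz hm0 rz ez rx (hmr.mono (by omega)) rzN
    obtain ⟨N', rN', nN'⟩ := h.exists_maxN h0 h1 es hy (hgood m (by omega)).2.2
    have hNN : N + 1 ≤ N' := by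
      by_contra hcon
      exact nN' (hmr.mono (by omega))
    have gg := ih (n - m) (by omega) _ hy (by
      intro k hk
      rw [← Function.iterate_add_apply]
      exact hgood _ (by omega)) N' rN' nN'
    rw [birk_split φ x hmn.le]
    have e1 : ((n - m : ℕ) : ℝ) = n - m := by push_cast [hmn.le]; ring
    rw [e1] at gg
    have e2 : θ ^ N' ≤ θ ^ (N + 1) := pow_le_pow_of_le_one h0.le h1.le hNN
    have e3 : θ ^ N + θ ^ (N + 1) * (1 / (1 - θ)) = θ ^ N * (1 / (1 - θ)) := by
      have : 1 - θ ≠ 0 := by linarith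
      field_simp
      ring
    have e4 : θ ^ N + θ ^ N' * (1 / (1 - θ)) ≤ θ ^ N * (1 / (1 - θ)) := by
      rw [← e3]; gcongr
    have := mul_le_mul_of_nonneg_left e4 hK
    linarith
  · push Not at hex
    have hex2 : ∃ t, t ≤ n ∧ URel T c (n - t) (T^[t] x) c :=
      ⟨n, le_rfl, by rw [Nat.sub_self]; exact URel.zero _ _⟩
    obtain ⟨htn, htr⟩ := Nat.find_spec hex2
    have hmin := fun i (hi : i < Nat.find hex2) => Nat.find_min hex2 hi
    set t := Nat.find hex2
    have hy := h.iter_mem hx t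
    have vv := h.partV hC h0 h1 es hφ (n - t) _ hy htr
    have g1 := mul_le_mul_of_nonneg_left (geo (n - t)) hK
    have g2 : 0 ≤ (K:ℝ) * (2 * C * (1 + 1 / (1 - θ))) * (θ ^ N * (1 / (1 - θ))) := by positivity
    have g3 : 0 ≤ (K:ℝ) * (2 * C * (1 + 1 / (1 - θ))) * (1 / (1 - θ)) := by positivity
    rw [birk_split φ x htn]
    have e1 : ((n - t : ℕ) : ℝ) = n - t := by push_cast [htn]; ring
    rw [e1] at vv
    rcases Nat.eq_zero_or_pos t with ht0 | htp
    · clear_value t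
      subst ht0
      simp only [Finset.range_zero, Finset.sum_empty, zero_add]
      simp only [Nat.cast_zero, sub_zero] at vv
      linarith
    · have hz : ∃ z ∈ Icc a b, URel T c t x z ∧ lev T c (T^[t] z) = lev T c z := by
        rcases le_total (lev T c (T^[t] x)) (lev T c x) with hl | hl
        · obtain ⟨z, hz, rz, ez, -⟩ := h.hopOuter hx (fun k hk => (hgood k (by omega)).2.2) rx hl
            (fun i hi him => hex i hi (by omega))
          exact ⟨z, hz, rz, ez⟩
        · obtain ⟨l, hl', rl, el⟩ := h.stage2 hx htn (fun k hk => (hgood k (by omega)).2.2)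
            ⟨(hgood t htn).1, (hgood t htn).2.1⟩ htr (fun i hi hr => hmin i hi ⟨by omega, hr⟩)
          obtain ⟨z, hz, ez⟩ := h.ivt_lev (m := t) hl' hx (by rw [el, lev_c]; exact lev_nonneg _) hl
          exact ⟨z, uIcc_sub_Icc hl' hx hz, (h.rel_right hl' hx rl.symm hz).symm, ez⟩
      obtain ⟨z, hz, rz, ez⟩ := hz
      have cc := h.closing hC h0 h1 es hφ hx hz htp rz ez (URel.zero _ _) (URel.zero _ _) (URel.zero _ _)
      rw [pow_zero] at cc
      linarith

theorem fin_pre {F : Set ℝ} (hF : F.Finite) : {x | x ∈ Icc a b ∧ T x ∈ F}.Finite := by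
  have h1 : {x | x ∈ Icc a c ∧ T x ∈ F}.Finite := by
    apply Set.Finite.of_finite_image (f := T)
    · apply hF.subset
      rintro _ ⟨x, hx, rfl⟩; exact hx.2
    · have : InjOn T (Icc a c) := by
        rcases h.mono1 with h1 | h1
        · exact h1.injOn
        · exact h1.injOn
      exact this.mono (fun x hx => hx.1)
  have h2 : {x | x ∈ Icc c b ∧ T x ∈ F}.Finite := by
    apply Set.Finite.of_finite_image (f := T)
    · apply hF.subset
      rintro _ ⟨x, hx, rfl⟩; exact hx.2
    · have : InjOn T (Icc c b) := by
        rcases h.mono2 with h1 | h1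
        · exact h1.injOn
        · exact h1.injOn
      exact this.mono (fun x hx => hx.1)
  apply (h1.union h2).subset
  rintro x ⟨hx, hx'⟩
  rcases le_total x c with hh | hh
  · exact Or.inl ⟨⟨hx.1, hh⟩, hx'⟩
  · exact Or.inr ⟨⟨hh, hx.2⟩, hx'⟩

theorem fin_pre_iter {F : Set ℝ} (hF : F.Finite) (n : ℕ) : {x | x ∈ Icc a b ∧ T^[n] x ∈ F}.Finite := by
  induction n with
  | zero => exact hF.subset (fun x hx => hx.2)
  | succ n ih =>
    apply (h.fin_pre ih).subset
    rintro x ⟨hx, hx'⟩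
    rw [Function.iterate_succ_apply] at hx'
    exact ⟨hx, h.maps hx, hx'⟩

theorem main_of_es {C θ : ℝ} (hC : 0 ≤ C) (h0 : 0 < θ) (h1 : θ < 1) (es : ExpShrink T a b c C θ) :
    ∃ C : ℝ, 0 < C ∧ ∀ (φ : ℝ → ℝ) (K : NNReal), LipschitzOnWith K φ (Icc a b) →
      ∀ n : ℕ, 1 ≤ n → ∀ x ∈ Icc a b,
        ∑ k ∈ Finset.range n, φ (T^[k] x) - n * betaOn T a b φ ≤ C * K := by
  have hth : 0 < 1 / (1 - θ) := by apply one_div_pos.2; linarith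
  set D := (2 * C * (1 + 1 / (1 - θ))) * (1 * (1 / (1 - θ)) + (1 + 1 / (1 - θ))) with hD
  have hD0 : 0 ≤ D := by positivity
  refine ⟨D + 1, by linarith, ?_⟩
  intro φ K hφ n _ x hx
  have good : ∀ x ∈ Icc a b, (∀ k ≤ n, T^[k] x ≠ a ∧ T^[k] x ≠ b ∧ T^[k] x ≠ c) →
      ∑ k ∈ Finset.range n, φ (T^[k] x) ≤ n * betaOn T a b φ + D * K := by
    intro x hx hg
    obtain ⟨N, r1, r2⟩ := h.exists_maxN h0 h1 es hx (hg 0 (by omega)).2.2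
    have := h.partG hC h0 h1 es hφ n x hx hg N r1 r2
    have e : θ ^ N ≤ 1 := pow_le_one₀ h0.le h1.le
    have : (K:ℝ) * (2 * C * (1 + 1 / (1 - θ))) * (θ ^ N * (1 / (1 - θ)) + (1 + 1 / (1 - θ))) ≤
       (K:ℝ) * (2 * C * (1 + 1 / (1 - θ))) * (1 * (1 / (1 - θ)) + (1 + 1 / (1 - θ))) := by
      gcongr
    rw [hD]; linarith
  set B : Set ℝ := ⋃ k ∈ Finset.range (n + 1), {x | x ∈ Icc a b ∧ T^[k] x ∈ ({a, b, c} : Set ℝ)} with hB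
  have hBf : B.Finite := by
    apply Set.Finite.biUnion (Finset.finite_toSet _)
    intro k _
    exact h.fin_pre_iter (by simp) k
  have hdense : Dense Bᶜ := hBf.countable.dense_compl ℝ
  have hcl : Icc a b ⊆ closure (Ioo a b ∩ Bᶜ) := by
    have e1 : Ioo a b ⊆ closure (Ioo a b ∩ Bᶜ) := hdense.open_subset_closure_inter isOpen_Ioo
    have e2 := closure_minimal e1 isClosed_closure
    rwa [closure_Ioo (h.hac.trans h.hcb).ne] at e2
  obtain ⟨u, hu, hlim⟩ := mem_closure_iff_seq_limit.1 (hcl hx)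
  have hcont : ContinuousOn (fun x => ∑ k ∈ Finset.range n, φ (T^[k] x)) (Icc a b) := by
    apply continuousOn_finsetSum
    intro k _
    exact hφ.continuousOn.comp (h.contIter k) (h.maps.iterate k)
  have hlim2 := (hcont x hx).tendsto.comp (tendsto_nhdsWithin_iff.2
    ⟨hlim, Filter.Eventually.of_forall (fun n => Ioo_subset_Icc_self (hu n).1)⟩)
  have := le_of_tendsto' hlim2 (fun j => good (u j) (Ioo_subset_Icc_self (hu j).1) (by
    intro k hk
    have hnb := (hu j).2
    have hI := Ioo_subset_Icc_self (hu j).1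
    refine ⟨?_, ?_, ?_⟩ <;>
    · intro hh
      apply hnb
      simp only [hB, mem_iUnion, Finset.mem_range]
      exact ⟨k, by omega, hI, by simp [hh]⟩))
  have hK := K.2
  simp only [NNReal.val_eq_coe] at hK
  linarith

theorem es_of_pe (pe : PiecewiseExpanding T a b) :
    ∃ C θ, 0 ≤ C ∧ 0 < θ ∧ θ < 1 ∧ ExpShrink T a b c C θ := by
  obtain ⟨-, C, hC, lam, hlam, hpe⟩ := pe
  have hba : 0 < b - a := by have := h.hac; have := h.hcb; linarith
  refine ⟨max (b - a) ((b - a) / C), lam⁻¹, by positivity, by positivity, inv_lt_one_of_one_lt₀ hlam, ?_⟩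
  intro n x hx y hy r
  rcases Nat.eq_zero_or_pos n with rfl | hn
  · simp only [pow_zero, mul_one]
    refine le_trans ?_ (le_max_left _ _)
    have := hx.1; have := hx.2; have := hy.1; have := hy.2
    rw [abs_le]; constructor <;> linarith
  have hsub : uIcc x y ⊆ Icc a b := fun z hz => uIcc_sub_Icc hx hy hz
  have hinj : InjOn (T^[n]) (uIcc x y) := by
    intro z hz w hw he
    exact h.rel_inj (hsub hz) (hsub hw) (h.rel_sub hx hy r hz hw) le_rfl he
  have hmon : StrictMonoOn (T^[n]) (uIcc x y) ∨ StrictAntiOn (T^[n]) (uIcc x y) :=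
    ContinuousOn.strictMonoOn_of_injOn_Icc' (inf_le_sup) ((h.contIter n).mono hsub) hinj
  have h1 := hpe n hn (uIcc x y) hsub ordConnected_uIcc hmon
  have h2 : volume (T^[n] '' uIcc x y) ≤ ENNReal.ofReal (b - a) := by
    rw [← Real.volume_Icc]
    apply measure_mono
    rintro _ ⟨z, hz, rfl⟩
    exact h.iter_mem (hsub hz) n
  rw [uIcc, Real.volume_Icc, max_sub_min_eq_abs] at h1
  have h3 := h1.trans h2
  rw [← ENNReal.ofReal_mul (by positivity), ENNReal.ofReal_le_ofReal_iff hba.le] at h3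
  have hl : 0 < lam ^ n := by positivity
  rw [abs_sub_comm]
  calc |y - x| = (C * lam ^ n * |y - x|) / C * (lam⁻¹) ^ n := by
        rw [inv_pow]; field_simp
    _ ≤ (b - a) / C * lam⁻¹ ^ n := by gcongr
    _ ≤ _ := by gcongr; exact le_max_right _ _

end IsUnimodal


theorem mob_hasDeriv {x g0 p t : ℝ} (h0 : 0 < g0) (ht : 0 < g0 + p * (t - x)) :
    HasDerivAt (fun t => (t - x) / (g0 * (g0 + p * (t - x)))) (1 / (g0 + p * (t - x)) ^ 2) t := by
  have h1 : HasDerivAt (fun t => t - x) 1 t := (hasDerivAt_id t).sub_const x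
  have h2 : HasDerivAt (fun t => g0 * (g0 + p * (t - x))) (g0 * (p * 1)) t :=
    ((h1.const_mul p).const_add g0).const_mul g0
  have h3 := h1.div h2 (by positivity)
  have hne : g0 + p * (t - x) ≠ 0 := ht.ne'
  have e : 1 / (g0 + p * (t - x)) ^ 2 =
    (1 * (g0 * (g0 + p * (t - x))) - (t - x) * (g0 * (p * 1))) / (g0 * (g0 + p * (t - x))) ^ 2 := by
    rw [div_eq_div_iff (by positivity) (by positivity)]
    ring
  rw [e]
  exact h3

theorem mono_of_hd {F F' : ℝ → ℝ} {l r : ℝ} (hlr : l ≤ r)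
    (hd : ∀ t ∈ Icc l r, HasDerivAt F (F' t) t) (hn : ∀ t ∈ Icc l r, 0 ≤ F' t) : F l ≤ F r := by
  have : MonotoneOn F (Icc l r) := by
    apply monotoneOn_of_hasDerivWithinAt_nonneg (convex_Icc l r)
      (fun t ht => (hd t ht).continuousAt.continuousWithinAt)
      (fun t ht => (hd t (interior_subset ht)).hasDerivWithinAt)
      (fun t ht => hn t (interior_subset ht))
  exact this ⟨le_rfl, hlr⟩ ⟨hlr, le_rfl⟩ hlr

theorem mob_ge {f f' : ℝ → ℝ} {l r x g0 p : ℝ} (hlr : l ≤ r) (h0 : 0 < g0)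
    (hd : ∀ t ∈ Icc l r, HasDerivAt f (f' t) t)
    (hh : ∀ t ∈ Icc l r, 0 < g0 + p * (t - x))
    (hn : ∀ t ∈ Icc l r, 1 / (g0 + p * (t - x)) ^ 2 ≤ f' t) :
    f l - (l - x) / (g0 * (g0 + p * (l - x))) ≤ f r - (r - x) / (g0 * (g0 + p * (r - x))) :=
  mono_of_hd (F := fun t => f t - (t - x) / (g0 * (g0 + p * (t - x)))) hlr
    (fun t ht => (hd t ht).sub (mob_hasDeriv h0 (hh t ht)))
    (fun t ht => sub_nonneg.2 (hn t ht))

theorem mob_le {f f' : ℝ → ℝ} {l r x g0 p : ℝ} (hlr : l ≤ r) (h0 : 0 < g0)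
    (hd : ∀ t ∈ Icc l r, HasDerivAt f (f' t) t)
    (hh : ∀ t ∈ Icc l r, 0 < g0 + p * (t - x))
    (hn : ∀ t ∈ Icc l r, f' t ≤ 1 / (g0 + p * (t - x)) ^ 2) :
    (l - x) / (g0 * (g0 + p * (l - x))) - f l ≤ (r - x) / (g0 * (g0 + p * (r - x))) - f r :=
  mono_of_hd (F := fun t => (t - x) / (g0 * (g0 + p * (t - x))) - f t) hlr
    (fun t ht => (mob_hasDeriv h0 (hh t ht)).sub (hd t ht))
    (fun t ht => sub_nonneg.2 (hn t ht))

/-- one step expansion estimate -/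
theorem one_step_E {f f' g : ℝ → ℝ} {u v x y : ℝ} (hx : x ∈ Ioo u v) (hy : y ∈ Ioo u v) (hxy : x < y)
    (hd : ∀ t ∈ Ioo u v, HasDerivAt f (f' t) t) (hg0 : ∀ t ∈ Ioo u v, 0 < g t)
    (hfg : ∀ t ∈ Ioo u v, f' t = 1 / (g t) ^ 2) (hconv : ConvexOn ℝ (Ioo u v) g) :
    y - x ≤ g x * g y * (f y - f x) := by
  set p := (g y - g x) / (y - x) with hp
  have hyx : 0 < y - x := by linarith
  have hsub : Icc x y ⊆ Ioo u v := fun t ht => ⟨lt_of_lt_of_le hx.1 ht.1, lt_of_le_of_lt ht.2 hy.2⟩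
  have gx := hg0 x hx
  have gy := hg0 y hy
  have hpy : g x + p * (y - x) = g y := by rw [hp]; field_simp; ring
  have hle : ∀ t ∈ Icc x y, g t ≤ g x + p * (t - x) := by
    intro t ht
    have := hconv.2 hx hy (show 0 ≤ (y - t) / (y - x) from div_nonneg (by linarith [ht.2]) hyx.le)
      (show 0 ≤ (t - x) / (y - x) from div_nonneg (by linarith [ht.1]) hyx.le)
      (by field_simp; ring)
    simp only [smul_eq_mul] at this
    have e1 : (y - t) / (y - x) * x + (t - x) / (y - x) * y = t := by field_simp; ring
    have e2 : (y - t) / (y - x) * g x + (t - x) / (y - x) * g y = g x + p * (t - x) := by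
      rw [hp]; field_simp; ring
    rwa [e1, e2] at this
  have key := mob_ge (f := f) (f' := f') (x := x) (g0 := g x) (p := p) hxy.le gx
    (fun t ht => hd t (hsub ht))
    (fun t ht => lt_of_lt_of_le (hg0 t (hsub ht)) (hle t ht)) (by
      intro t ht
      rw [hfg t (hsub ht)]
      have := hg0 t (hsub ht)
      have := hle t ht
      gcongr)
  rw [hpy] at key
  simp only [sub_self, zero_div, sub_zero] at key
  have : (y - x) / (g x * g y) ≤ f y - f x := by linarith
  rw [div_le_iff₀ (by positivity)] at this
  linarith

theorem one_step_CR {f f' g : ℝ → ℝ} {u v l x r : ℝ} (hl : l ∈ Ioo u v) (hr : r ∈ Ioo u v)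
    (hlx : l < x) (hxr : x < r)
    (hd : ∀ t ∈ Ioo u v, HasDerivAt f (f' t) t) (hg0 : ∀ t ∈ Ioo u v, 0 < g t)
    (hfg : ∀ t ∈ Ioo u v, f' t = 1 / (g t) ^ 2) (hconv : ConvexOn ℝ (Ioo u v) g) :
    (f x - f l) * (f r - f x) * (r - l) ≤ f' x * ((f r - f l) * ((x - l) * (r - x))) := by
  have hsub : Icc l r ⊆ Ioo u v := fun t ht => ⟨lt_of_lt_of_le hl.1 ht.1, lt_of_le_of_lt ht.2 hr.2⟩
  have hx : x ∈ Ioo u v := hsub ⟨hlx.le, hxr.le⟩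
  have gx := hg0 x hx
  have hxi : x ∈ interior (Ioo u v) := by rwa [isOpen_Ioo.interior_eq]
  obtain ⟨p, hp⟩ : ∃ p, ∀ t ∈ Ioo u v, g x + p * (t - x) ≤ g t := by
    refine ⟨derivWithin g (Ioi x) x, ?_⟩
    intro t ht
    rcases lt_trichotomy t x with htx | htx | htx
    · have h1 := hconv.slope_le_leftDeriv_of_mem_interior ht hxi htx
      have h2 := hconv.leftDeriv_le_rightDeriv_of_mem_interior hxi
      have h3 := h1.trans h2
      rw [slope_def_field, div_le_iff₀ (by linarith)] at h3
      linarith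
    · rw [htx]; simp
    · have h1 := hconv.rightDeriv_le_slope_of_mem_interior hxi ht htx
      rw [slope_def_field, le_div_iff₀ (by linarith)] at h1
      linarith
  have hmono : ∀ s ∈ Ioo u v, ∀ t ∈ Ioo u v, s ≤ t → f s ≤ f t := by
    intro s hs t ht hst
    apply mono_of_hd hst (F' := f')
    · intro w hw; exact hd w ⟨lt_of_lt_of_le hs.1 hw.1, lt_of_le_of_lt hw.2 ht.2⟩
    · intro w hw
      rw [hfg w ⟨lt_of_lt_of_le hs.1 hw.1, lt_of_le_of_lt hw.2 ht.2⟩]; positivity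
  have A0 : 0 ≤ f x - f l := sub_nonneg.2 (hmono l hl x hx hlx.le)
  have B0 : 0 ≤ f r - f x := sub_nonneg.2 (hmono x hx r hr hxr.le)
  have hder : ∀ t ∈ Icc l r, 0 < g x + p * (t - x) → f' t ≤ 1 / (g x + p * (t - x)) ^ 2 := by
    intro t ht hpos
    rw [hfg t (hsub ht)]
    have := hp t (hsub ht)
    gcongr
  have cB : (g x + p * (r - x)) * g x * (f r - f x) ≤ r - x := by
    rcases le_or_gt (g x + p * (r - x)) 0 with hneg | hpos
    · have : (g x + p * (r - x)) * (g x * (f r - f x)) ≤ 0 :=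
        mul_nonpos_of_nonpos_of_nonneg hneg (by positivity)
      nlinarith
    · have hh : ∀ t ∈ Icc x r, 0 < g x + p * (t - x) := by
        intro t ht
        rcases le_total 0 p with hp0 | hp0
        · have := mul_nonneg hp0 (sub_nonneg.2 ht.1); linarith
        · have := mul_le_mul_of_nonpos_left (sub_le_sub_right ht.2 x) hp0; linarith
      have key := mob_le (f := f) (f' := f') (x := x) (g0 := g x) (p := p) hxr.le gx
        (fun t ht => hd t (hsub ⟨hlx.le.trans ht.1, ht.2⟩)) hh
        (fun t ht => hder t ⟨hlx.le.trans ht.1, ht.2⟩ (hh t ht))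
      simp only [sub_self, zero_div, zero_sub] at key
      have : f r - f x ≤ (r - x) / (g x * (g x + p * (r - x))) := by linarith
      rw [le_div_iff₀ (by positivity)] at this
      linarith
  have cA : (g x + p * (l - x)) * g x * (f x - f l) ≤ x - l := by
    rcases le_or_gt (g x + p * (l - x)) 0 with hneg | hpos
    · have : (g x + p * (l - x)) * (g x * (f x - f l)) ≤ 0 :=
        mul_nonpos_of_nonpos_of_nonneg hneg (by positivity)
      nlinarith
    · have hh : ∀ t ∈ Icc l x, 0 < g x + p * (t - x) := by
        intro t ht
        rcases le_total 0 p with hp0 | hp0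
        · have := mul_le_mul_of_nonneg_left (sub_le_sub_right ht.1 x) hp0; linarith
        · have := mul_nonneg_of_nonpos_of_nonpos hp0 (sub_nonpos.2 ht.2); linarith
      have key := mob_le (f := f) (f' := f') (x := x) (g0 := g x) (p := p) hlx.le gx
        (fun t ht => hd t (hsub ⟨ht.1, ht.2.trans hxr.le⟩)) hh
        (fun t ht => hder t ⟨ht.1, ht.2.trans hxr.le⟩ (hh t ht))
      simp only [sub_self, zero_div, zero_sub] at key
      have : f x - f l ≤ -((l - x) / (g x * (g x + p * (l - x)))) := by linarith
      rw [← neg_div, le_div_iff₀ (by positivity)] at this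
      linarith
  rw [hfg x hx]
  have e1 : 1 / g x ^ 2 * ((f r - f l) * ((x - l) * (r - x))) =
    ((f r - f l) * ((x - l) * (r - x))) / g x ^ 2 := by ring
  rw [e1, le_div_iff₀ (by positivity)]
  have m1 := mul_le_mul_of_nonneg_left cB (mul_nonneg A0 (sub_nonneg.2 hlx.le))
  have m2 := mul_le_mul_of_nonneg_left cA (mul_nonneg B0 (sub_nonneg.2 hxr.le))
  nlinarith


/-- absolute derivative of iterates -/
noncomputable def Dn (T : ℝ → ℝ) (n : ℕ) (x : ℝ) : ℝ := ∏ k ∈ Finset.range n, |deriv T (T^[k] x)|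

theorem Dn_zero (x : ℝ) : Dn T 0 x = 1 := by simp [Dn]
theorem Dn_succ (n : ℕ) (x : ℝ) : Dn T (n + 1) x = Dn T n x * |deriv T (T^[n] x)| := by
  simp [Dn, Finset.prod_range_succ]
theorem Dn_nonneg (n : ℕ) (x : ℝ) : 0 ≤ Dn T n x := Finset.prod_nonneg (fun _ _ => abs_nonneg _)
theorem Dn_add (m n : ℕ) (x : ℝ) : Dn T (m + n) x = Dn T m x * Dn T n (T^[m] x) := by
  unfold Dn
  rw [Finset.prod_range_add]
  congr 1
  apply Finset.prod_congr rfl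
  intro k _
  rw [← Function.iterate_add_apply, Nat.add_comm]
theorem Dn_succ' (n : ℕ) (x : ℝ) : Dn T (n + 1) x = |deriv T x| * Dn T n (T x) := by
  rw [Nat.add_comm, Dn_add]; simp [Dn]

/-- S-unimodal Collet-Eckmann data -/
structure SCE (T : ℝ → ℝ) (a b c α K₁ K₂ C0 lam : ℝ) : Prop where
  uni : IsUnimodal T a b c
  diff : ∀ x ∈ Icc a b, DifferentiableAt ℝ T x
  dcont : ContinuousOn (deriv T) (Icc a b)
  conv1 : ConvexOn ℝ (Ioo a c) (fun x => |deriv T x| ^ (-(1 : ℝ) / 2))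
  conv2 : ConvexOn ℝ (Ioo c b) (fun x => |deriv T x| ^ (-(1 : ℝ) / 2))
  hα : 1 < α
  hK₁ : 0 < K₁
  low : ∀ x ∈ Icc a b, K₁ * |x - c| ^ (α - 1) ≤ |deriv T x|
  up : ∀ x ∈ Icc a b, |deriv T x| ≤ K₂ * |x - c| ^ (α - 1)
  Ta : T a = a
  dTa : 1 < deriv T a
  hC0 : 0 < C0
  hlam : 1 < lam
  ce : ∀ n : ℕ, C0 * lam ^ n ≤ Dn T n (T c)

theorem hasDeriv_iter (hm : MapsTo T (Icc a b) (Icc a b))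
    (hd : ∀ x ∈ Icc a b, DifferentiableAt ℝ T x) (n : ℕ) {x : ℝ} (hx : x ∈ Icc a b) :
    ∃ d, HasDerivAt (T^[n]) d x ∧ |d| = Dn T n x := by
  induction n with
  | zero => exact ⟨1, hasDerivAt_id x, by simp [Dn]⟩
  | succ n ih =>
    obtain ⟨d, h1, h2⟩ := ih
    have h3 := (hd _ (hm.iterate n hx)).hasDerivAt
    have h4 := h3.comp x h1
    rw [← Function.iterate_succ'] at h4
    exact ⟨_, h4, by rw [abs_mul, h2, Dn_succ, mul_comm]⟩

theorem sce_of (h : IsUnimodal T a b c) (hs : SUnimodal T a b c) (hc : ColletEckmann T c) :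
    ∃ α K₁ K₂ C0 lam, SCE T a b c α K₁ K₂ C0 lam := by
  obtain ⟨cd, c1, c2, ⟨α, hα, K₁, K₂, hK₁, hb⟩, Ta, dTa⟩ := hs
  obtain ⟨C, hC, lam, hlam, ce⟩ := hc
  have hab : a < b := h.hac.trans h.hcb
  have hdiff : ∀ x ∈ Icc a b, DifferentiableAt ℝ T x := by
    intro x hx
    by_cases hxc : x = c
    · subst hxc
      exact (cd.differentiableOn (by norm_num) x hx).differentiableAt (Icc_mem_nhds h.hac h.hcb)
    · by_contra hcon
      have h1 := (hb x hx).1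
      rw [deriv_zero_of_not_differentiableAt hcon, abs_zero] at h1
      have : 0 < |x - c| := abs_pos.2 (sub_ne_zero.2 hxc)
      have : 0 < K₁ * |x - c| ^ (α - 1) := by positivity
      linarith
  have hdc : ContinuousOn (deriv T) (Icc a b) := by
    have h1 := cd.continuousOn_derivWithin (uniqueDiffOn_Icc hab) (by norm_num)
    apply h1.congr
    intro x hx
    exact ((hdiff x hx).derivWithin (uniqueDiffOn_Icc hab x hx)).symm
  refine ⟨α, K₁, K₂, min C 1, lam, h, hdiff, hdc, c1, c2, hα, hK₁, fun x hx => (hb x hx).1,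
    fun x hx => (hb x hx).2, Ta, dTa, by positivity, hlam, ?_⟩
  intro n
  rcases Nat.eq_zero_or_pos n with rfl | hn
  · simp [Dn]
  · have h1 := ce n hn
    obtain ⟨d, h2, h3⟩ := hasDeriv_iter h.maps hdiff n (h.maps h.cmem)
    rw [h2.deriv, h3] at h1
    refine le_trans ?_ h1
    gcongr
    exact min_le_left _ _

theorem shrink_seq {u v x : ℝ} (huv : u < v) (hx : x ∈ Icc u v) :
    (∀ n : ℕ, x + ((u + v) / 2 - x) / (n + 2) ∈ Ioo u v) ∧
    Filter.Tendsto (fun n : ℕ => x + ((u + v) / 2 - x) / (n + 2)) Filter.atTop (nhds x) := by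
  constructor
  · intro n
    have hn : (0:ℝ) < (n:ℝ) + 2 := by positivity
    have e : x + ((u + v) / 2 - x) / (n + 2) = (x * (n + 1) + (u + v) / 2) / (n + 2) := by
      field_simp; ring
    rw [e]
    have := hx.1; have := hx.2
    have hn1 : (0:ℝ) < (n:ℝ) + 1 := by positivity
    constructor
    · rw [lt_div_iff₀ hn]; nlinarith
    · rw [div_lt_iff₀ hn]; nlinarith
  · have h1 : Filter.Tendsto (fun n : ℕ => ((u + v) / 2 - x) / ((n:ℝ) + 2)) Filter.atTop (nhds 0) := by
      apply Filter.Tendsto.const_div_atTop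
      exact Filter.tendsto_atTop_add_const_right _ _ tendsto_natCast_atTop_atTop
    simpa using h1.const_add x

namespace SCE
variable {α K₁ K₂ C0 lam : ℝ} (S : SCE T a b c α K₁ K₂ C0 lam)
include S

theorem orient : StrictMonoOn T (Icc a c) ∧ StrictAntiOn T (Icc c b) := by
  have h := S.uni
  rcases h.orient with h1 | h1
  · exact h1
  · exfalso
    have := h1.1 ⟨le_rfl, h.hac.le⟩ ⟨h.hac.le, le_rfl⟩ h.hac
    rw [S.Ta] at this
    exact absurd (h.maps h.cmem).1 (not_le.2 this)

theorem Tb : T b = a := by rw [← S.uni.Tab, S.Ta]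

theorem d_pos {x : ℝ} (hx : x ∈ Icc a b) (hxc : x ≠ c) : 0 < |deriv T x| := by
  have : 0 < |x - c| := abs_pos.2 (sub_ne_zero.2 hxc)
  have h2 := S.hK₁
  have : 0 < K₁ * |x - c| ^ (α - 1) := by positivity
  have := S.low x hx
  linarith

theorem deriv_pos {x : ℝ} (hx : x ∈ Ioo a c) : 0 < deriv T x := by
  have hxm : x ∈ Icc a b := ⟨hx.1.le, hx.2.le.trans S.uni.hcb.le⟩
  have h1 : 0 ≤ derivWithin T (Icc a c) x := S.orient.1.monotoneOn.derivWithin_nonneg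
  rw [derivWithin_of_mem_nhds (Icc_mem_nhds hx.1 hx.2)] at h1
  have h2 := S.d_pos hxm hx.2.ne
  rw [abs_pos] at h2
  exact lt_of_le_of_ne h1 h2.symm

theorem deriv_neg {x : ℝ} (hx : x ∈ Ioo c b) : deriv T x < 0 := by
  have hxm : x ∈ Icc a b := ⟨S.uni.hac.le.trans hx.1.le, hx.2.le⟩
  have h1 : derivWithin T (Icc c b) x ≤ 0 := S.orient.2.antitoneOn.derivWithin_nonpos
  rw [derivWithin_of_mem_nhds (Icc_mem_nhds hx.1 hx.2)] at h1
  have h2 := S.d_pos hxm hx.1.ne'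
  rw [abs_pos] at h2
  exact lt_of_le_of_ne h1 h2

omit S in
theorem g_sq {d : ℝ} (hd : 0 < d) : d = 1 / (d ^ (-(1:ℝ) / 2)) ^ 2 := by
  rw [← Real.rpow_natCast, ← Real.rpow_mul hd.le]
  norm_num [Real.rpow_neg_one]

/-- data on an open side -/
theorem side_data : ∀ u v, ((u = a ∧ v = c) ∨ (u = c ∧ v = b)) → ∃ f f' g : ℝ → ℝ,
    (∀ t ∈ Ioo u v, HasDerivAt f (f' t) t) ∧ (∀ t ∈ Ioo u v, 0 < g t) ∧
    (∀ t ∈ Ioo u v, f' t = 1 / (g t) ^ 2) ∧ ConvexOn ℝ (Ioo u v) g ∧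
    (∀ t ∈ Ioo u v, |deriv T t| = f' t) ∧ (∀ s ∈ Ioo u v, ∀ t ∈ Ioo u v, s ≤ t → |T s - T t| = f t - f s) := by
  have hac := S.uni.hac
  have hcb := S.uni.hcb
  rintro u v (⟨rfl, rfl⟩ | ⟨rfl, rfl⟩)
  · refine ⟨T, deriv T, _, fun t ht => (S.diff t ⟨ht.1.le, ht.2.le.trans hcb.le⟩).hasDerivAt, ?_, ?_, S.conv1, ?_, ?_⟩
    · intro t ht
      have := S.deriv_pos ht
      have : 0 < |deriv T t| := abs_pos.2 this.ne'
      positivity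
    · intro t ht
      have := S.deriv_pos ht
      simp only [abs_of_pos this]
      exact g_sq this
    · intro t ht; exact abs_of_pos (S.deriv_pos ht)
    · intro s hs t ht hst
      have := S.orient.1.monotoneOn ⟨hs.1.le, hs.2.le⟩ ⟨ht.1.le, ht.2.le⟩ hst
      rw [abs_of_nonpos (by linarith)]; ring
  · refine ⟨fun t => - T t, fun t => - deriv T t, _,
      fun t ht => (S.diff t ⟨hac.le.trans ht.1.le, ht.2.le⟩).hasDerivAt.neg, ?_, ?_, S.conv2, ?_, ?_⟩
    · intro t ht
      have := S.deriv_neg ht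
      have : 0 < |deriv T t| := abs_pos.2 this.ne
      positivity
    · intro t ht
      have := S.deriv_neg ht
      simp only [abs_of_neg this]
      exact g_sq (neg_pos.2 this)
    · intro t ht; exact abs_of_neg (S.deriv_neg ht)
    · intro s hs t ht hst
      have := S.orient.2.antitoneOn ⟨hs.1.le, hs.2.le⟩ ⟨ht.1.le, ht.2.le⟩ hst
      rw [abs_of_nonneg (by linarith)]; ring

theorem side_sub {u v : ℝ} (h : (u = a ∧ v = c) ∨ (u = c ∧ v = b)) : u < v ∧ Icc u v ⊆ Icc a b := by
  have hac := S.uni.hac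
  have hcb := S.uni.hcb
  rcases h with ⟨rfl, rfl⟩ | ⟨rfl, rfl⟩
  · exact ⟨hac, Icc_subset_Icc_right hcb.le⟩
  · exact ⟨hcb, Icc_subset_Icc_left hac.le⟩

theorem E1_lt {u v x y : ℝ} (h : (u = a ∧ v = c) ∨ (u = c ∧ v = b)) (hx : x ∈ Icc u v) (hy : y ∈ Icc u v)
    (hxy : x < y) : |deriv T x| * |deriv T y| * (x - y) ^ 2 ≤ (T x - T y) ^ 2 := by
  obtain ⟨huv, hsub⟩ := S.side_sub h
  obtain ⟨f, f', g, h1, h2, h3, h4, h5, h6⟩ := S.side_data u v h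
  have key : ∀ x ∈ Ioo u v, ∀ y ∈ Ioo u v, x < y →
      |deriv T x| * |deriv T y| * (x - y) ^ 2 ≤ (T x - T y) ^ 2 := by
    intro x hx y hy hxy
    have e := one_step_E hx hy hxy h1 h2 h3 h4
    have gx := h2 x hx
    have gy := h2 y hy
    rw [h5 x hx, h5 y hy, h3 x hx, h3 y hy]
    have e2 := h6 x hx y hy hxy.le
    have e3 : (T x - T y) ^ 2 = (f y - f x) ^ 2 := by rw [← sq_abs, e2]
    rw [e3]
    have e4 : (y - x) ^ 2 ≤ (g x * g y * (f y - f x)) ^ 2 :=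
      pow_le_pow_left₀ (by linarith) e 2
    rw [show 1 / g x ^ 2 * (1 / g y ^ 2) * (x - y) ^ 2 = (y - x) ^ 2 / (g x * g y) ^ 2 by
      field_simp; ring, div_le_iff₀ (by positivity)]
    linarith
  obtain ⟨sx, tx⟩ := shrink_seq huv hx
  obtain ⟨sy, ty⟩ := shrink_seq huv hy
  have cT : ∀ z ∈ Icc u v, Filter.Tendsto (fun n : ℕ => T (z + ((u + v) / 2 - z) / (n + 2))) Filter.atTop (nhds (T z)) :=
    fun z hz => (S.diff z (hsub hz)).continuousAt.tendsto.comp (shrink_seq huv hz).2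
  have cD : ∀ z ∈ Icc u v, Filter.Tendsto (fun n : ℕ => |deriv T (z + ((u + v) / 2 - z) / (n + 2))|) Filter.atTop
      (nhds |deriv T z|) := by
    intro z hz
    have := (S.dcont z (hsub hz)).abs
    exact this.tendsto.comp (tendsto_nhdsWithin_iff.2 ⟨(shrink_seq huv hz).2,
      Filter.Eventually.of_forall (fun n => hsub (Ioo_subset_Icc_self ((shrink_seq huv hz).1 n)))⟩)
  refine le_of_tendsto_of_tendsto' (((cD x hx).mul (cD y hy)).mul ((tx.sub ty).pow 2))
    (((cT x hx).sub (cT y hy)).pow 2) ?_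
  intro n
  apply key _ (sx n) _ (sy n)
  have hn : (0:ℝ) < (n:ℝ) + 2 := by positivity
  rw [← sub_pos]
  have : y + ((u + v) / 2 - y) / (n + 2) - (x + ((u + v) / 2 - x) / (n + 2)) = (y - x) * (n + 1) / (n + 2) := by
    field_simp; ring
  rw [this]
  have : 0 < y - x := by linarith
  positivity

theorem side_of_ss {x y : ℝ} (hx : x ∈ Icc a b) (hy : y ∈ Icc a b) (hs : SS c x y) :
    ∃ u v, ((u = a ∧ v = c) ∨ (u = c ∧ v = b)) ∧ x ∈ Icc u v ∧ y ∈ Icc u v := by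
  rcases hs with hs | hs
  · exact ⟨a, c, Or.inl ⟨rfl, rfl⟩, ⟨hx.1, hs.1⟩, ⟨hy.1, hs.2⟩⟩
  · exact ⟨c, b, Or.inr ⟨rfl, rfl⟩, ⟨hs.1, hx.2⟩, ⟨hs.2, hy.2⟩⟩

theorem E1 {x y : ℝ} (hx : x ∈ Icc a b) (hy : y ∈ Icc a b) (hs : SS c x y) :
    |deriv T x| * |deriv T y| * (x - y) ^ 2 ≤ (T x - T y) ^ 2 := by
  obtain ⟨u, v, h, hx', hy'⟩ := S.side_of_ss hx hy hs
  rcases lt_trichotomy x y with hxy | hxy | hxy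
  · exact S.E1_lt h hx' hy' hxy
  · subst hxy; simp
  · have := S.E1_lt h hy' hx' hxy
    calc _ = |deriv T y| * |deriv T x| * (y - x) ^ 2 := by ring
      _ ≤ _ := this
      _ = _ := by ring

theorem CR1_lt {u v l x r : ℝ} (h : (u = a ∧ v = c) ∨ (u = c ∧ v = b)) (hl : l ∈ Icc u v) (hr : r ∈ Icc u v)
    (hlx : l < x) (hxr : x < r) : |T l - T x| * |T x - T r| * |l - r| ≤
      |deriv T x| * (|T l - T r| * (|l - x| * |x - r|)) := by
  obtain ⟨huv, hsub⟩ := S.side_sub h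
  obtain ⟨f, f', g, h1, h2, h3, h4, h5, h6⟩ := S.side_data u v h
  have hx : x ∈ Icc u v := ⟨hl.1.trans hlx.le, hxr.le.trans hr.2⟩
  have key : ∀ l ∈ Ioo u v, ∀ x, ∀ r ∈ Ioo u v, l < x → x < r → |T l - T x| * |T x - T r| * |l - r| ≤
      |deriv T x| * (|T l - T r| * (|l - x| * |x - r|)) := by
    intro l hl x r hr hlx hxr
    have hx : x ∈ Ioo u v := ⟨hl.1.trans hlx, hxr.trans hr.2⟩
    have e := one_step_CR hl hr hlx hxr h1 h2 h3 h4
    rw [h5 x hx, h6 l hl x hx hlx.le, h6 x hx r hr hxr.le, h6 l hl r hr (hlx.trans hxr).le,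
      abs_of_neg (by linarith : l - r < 0), abs_of_neg (by linarith : l - x < 0),
      abs_of_neg (by linarith : x - r < 0)]
    simpa only [neg_sub] using e
  have cT : ∀ z ∈ Icc u v, Filter.Tendsto (fun n : ℕ => T (z + ((u + v) / 2 - z) / (n + 2))) Filter.atTop (nhds (T z)) :=
    fun z hz => (S.diff z (hsub hz)).continuousAt.tendsto.comp (shrink_seq huv hz).2
  have cD : ∀ z ∈ Icc u v, Filter.Tendsto (fun n : ℕ => |deriv T (z + ((u + v) / 2 - z) / (n + 2))|) Filter.atTop
      (nhds |deriv T z|) := by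
    intro z hz
    have := (S.dcont z (hsub hz)).abs
    exact this.tendsto.comp (tendsto_nhdsWithin_iff.2 ⟨(shrink_seq huv hz).2,
      Filter.Eventually.of_forall (fun n => hsub (Ioo_subset_Icc_self ((shrink_seq huv hz).1 n)))⟩)
  have c0 := fun z (hz : z ∈ Icc u v) => (shrink_seq huv hz).2
  have m0 := fun z (hz : z ∈ Icc u v) => (shrink_seq huv hz).1
  have ord : ∀ x y : ℝ, x < y → ∀ n : ℕ, x + ((u + v) / 2 - x) / (n + 2) < y + ((u + v) / 2 - y) / (n + 2) := by
    intro x y hxy n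
    have hn : (0:ℝ) < (n:ℝ) + 2 := by positivity
    rw [← sub_pos]
    have : y + ((u + v) / 2 - y) / (n + 2) - (x + ((u + v) / 2 - x) / (n + 2)) = (y - x) * (n + 1) / (n + 2) := by
      field_simp; ring
    rw [this]
    have : 0 < y - x := by linarith
    positivity
  refine le_of_tendsto_of_tendsto'
    ((((cT l hl).sub (cT x hx)).abs.mul ((cT x hx).sub (cT r hr)).abs).mul ((c0 l hl).sub (c0 r hr)).abs)
    ((cD x hx).mul (((cT l hl).sub (cT r hr)).abs.mul
      (((c0 l hl).sub (c0 x hx)).abs.mul ((c0 x hx).sub (c0 r hr)).abs))) ?_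
  intro n
  exact key _ (m0 l hl n) _ _ (m0 r hr n) (ord _ _ hlx n) (ord _ _ hxr n)

theorem CR1 {l x r : ℝ} (hl : l ∈ Icc a b) (hr : r ∈ Icc a b) (hs : SS c l r) (hx : x ∈ uIcc l r) :
    |T l - T x| * |T x - T r| * |l - r| ≤ |deriv T x| * (|T l - T r| * (|l - x| * |x - r|)) := by
  obtain ⟨u, v, h, hl', hr'⟩ := S.side_of_ss hl hr hs
  by_cases e1 : l = x
  · subst e1; simp
  by_cases e2 : x = r
  · subst e2; simp
  rw [mem_uIcc] at hx
  rcases hx with ⟨p, q⟩ | ⟨p, q⟩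
  · exact S.CR1_lt h hl' hr' (lt_of_le_of_ne p e1) (lt_of_le_of_ne q e2)
  · have := S.CR1_lt h hr' hl' (lt_of_le_of_ne p (Ne.symm e2)) (lt_of_le_of_ne q (Ne.symm e1))
    rw [abs_sub_comm (T l) (T x), abs_sub_comm (T x) (T r), abs_sub_comm l r, abs_sub_comm (T l) (T r),
      abs_sub_comm l x, abs_sub_comm x r]
    calc _ = _ := by ring
      _ ≤ _ := this
      _ = _ := by ring

end SCE


namespace SCE
variable {α K₁ K₂ C0 lam : ℝ} (S : SCE T a b c α K₁ K₂ C0 lam)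
include S

theorem itmem {x : ℝ} (hx : x ∈ Icc a b) (n : ℕ) : T^[n] x ∈ Icc a b := S.uni.iter_mem hx n

theorem En {n : ℕ} {x y : ℝ} (hx : x ∈ Icc a b) (hy : y ∈ Icc a b) (r : URel T c n x y) :
    Dn T n x * Dn T n y * (x - y) ^ 2 ≤ (T^[n] x - T^[n] y) ^ 2 := by
  induction n with
  | zero => simp [Dn_zero]
  | succ n ih =>
    rw [URel.succ_iff'] at r
    have h1 := ih r.1
    have h2 := S.E1 (S.itmem hx n) (S.itmem hy n) r.2
    rw [Function.iterate_succ_apply', Function.iterate_succ_apply', Dn_succ, Dn_succ]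
    refine le_trans ?_ h2
    calc _ = |deriv T (T^[n] x)| * |deriv T (T^[n] y)| * (Dn T n x * Dn T n y * (x - y) ^ 2) := by ring
      _ ≤ _ := by gcongr

theorem CRn {n : ℕ} {l r x : ℝ} (hl : l ∈ Icc a b) (hr : r ∈ Icc a b) (R : URel T c n l r) (hx : x ∈ uIcc l r) :
    |T^[n] l - T^[n] x| * |T^[n] x - T^[n] r| * |l - r| ≤
      Dn T n x * (|T^[n] l - T^[n] r| * (|l - x| * |x - r|)) := by
  induction n with
  | zero => simp [Dn_zero]; exact le_of_eq (by ring)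
  | succ n ih =>
    have R' := R.mono (Nat.le_succ n)
    have hss := (URel.succ_iff'.1 R).2
    by_cases hlr : l = r
    · subst hlr
      simp at hx; subst hx; simp
    have hW : 0 < |T^[n] l - T^[n] r| := by
      rw [abs_pos, sub_ne_zero]
      intro e; exact hlr (S.uni.rel_inj hl hr R' le_rfl e)
    have h1 := ih R'
    have h2 := S.CR1 (S.itmem hl n) (S.itmem hr n) hss (S.uni.rel_between hl hr R' hx le_rfl)
    rw [Function.iterate_succ_apply', Function.iterate_succ_apply', Function.iterate_succ_apply', Dn_succ]
    refine le_of_mul_le_mul_right ?_ hW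
    calc _ = |T (T^[n] l) - T (T^[n] x)| * |T (T^[n] x) - T (T^[n] r)| * |T^[n] l - T^[n] r| * |l - r| := by ring
      _ ≤ |deriv T (T^[n] x)| * (|T (T^[n] l) - T (T^[n] r)| * (|T^[n] l - T^[n] x| * |T^[n] x - T^[n] r|)) * |l - r| := by
        gcongr
      _ = |deriv T (T^[n] x)| * |T (T^[n] l) - T (T^[n] r)| * (|T^[n] l - T^[n] x| * |T^[n] x - T^[n] r| * |l - r|) := by ring
      _ ≤ |deriv T (T^[n] x)| * |T (T^[n] l) - T (T^[n] r)| * (Dn T n x * (|T^[n] l - T^[n] r| * (|l - x| * |x - r|))) := by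
        gcongr
      _ = _ := by ring

theorem mvt (n : ℕ) {x y : ℝ} (hx : x ∈ Icc a b) (hy : y ∈ Icc a b) :
    ∃ ξ ∈ uIcc x y, |T^[n] x - T^[n] y| = Dn T n ξ * |x - y| := by
  wlog hxy : x < y generalizing x y
  · rcases eq_or_lt_of_le (not_lt.1 hxy) with e | e
    · subst e; exact ⟨y, left_mem_uIcc, by simp⟩
    · obtain ⟨ξ, h1, h2⟩ := this hy hx e
      exact ⟨ξ, uIcc_comm' h1, by rw [abs_sub_comm, h2, abs_sub_comm x]⟩
  have hd : ∀ z ∈ Icc a b, DifferentiableAt ℝ (T^[n]) z := fun z hz => by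
    obtain ⟨d, h, _⟩ := hasDeriv_iter S.uni.maps S.diff n hz
    exact h.differentiableAt
  have hsub : Icc x y ⊆ Icc a b := Icc_subset_Icc hx.1 hy.2
  obtain ⟨ξ, h1, h2⟩ := exists_deriv_eq_slope (T^[n]) hxy
    (fun z hz => (hd z (hsub hz)).continuousAt.continuousWithinAt)
    (fun z hz => (hd z (hsub (Ioo_subset_Icc_self hz))).differentiableWithinAt)
  obtain ⟨d, h3, h4⟩ := hasDeriv_iter S.uni.maps S.diff n (hsub (Ioo_subset_Icc_self h1))
  refine ⟨ξ, by rw [uIcc_of_le hxy.le]; exact Ioo_subset_Icc_self h1, ?_⟩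
  have hne : y - x ≠ 0 := by linarith
  rw [← h4, ← h3.deriv, h2, abs_sub_comm x y, ← abs_mul, abs_sub_comm]
  congr 1; field_simp

omit S in
/-- distance additivity -/
theorem _root_.abs_add_of_mem {x y z : ℝ} (h : z ∈ uIcc x y) : |x - z| + |z - y| = |x - y| := by
  rw [mem_uIcc] at h
  rcases h with h | h
  · rw [abs_of_nonpos (by linarith), abs_of_nonpos (by linarith), abs_of_nonpos (by linarith)]; ring
  · rw [abs_of_nonneg (by linarith), abs_of_nonneg (by linarith), abs_of_nonneg (by linarith)]; ring

theorem koebe {n : ℕ} {l u v r m : ℝ} (hl : l ∈ Icc a b) (hr : r ∈ Icc a b) (R : URel T c n l r)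
    (hu : u ∈ uIcc l r) (hv : v ∈ uIcc u r) (hm0 : 0 ≤ m) (hmL : m ≤ |T^[n] l - T^[n] u|)
    (hmR : m ≤ |T^[n] v - T^[n] r|) :
    m * |u - v| ≤ 2 * |T^[n] u - T^[n] v| * |l - v| ∧ m * |u - v| ≤ 2 * |T^[n] u - T^[n] v| * |u - r| := by
  have hum := uIcc_sub_Icc hl hr hu
  have hvm := uIcc_sub_Icc hum hr hv
  have hvlr : v ∈ uIcc l r := mem_uIcc_trans' hu hv
  obtain ⟨ξ, hξ, e⟩ := S.mvt n hum hvm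
  have hξr : ξ ∈ uIcc u r := mem_uIcc_trans hv hξ
  have hξlr : ξ ∈ uIcc l r := mem_uIcc_trans' hu hξr
  have cr := S.CRn hl hr R hξlr
  by_cases hlr : l = r
  · subst hlr
    simp at hu hvlr; subst hu; subst hvlr; simp
  have hlr' : 0 < |l - r| := abs_pos.2 (sub_ne_zero.2 hlr)
  -- ordering of images
  have ulξ : u ∈ uIcc l ξ := by rw [mem_uIcc] at *; grind
  have vξr : v ∈ uIcc ξ r := by rw [mem_uIcc] at *; grind
  have ξlv : ξ ∈ uIcc l v := by rw [mem_uIcc] at *; grind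
  have hξm := uIcc_sub_Icc hl hr hξlr
  have i1 := abs_add_of_mem (S.uni.rel_between hl hξm (S.uni.rel_left hl hr R hξlr) ulξ le_rfl)
  have i2 := abs_add_of_mem (S.uni.rel_between hξm hr (S.uni.rel_right hl hr R hξlr) vξr le_rfl)
  have i3 := abs_add_of_mem (S.uni.rel_between hl hr R hξlr le_rfl)
  have j1 := abs_add_of_mem hξr
  have j2 := abs_add_of_mem ξlv
  have j3 := abs_add_of_mem hξlr
  set L := |T^[n] l - T^[n] ξ|
  set Q := |T^[n] ξ - T^[n] r|
  set W := |T^[n] l - T^[n] r|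
  have hL : m ≤ L := by have := abs_nonneg (T^[n] u - T^[n] ξ); linarith
  have hQ : m ≤ Q := by have := abs_nonneg (T^[n] ξ - T^[n] v); linarith
  have hD := Dn_nonneg (T := T) n ξ
  have k0 := abs_nonneg (u - v)
  rcases hm0.eq_or_lt with hm0 | hm0
  · rw [← hm0]; simp only [zero_mul]
    exact ⟨by positivity, by positivity⟩
  have hW : 0 < W := by linarith
  -- m*W ≤ 2*L*Q
  have key : m * W ≤ 2 * (L * Q) := by
    rw [← i3]; nlinarith
  have main : m * |u - v| * |l - r| ≤ 2 * |T^[n] u - T^[n] v| * (|l - ξ| * |ξ - r|) := by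
    refine le_of_mul_le_mul_left ?_ hW
    calc W * (m * |u - v| * |l - r|) = (m * W) * (|u - v| * |l - r|) := by ring
      _ ≤ (2 * (L * Q)) * (|u - v| * |l - r|) := by gcongr
      _ = 2 * |u - v| * (L * Q * |l - r|) := by ring
      _ ≤ 2 * |u - v| * (Dn T n ξ * (W * (|l - ξ| * |ξ - r|))) := by gcongr
      _ = W * (2 * (Dn T n ξ * |u - v|) * (|l - ξ| * |ξ - r|)) := by ring
      _ = _ := by rw [← e]
  have a1 := abs_nonneg (l - ξ)
  have a2 := abs_nonneg (ξ - r)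
  have a3 := abs_nonneg (u - ξ)
  have a4 := abs_nonneg (ξ - v)
  have a5 := abs_nonneg (T^[n] u - T^[n] v)
  constructor
  · refine le_of_mul_le_mul_right (main.trans ?_) hlr'
    rw [mul_assoc (2 * _)]
    exact mul_le_mul_of_nonneg_left (mul_le_mul (by linarith) (by linarith) a2 (by linarith)) (by linarith)
  · refine le_of_mul_le_mul_right (main.trans ?_) hlr'
    rw [mul_assoc (2 * _), mul_comm (|l - ξ|)]
    exact mul_le_mul_of_nonneg_left (mul_le_mul (by linarith) (by linarith) a1 (by linarith)) (by linarith)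

/-- minimum principle -/
theorem minp {n : ℕ} {x y w : ℝ} (hx : x ∈ Icc a b) (hy : y ∈ Icc a b) (R : URel T c n x y) (hw : w ∈ uIcc x y) :
    min (Dn T n x) (Dn T n y) ≤ Dn T n w := by
  have hwm := uIcc_sub_Icc hx hy hw
  by_contra hcon
  push Not at hcon
  rw [lt_min_iff] at hcon
  have hxw : x ≠ w := by rintro rfl; exact lt_irrefl _ hcon.1
  have hyw : w ≠ y := by rintro rfl; exact lt_irrefl _ hcon.2
  have e1 := S.En hx hwm (S.uni.rel_left hx hy R hw)
  have e2 := S.En hwm hy (S.uni.rel_right hx hy R hw)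
  have cr := S.CRn hx hy R hw
  have i1 := abs_add_of_mem (S.uni.rel_between hx hy R hw le_rfl)
  have i2 := abs_add_of_mem hw
  have p1 : 0 < |x - w| := abs_pos.2 (sub_ne_zero.2 hxw)
  have p2 : 0 < |w - y| := abs_pos.2 (sub_ne_zero.2 hyw)
  have n1 : 0 < |T^[n] x - T^[n] w| := abs_pos.2 (sub_ne_zero.2 fun e =>
    hxw (S.uni.rel_inj hx hwm (S.uni.rel_left hx hy R hw) le_rfl e))
  have n2 : 0 < |T^[n] w - T^[n] y| := abs_pos.2 (sub_ne_zero.2 fun e =>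
    hyw (S.uni.rel_inj hwm hy (S.uni.rel_right hx hy R hw) le_rfl e))
  rw [← sq_abs, ← sq_abs (T^[n] x - _)] at e1
  rw [← sq_abs, ← sq_abs (T^[n] w - _)] at e2
  rw [← i1, ← i2] at cr
  set A := |T^[n] x - T^[n] w|
  set B := |T^[n] w - T^[n] y|
  set p := |x - w|
  set q := |w - y|
  have hD := Dn_nonneg (T := T) n w
  -- Dw * p < A, Dw * q < B
  have s1 : Dn T n w * p < A := by
    by_contra h; push Not at h
    have : A ^ 2 ≤ (Dn T n w * p) ^ 2 := by gcongr
    have hp : 0 < Dn T n w := by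
      by_contra h0; have : Dn T n w = 0 := le_antisymm (not_lt.1 h0) hD
      rw [this] at h; linarith
    have : Dn T n x * (Dn T n w * p ^ 2) ≤ Dn T n w * (Dn T n w * p ^ 2) := by nlinarith
    have := le_of_mul_le_mul_right this (by positivity)
    linarith [hcon.1]
  have s2 : Dn T n w * q < B := by
    by_contra h; push Not at h
    have : B ^ 2 ≤ (Dn T n w * q) ^ 2 := by gcongr
    have hp : 0 < Dn T n w := by
      by_contra h0; have : Dn T n w = 0 := le_antisymm (not_lt.1 h0) hD
      rw [this] at h; linarith
    have : Dn T n y * (Dn T n w * q ^ 2) ≤ Dn T n w * (Dn T n w * q ^ 2) := by nlinarith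
    have := le_of_mul_le_mul_right this (by positivity)
    linarith [hcon.2]
  -- cr: A*B*(p+q) ≤ Dw*((A+B)*(p*q))
  have t1 : A * (Dn T n w * q) * p < A * B * p := by
    have := mul_lt_mul_of_pos_left s2 n1
    exact mul_lt_mul_of_pos_right this p1
  have t2 : (Dn T n w * p) * B * q < A * B * q := by
    have := mul_lt_mul_of_pos_right s1 n2
    exact mul_lt_mul_of_pos_right this p2
  nlinarith

end SCE


/-- uniform small constant for finitely many indices -/
theorem unif_small (P : ℕ → ℝ → Prop) (hP : ∀ n s t, 0 < s → s ≤ t → P n t → P n s)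
    (h : ∀ n, ∃ t, 0 < t ∧ P n t) (N : ℕ) : ∃ t, 0 < t ∧ ∀ n < N, P n t := by
  induction N with
  | zero => exact ⟨1, one_pos, fun n hn => absurd hn (Nat.not_lt_zero n)⟩
  | succ N ih =>
    obtain ⟨t, ht, h1⟩ := ih
    obtain ⟨t', ht', h2⟩ := h N
    refine ⟨min t t', lt_min ht ht', fun n hn => ?_⟩
    rcases Nat.lt_succ_iff_lt_or_eq.1 hn with h3 | rfl
    · exact hP n _ _ (lt_min ht ht') (min_le_left _ _) (h1 n h3)
    · exact hP n _ _ (lt_min ht ht') (min_le_right _ _) h2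

theorem abs_sub_le_of_mem {x y : ℝ} (hx : x ∈ Icc a b) (hy : y ∈ Icc a b) : |x - y| ≤ b - a := by
  rw [abs_le]; exact ⟨by linarith [hx.1, hy.2], by linarith [hx.2, hy.1]⟩

theorem abs_le_of_mem_uIcc {x y : ℝ} (hx : x ∈ uIcc c y) : |x - c| ≤ |y - c| := by
  have := abs_add_of_mem hx
  rw [abs_sub_comm c x, abs_sub_comm c y] at this
  linarith [abs_nonneg (x - y)]

theorem isClosed_SS (c : ℝ) : IsClosed {p : ℝ × ℝ | SS c p.1 p.2} := by
  unfold SS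
  apply IsClosed.union
  · exact (isClosed_le continuous_fst continuous_const).inter (isClosed_le continuous_snd continuous_const)
  · exact (isClosed_le continuous_const continuous_fst).inter (isClosed_le continuous_const continuous_snd)

theorem IsUnimodal.isCompact_rel (h : IsUnimodal T a b c) (n : ℕ) :
    IsCompact {p : ℝ × ℝ | p.1 ∈ Icc a b ∧ p.2 ∈ Icc a b ∧ URel T c n p.1 p.2} := by
  have hK : IsCompact (Icc a b ×ˢ Icc a b : Set (ℝ × ℝ)) := isCompact_Icc.prod isCompact_Icc
  have : {p : ℝ × ℝ | p.1 ∈ Icc a b ∧ p.2 ∈ Icc a b ∧ URel T c n p.1 p.2} =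
      (Icc a b ×ˢ Icc a b) ∩ ⋂ k : ℕ, ⋂ _ : k < n, ((Icc a b ×ˢ Icc a b) ∩
        (fun p : ℝ × ℝ => (T^[k] p.1, T^[k] p.2)) ⁻¹' {p | SS c p.1 p.2}) := by
    ext p
    simp only [mem_ofPred_eq, mem_inter_iff, mem_prod, mem_iInter, mem_preimage, URel]
    constructor
    · rintro ⟨h1, h2, h3⟩; exact ⟨⟨h1, h2⟩, fun k hk => ⟨⟨h1, h2⟩, h3 k hk⟩⟩
    · rintro ⟨⟨h1, h2⟩, h3⟩; exact ⟨h1, h2, fun k hk => (h3 k hk).2⟩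
  rw [this]
  apply hK.inter_right
  refine isClosed_iInter fun k => isClosed_iInter fun _ => ?_
  refine ContinuousOn.preimage_isClosed_of_isClosed ?_ hK.isClosed (isClosed_SS c)
  exact ((h.contIter k).comp continuousOn_fst (fun p hp => hp.1)).prodMk
    ((h.contIter k).comp continuousOn_snd (fun p hp => hp.2))

theorem IsUnimodal.isCompact_relc (h : IsUnimodal T a b c) (n : ℕ) :
    IsCompact {y : ℝ | y ∈ Icc a b ∧ URel T c n y c} := by
  have : {y : ℝ | y ∈ Icc a b ∧ URel T c n y c} = Prod.fst ''
      ({p : ℝ × ℝ | p.1 ∈ Icc a b ∧ p.2 ∈ Icc a b ∧ URel T c n p.1 p.2} ∩ {p | p.2 = c}) := by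
    ext y
    constructor
    · rintro ⟨h1, h2⟩; exact ⟨(y, c), ⟨⟨h1, h.cmem, h2⟩, rfl⟩, rfl⟩
    · rintro ⟨⟨u, v⟩, ⟨⟨h1, h2, h3⟩, h4⟩, rfl⟩
      simp at h4; subst h4; exact ⟨h1, h3⟩
  rw [this]
  exact ((h.isCompact_rel n).inter_right (isClosed_eq continuous_snd continuous_const)).image continuous_fst

namespace SCE
variable {α K₁ K₂ C0 lam : ℝ} (S : SCE T a b c α K₁ K₂ C0 lam)
include S

theorem hab : 0 < b - a := by linarith [S.uni.hac, S.uni.hcb]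

theorem K2_ge : K₁ ≤ K₂ := by
  have h1 := S.low a S.uni.amem
  have h2 := S.up a S.uni.amem
  have : 0 < |a - c| := abs_pos.2 (sub_ne_zero.2 S.uni.hac.ne)
  exact le_of_mul_le_mul_right (h1.trans h2) (Real.rpow_pos_of_pos this _)

theorem K2_pos : 0 < K₂ := S.hK₁.trans_le S.K2_ge

omit S in
theorem _root_.Dn_one' (x : ℝ) : Dn T 1 x = |deriv T x| := by simp [Dn]

theorem lev_up {x : ℝ} (hx : x ∈ Icc a b) : lev T c x ≤ K₂ * |x - c| ^ α := by
  obtain ⟨ξ, h1, h2⟩ := S.mvt 1 hx S.uni.cmem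
  rw [Dn_one'] at h2
  have h3 := S.up ξ (uIcc_sub_Icc hx S.uni.cmem h1)
  have h4 := abs_le_of_mem_uIcc (uIcc_comm' h1)
  have hK := S.K2_pos
  have hα := S.hα
  unfold lev
  calc |T x - T c| = _ := h2
    _ ≤ (K₂ * |ξ - c| ^ (α - 1)) * |x - c| := by gcongr
    _ ≤ (K₂ * |x - c| ^ (α - 1)) * |x - c| := by gcongr
    _ = _ := by
      by_cases hxc : x = c
      · subst hxc; simp [Real.zero_rpow (by linarith : α ≠ 0)]
      have : 0 < |x - c| := abs_pos.2 (sub_ne_zero.2 hxc)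
      rw [mul_assoc, ← Real.rpow_add_one this.ne']; simp

theorem lev_low {x : ℝ} (hx : x ∈ Icc a b) : K₁ * (|x - c| / 2) ^ α ≤ lev T c x := by
  have hα := S.hα
  by_cases hxc : x = c
  · subst hxc; simp [Real.zero_rpow (by linarith : α ≠ 0), lev]
  have hm : (x + c) / 2 ∈ uIcc c x := by
    rw [mem_uIcc]; rcases le_total c x with h | h
    · left; constructor <;> linarith
    · right; constructor <;> linarith
  have hmm := uIcc_sub_Icc S.uni.cmem hx hm
  obtain ⟨ξ, h1, h2⟩ := S.mvt 1 hx hmm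
  rw [Dn_one'] at h2
  have h3 := S.low ξ (uIcc_sub_Icc hx hmm h1)
  have h5 : (x + c) / 2 - c = (x - c) / 2 := by ring
  have h6 : x - (x + c) / 2 = (x - c) / 2 := by ring
  have h4 : |x - c| / 2 ≤ |ξ - c| := by
    rw [mem_uIcc] at h1
    rcases le_total c x with h | h
    · rw [abs_of_nonneg (by linarith)]
      exact le_trans (by grind) (le_abs_self _)
    · rw [abs_of_nonpos (by linarith)]
      exact le_trans (by grind) (neg_le_abs _)
  have h7 : |T x - T ((x + c) / 2)| ≤ lev T c x := by
    have := abs_add_of_mem (S.uni.ss_between S.uni.cmem hx (SS.self_c x).symm hm)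
    unfold lev
    rw [abs_sub_comm (T x), abs_sub_comm (T x)]
    linarith [abs_nonneg (T c - T ((x + c) / 2))]
  refine le_trans ?_ h7
  simp only [Function.iterate_one] at h2
  rw [h2, h6, abs_div, abs_two]
  have : 0 < |x - c| / 2 := by have := abs_pos.2 (sub_ne_zero.2 hxc); positivity
  have hK := S.hK₁
  calc K₁ * (|x - c| / 2) ^ α = K₁ * (|x - c| / 2) ^ (α - 1) * (|x - c| / 2) := by
        rw [mul_assoc, ← Real.rpow_add_one this.ne']; simp
    _ ≤ K₁ * |ξ - c| ^ (α - 1) * (|x - c| / 2) := by gcongr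
    _ ≤ _ := by gcongr

theorem lev_dist : ∃ G, 1 ≤ G ∧ ∀ x ∈ Icc a b, ∀ y ∈ Icc a b, lev T c x ≤ lev T c y → |x - c| ≤ G * |y - c| := by
  have hK := S.hK₁
  have hK2 := S.K2_pos
  have hα : 0 < α := by linarith [S.hα]
  refine ⟨2 * (K₂ / K₁) ^ (1 / α), ?_, ?_⟩
  · have : 1 ≤ (K₂ / K₁) ^ (1 / α) := Real.one_le_rpow (by rw [one_le_div hK]; exact S.K2_ge) (by positivity)
    linarith
  · intro x hx y hy hl
    have h1 := (S.lev_low hx).trans (hl.trans (S.lev_up hy))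
    have h2 : (|x - c| / 2) ^ α ≤ ((K₂ / K₁) ^ (1 / α) * |y - c|) ^ α := by
      rw [Real.mul_rpow (by positivity) (by positivity), ← Real.rpow_mul (by positivity),
        one_div_mul_cancel hα.ne', Real.rpow_one, div_mul_eq_mul_div, le_div_iff₀ hK]
      linarith
    have h3 := (Real.rpow_le_rpow_iff (by positivity) (by positivity) hα).1 h2
    linarith

theorem Dn_cs (s : ℕ) : C0 * lam ^ (s + 1) ≤ Dn T s (T c) * (K₂ * |T^[s + 1] c - c| ^ (α - 1)) := by
  have h1 := S.ce (s + 1)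
  rw [Dn_succ] at h1
  have h2 := S.up (T^[s + 1] c) (S.itmem S.uni.cmem _)
  rw [← Function.iterate_succ_apply] at h1
  exact h1.trans (mul_le_mul_of_nonneg_left h2 (Dn_nonneg _ _))

theorem cs_ne {s : ℕ} (hs : 1 ≤ s) : T^[s] c ≠ c := by
  intro e
  obtain ⟨s, rfl⟩ : ∃ k, s = k + 1 := ⟨s - 1, by omega⟩
  have h := S.Dn_cs s
  rw [e] at h
  have hα := S.hα
  rw [sub_self, abs_zero, Real.zero_rpow (by linarith)] at h
  have h1 := S.hC0
  have h2 : 0 < lam := by linarith [S.hlam]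
  have : 0 < C0 * lam ^ (s + 1) := by positivity
  simp at h; linarith

theorem F2 {s : ℕ} {l y : ℝ} (hl : l ∈ Icc a b) (R : URel T c (s + 1) l c) (hy : y ∈ uIcc c l) (hyc : y ≠ c) :
    |T^[s + 1] l - T^[s + 1] y| * (lev T c y * Dn T s (T c)) ≤
      |T^[s + 1] y - T^[s + 1] c| * (|T^[s + 1] y - T^[s + 1] c| + |T^[s + 1] l - T^[s + 1] y|) := by
  have hc := S.uni.cmem
  have hym := uIcc_sub_Icc hc hl hy
  obtain ⟨hss, R'⟩ := URel.succ_iff.1 R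
  have hTy := S.uni.ss_between hl hc hss (uIcc_comm' hy)
  have hTl := S.uni.maps hl
  have hTc := S.uni.maps hc
  have hTym := S.uni.maps hym
  have cr := S.CRn hTl hTc R' hTy
  have en := S.En hTym hTc (S.uni.rel_right hTl hTc R' hTy)
  have i1 := abs_add_of_mem (S.uni.rel_between hTl hTc R' hTy le_rfl)
  have i2 := abs_add_of_mem hTy
  have hI : 0 < |T^[s] (T y) - T^[s] (T c)| := by
    rw [abs_pos, sub_ne_zero]
    intro e
    rw [← Function.iterate_succ_apply, ← Function.iterate_succ_apply] at e
    exact hyc (S.uni.rel_inj hym hc (S.uni.rel_right hl hc R (uIcc_comm' hy)) le_rfl e)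
  have hE : 0 < |T y - T c| := S.uni.lev_pos hym hyc
  rw [← sq_abs, ← sq_abs (T^[s] (T y) - _)] at en
  simp only [Function.iterate_succ_apply]
  unfold lev
  set X := |T^[s] (T l) - T^[s] (T y)|
  set I := |T^[s] (T y) - T^[s] (T c)|
  rw [← i1] at cr
  have p1 := abs_nonneg (T l - T y)
  have hDy := Dn_nonneg (T := T) s (T y)
  have hD := Dn_nonneg (T := T) s (T c)
  have hX : 0 ≤ X := abs_nonneg _
  have hLpos : 0 < |T l - T c| := by linarith
  have n1 : X * I * |T l - T c| * (Dn T s (T c) * |T y - T c| ^ 2) ≤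
      (X + I) * |T l - T c| * |T y - T c| * I ^ 2 := by
    calc _ ≤ Dn T s (T y) * ((X + I) * (|T l - T y| * |T y - T c|)) * (Dn T s (T c) * |T y - T c| ^ 2) := by gcongr
      _ = ((X + I) * (|T l - T y| * |T y - T c|)) * (Dn T s (T y) * Dn T s (T c) * |T y - T c| ^ 2) := by ring
      _ ≤ ((X + I) * (|T l - T c| * |T y - T c|)) * I ^ 2 := by
        have h9 : |T l - T y| ≤ |T l - T c| := by linarith
        gcongr
      _ = _ := by ring
  have hpos : 0 < I * |T l - T c| * |T y - T c| := by positivity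
  refine le_of_mul_le_mul_left ?_ hpos
  calc _ = X * I * |T l - T c| * (Dn T s (T c) * |T y - T c| ^ 2) := by ring
    _ ≤ _ := n1
    _ = _ := by ring

theorem no_ht_c {i : ℕ} (hi : 1 ≤ i) (H : ∀ n, URel T c n (T^[i] c) c) : False := by
  have hc := S.uni.cmem
  have hne := S.cs_ne hi
  have hTc := S.uni.maps hc
  have hci := S.itmem hc i
  have hne1 : T (T^[i] c) ≠ T c := fun e => hne (S.uni.ss_inj hci hc (SS.self_c _) e)
  have hab := S.hab
  have hC0 := S.hC0
  have hlam := S.hlam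
  have hlam0 : 0 < lam := by linarith
  have hlow : ∀ n, C0 * lam ^ n * (C0 * lam ^ n) * (T (T^[i] c) - T c) ^ 2 ≤ (b - a) ^ 2 * Dn T i (T c) := by
    intro n
    have en := S.En (S.uni.maps hci) hTc (URel.succ_iff.1 (H (n + 1))).2
    have e1 : Dn T i (T c) * Dn T n (T (T^[i] c)) = Dn T (i + n) (T c) := by
      rw [Dn_add, ← Function.iterate_succ_apply' T i c, Function.iterate_succ_apply]
    have c1 := S.ce n
    have c2 : C0 * lam ^ n ≤ Dn T (i + n) (T c) := le_trans (by
      gcongr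
      · exact hlam.le
      · omega) (S.ce (i + n))
    have hD := Dn_nonneg (T := T) i (T c)
    have hb : (T^[n] (T (T^[i] c)) - T^[n] (T c)) ^ 2 ≤ (b - a) ^ 2 := by
      rw [← sq_abs]
      have := abs_sub_le_of_mem (S.itmem (S.uni.maps hci) n) (S.itmem hTc n)
      gcongr
    calc C0 * lam ^ n * (C0 * lam ^ n) * (T (T^[i] c) - T c) ^ 2
        ≤ Dn T (i + n) (T c) * Dn T n (T c) * (T (T^[i] c) - T c) ^ 2 := by gcongr; exact Dn_nonneg _ _
      _ = Dn T i (T c) * (Dn T n (T (T^[i] c)) * Dn T n (T c) * (T (T^[i] c) - T c) ^ 2) := by rw [← e1]; ring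
      _ ≤ Dn T i (T c) * (b - a) ^ 2 := by gcongr; exact en.trans hb
      _ = _ := by ring
  have hpos : 0 < C0 * C0 * (T (T^[i] c) - T c) ^ 2 := by
    have := sub_ne_zero.2 hne1; positivity
  obtain ⟨n, hn⟩ := pow_unbounded_of_one_lt ((b - a) ^ 2 * Dn T i (T c) / (C0 * C0 * (T (T^[i] c) - T c) ^ 2)) hlam
  rw [div_lt_iff₀ hpos] at hn
  have h1 := hlow n
  have h2 : 1 ≤ lam ^ n := one_le_pow₀ hlam.le
  have : lam ^ n * (C0 * C0 * (T (T^[i] c) - T c) ^ 2) ≤ lam ^ n * lam ^ n * (C0 * C0 * (T (T^[i] c) - T c) ^ 2) := by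
    gcongr; nlinarith
  linarith

end SCE


theorem IsUnimodal.side_e (h : IsUnimodal T a b c) {x : ℝ} (hx : x ∈ Icc a b) :
    ∃ e, (e = a ∨ e = b) ∧ x ∈ uIcc e c := by
  rcases le_total x c with h1 | h1
  · exact ⟨a, Or.inl rfl, by rw [mem_uIcc]; exact Or.inl ⟨hx.1, h1⟩⟩
  · exact ⟨b, Or.inr rfl, by rw [mem_uIcc]; exact Or.inr ⟨h1, hx.2⟩⟩

namespace SCE
variable {α K₁ K₂ C0 lam : ℝ} (S : SCE T a b c α K₁ K₂ C0 lam)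
include S

theorem no_ht {y : ℝ} (hy : y ∈ Icc a b) (hyc : y ≠ c) (H : ∀ n, URel T c n y c) : False := by
  have h := S.uni
  have hc := h.cmem
  -- maximal
  have hcomp : IsCompact (⋂ n, {y : ℝ | y ∈ Icc a b ∧ URel T c n y c}) :=
    isCompact_Icc.of_isClosed_subset (isClosed_iInter fun n => (h.isCompact_relc n).isClosed)
      (fun z hz => (mem_iInter.1 hz 0).1)
  have hlc : ContinuousOn (lev T c) (⋂ n, {y : ℝ | y ∈ Icc a b ∧ URel T c n y c}) :=
    h.contLev.mono (fun z hz => (mem_iInter.1 hz 0).1)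
  obtain ⟨x, hx, hmax⟩ := hcomp.exists_isMaxOn ⟨y, mem_iInter.2 fun n => ⟨hy, H n⟩⟩ hlc
  have hxm : x ∈ Icc a b := (mem_iInter.1 hx 0).1
  have Hx : ∀ n, URel T c n x c := fun n => (mem_iInter.1 hx n).2
  have hxpos : 0 < lev T c x := lt_of_lt_of_le (h.lev_pos hy hyc) (hmax (mem_iInter.2 fun n => ⟨hy, H n⟩))
  have hxc : x ≠ c := by rintro rfl; simp [lev] at hxpos
  have A1 : ∀ i, T^[i] x ≠ c := by
    intro i e
    rcases Nat.eq_zero_or_pos i with rfl | hi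
    · exact hxc e
    · refine S.no_ht_c hi (fun n => ?_)
      have := (URel.add_iff.1 (Hx (i + n))).2
      rw [e] at this; exact this.symm
  have A2 : ∀ i, 1 ≤ i → lev T c x < lev T c (T^[i] x) := by
    intro i hi
    by_contra hcon
    push Not at hcon
    refine S.no_ht_c hi (fun n => ?_)
    have r1 : URel T c n (T^[i] x) c := h.rel_lev (S.itmem hxm i) hxm hcon (Hx n)
    have r2 : URel T c n (T^[i] x) (T^[i] c) := (URel.add_iff.1 (Hx (i + n))).2
    refine r2.via r1 (fun k _ => ?_)
    rw [← Function.iterate_add_apply]; exact A1 _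
  obtain ⟨e, he, hxe⟩ := h.side_e hxm
  have hxne : x ≠ e := by
    intro e1
    have := A2 1 le_rfl
    have h2 := h.lev_le_bd (S.itmem hxm 1) he
    rw [e1] at this h2; linarith
  -- bound on i
  have hC0 := S.hC0
  have hab := S.hab
  obtain ⟨N0, hN0⟩ := pow_unbounded_of_one_lt (2 * (b - a) ^ 2 / (lev T c x ^ 2 * C0)) S.hlam
  rw [div_lt_iff₀ (by positivity)] at hN0
  -- neighborhood
  have ev : ∀ᶠ z in nhdsWithin x (Icc a b), ∀ i ∈ Finset.range N0, T^[i] z ≠ c := by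
    rw [Filter.eventually_all_finset]
    intro i _
    exact (h.contIter i x hxm).eventually_ne (A1 i)
  obtain ⟨δ, hδ, hδ2⟩ := Metric.mem_nhdsWithin_iff.1 ev
  -- choose z
  obtain ⟨z, hz1, hz2, hz3⟩ : ∃ z ∈ uIcc e x, z ≠ x ∧ |z - x| < δ := by
    have hd : 0 < |e - x| := abs_pos.2 (sub_ne_zero.2 (Ne.symm hxne))
    set t := min (1:ℝ) (δ / (2 * |e - x|)) with ht
    have ht0 : 0 < t := lt_min one_pos (by positivity)
    have ht1 : t ≤ 1 := min_le_left _ _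
    have ht2 : t * |e - x| ≤ δ / 2 := by
      calc _ ≤ δ / (2 * |e - x|) * |e - x| := by gcongr; exact min_le_right _ _
        _ = _ := by field_simp
    refine ⟨x + t * (e - x), ?_, ?_, ?_⟩
    · rw [mem_uIcc]
      rcases le_total e x with h1 | h1
      · left; constructor <;> nlinarith
      · right; constructor <;> nlinarith
    · intro e1
      have : t * (e - x) = 0 := by linarith
      rcases mul_eq_zero.1 this with h1 | h1
      · linarith
      · exact hxne (by linarith)
    · rw [add_sub_cancel_left, abs_mul, abs_of_pos ht0]; linarith
  have hem := h.bd_mem he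
  have hzm := uIcc_sub_Icc hem hxm hz1
  have hxz : x ∈ uIcc c z := by rw [mem_uIcc] at *; grind
  have hlz : lev T c x < lev T c z := by
    refine lt_of_le_of_ne (h.lev_mono hzm hxz) (fun e1 => hz2 ?_)
    refine (h.lev_eq_ss hxm hzm ?_ e1).symm
    unfold SS; rw [mem_uIcc] at *; grind
  obtain ⟨n, hn⟩ : ∃ n, ¬ URel T c n z c := by
    by_contra hcon
    push Not at hcon
    exact not_lt.2 (hmax (mem_iInter.2 fun n => ⟨hzm, hcon n⟩)) hlz
  obtain ⟨l, hl, Rl, hli⟩ := h.extend hc (Hx n) he hxe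
  have hlm := uIcc_sub_Icc hem hxm hl
  have hlz : l ∈ uIcc x z := by
    by_contra hcon
    have : z ∈ uIcc l c := by rw [mem_uIcc] at *; grind
    exact hn (h.rel_right hlm hc Rl this)
  have hxl : x ∈ uIcc c l := by rw [mem_uIcc] at *; grind
  rcases hli with rfl | ⟨i, hi, hic⟩
  · have : z ∈ uIcc l c := by rw [mem_uIcc] at *; grind
    exact hn (h.rel_right hlm hc Rl this)
  have hi1 : 1 ≤ i := by
    by_contra h0
    obtain rfl : i = 0 := by omega
    simp at hic; subst hic
    simp at hxl; exact hxc hxl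
  have f2 := S.F2 hlm (Rl.mono hi) hxl hxc
  have hX : |T^[i + 1] l - T^[i + 1] x| = lev T c (T^[i] x) := by
    rw [Function.iterate_succ_apply', Function.iterate_succ_apply', hic, abs_sub_comm]; rfl
  have b1 := abs_sub_le_of_mem (S.itmem hxm (i + 1)) (S.itmem hc (i + 1))
  have b2 := abs_sub_le_of_mem (S.itmem hlm (i + 1)) (S.itmem hxm (i + 1))
  have hb : lev T c x * (lev T c x * (C0 * lam ^ i)) ≤ (b - a) * ((b - a) + (b - a)) := by
    refine le_trans ?_ (f2.trans ?_)
    · have q1 : lev T c x ≤ |T^[i + 1] l - T^[i + 1] x| := by rw [hX]; exact (A2 i hi1).le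
      have q2 := S.ce i
      have : 0 ≤ lam := by linarith [S.hlam]
      gcongr
    · gcongr
  have hiN : i < N0 := by
    by_contra h1
    push Not at h1
    have : lam ^ N0 ≤ lam ^ i := pow_le_pow_right₀ S.hlam.le h1
    have : lam ^ N0 * (lev T c x ^ 2 * C0) ≤ lam ^ i * (lev T c x ^ 2 * C0) := by gcongr
    nlinarith
  have hlb : l ∈ Metric.ball x δ ∩ Icc a b := by
    refine ⟨?_, hlm⟩
    rw [Metric.mem_ball, Real.dist_eq]
    refine lt_of_le_of_lt (abs_le_of_mem_uIcc hlz) hz3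
  exact hδ2 hlb i (Finset.mem_range.2 hiN) hic

theorem nru {s : ℕ} {y : ℝ} (hs : 1 ≤ s) (hy : y ∈ Icc a b) (hyc : y ≠ c) (R : URel T c s y c)
    (h1 : lev T c (T^[s] c) ≤ lev T c y) (h2 : lev T c (T^[s] y) ≤ lev T c y)
    (h3 : SS c (T^[s] y) (T^[s] c)) : False := by
  have h := S.uni
  have key : ∀ k : ℕ, URel T c (k * s) y c := by
    intro k
    induction k with
    | zero => simpa using URel.zero y c
    | succ k ih =>
      have e : (k + 1) * s = s + k * s := by ring
      rw [e, URel.add_iff]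
      exact ⟨R, h.rel_c_c (S.itmem hy s) (S.itmem h.cmem s) (h.rel_lev (S.itmem hy s) hy h2 ih)
        (h.rel_lev (S.itmem h.cmem s) hy h1 ih) h3⟩
  exact S.no_ht hy hyc (fun n => (key n).mono (Nat.le_mul_of_pos_right n hs))

theorem W0 {δ : ℝ} (hδ : 0 < δ) : ∃ N, ∀ y ∈ Icc a b, URel T c N y c → |y - c| < δ := by
  by_contra hcon
  push Not at hcon
  have h := S.uni
  have hcl : IsClosed {y : ℝ | δ ≤ |y - c|} := isClosed_le continuous_const (by fun_prop)
  have := IsCompact.nonempty_iInter_of_sequence_nonempty_isCompact_isClosed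
    (fun n => {y : ℝ | y ∈ Icc a b ∧ URel T c n y c} ∩ {y | δ ≤ |y - c|})
    (fun n y hy => ⟨⟨hy.1.1, hy.1.2.mono (Nat.le_succ n)⟩, hy.2⟩)
    (fun n => by obtain ⟨y, h1, h2, h3⟩ := hcon n; exact ⟨y, ⟨h1, h2⟩, h3⟩)
    ((h.isCompact_relc 0).inter_right hcl) (fun n => (h.isCompact_relc n).isClosed.inter hcl)
  obtain ⟨y, hy⟩ := this
  rw [mem_iInter] at hy
  refine S.no_ht (hy 0).1.1 ?_ (fun n => (hy n).1.2)
  rintro rfl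
  have := (hy 0).2
  simp at this; linarith

theorem W0' {ρ : ℝ} (hρ : 0 < ρ) : ∃ τ, 0 < τ ∧ ∀ n, ∀ y ∈ Icc a b, URel T c n y c →
    |T^[n] y - T^[n] c| ≤ τ → |y - c| ≤ ρ := by
  obtain ⟨N, hN⟩ := S.W0 hρ
  have h := S.uni
  obtain ⟨τ, hτ, ht⟩ := unif_small (fun n t => ∀ y ∈ Icc a b, URel T c n y c →
    |T^[n] y - T^[n] c| ≤ t → |y - c| ≤ ρ) (fun n s t _ hst hP y hy r hl => hP y hy r (hl.trans hst)) (by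
      intro n
      have hcl : IsClosed {y : ℝ | ρ ≤ |y - c|} := isClosed_le continuous_const (by fun_prop)
      have hK := (h.isCompact_relc n).inter_right hcl
      rcases ({y : ℝ | y ∈ Icc a b ∧ URel T c n y c} ∩ {y | ρ ≤ |y - c|}).eq_empty_or_nonempty with he | hne
      · refine ⟨1, one_pos, fun y hy r _ => ?_⟩
        by_contra hcon
        push Not at hcon
        have : y ∈ ({y : ℝ | y ∈ Icc a b ∧ URel T c n y c} ∩ {y | ρ ≤ |y - c|}) := ⟨⟨hy, r⟩, hcon.le⟩
        rw [he] at this; exact this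
      · have hcont : ContinuousOn (fun y => |T^[n] y - T^[n] c|)
          ({y : ℝ | y ∈ Icc a b ∧ URel T c n y c} ∩ {y | ρ ≤ |y - c|}) :=
          (((h.contIter n).mono (fun y hy => hy.1.1)).sub continuousOn_const).abs
        obtain ⟨z, hz, hmin⟩ := hK.exists_isMinOn hne hcont
        have hpos : 0 < |T^[n] z - T^[n] c| := by
          rw [abs_pos, sub_ne_zero]
          intro e
          have := h.rel_inj hz.1.1 h.cmem hz.1.2 le_rfl e
          have h2 := hz.2
          rw [this] at h2
          simp at h2; linarith
        refine ⟨|T^[n] z - T^[n] c| / 2, by positivity, fun y hy r hl => ?_⟩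
        by_contra hcon
        push Not at hcon
        have := hmin (show y ∈ _ from ⟨⟨hy, r⟩, hcon.le⟩)
        simp only [mem_ofPred_eq] at this
        linarith) N
  refine ⟨τ, hτ, fun n y hy r hl => ?_⟩
  rcases lt_or_ge n N with hn | hn
  · exact ht n hn y hy r hl
  · exact (hN y hy (r.mono hn)).le

end SCE


def FLP (T : ℝ → ℝ) (a b c r κ η : ℝ) : Prop :=
  ∀ s, 1 ≤ s → ∀ l ∈ Icc a b, ∀ y M : ℝ, URel T c s l c → y ∈ uIcc c l → y ≠ c → (r ^ 8) ^ s ≤ κ →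
    |T^[s] c - c| ≤ M → |T^[s] y - c| ≤ M → M * (r ^ 8) ^ s ≤ κ * |y - c| →
    |T^[s] l - T^[s] y| ≤ η * M ∧ |T^[s] l - T^[s] y| ≤ η * |y - c|

theorem fl_end {X Λ M θ η : ℝ} (h : X * Λ ≤ θ * (2 * M + X)) (h1 : θ ≤ 1 / 2) (h2 : θ ≤ η / 4)
    (h3 : 1 ≤ Λ) (h4 : 0 ≤ X) (h5 : 0 < M) : X * Λ ≤ η * M := by
  have a1 : X ≤ X * Λ := le_mul_of_one_le_right h4 h3
  have a2 : θ * X ≤ 1 / 2 * X := by gcongr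
  have a3 : θ * M ≤ η / 4 * M := by gcongr
  linarith

namespace SCE
variable {α K₁ K₂ C0 lam : ℝ} (S : SCE T a b c α K₁ K₂ C0 lam)
include S

set_option maxHeartbeats 1000000 in
theorem FL : ∃ r, 0 < r ∧ r < 1 ∧ ∀ η, 0 < η → ∃ κ, 0 < κ ∧ FLP T a b c r κ η := by
  have hα := S.hα
  have hlam := S.hlam
  have hlam0 : 0 < lam := by linarith
  have hC0 := S.hC0
  have hK1 := S.hK₁
  have hK2 := S.K2_pos
  have hα1 : 0 < α + 1 := by linarith
  refine ⟨lam ^ (-(1 / (8 * (α + 1)))), by positivity, ?_, ?_⟩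
  · apply Real.rpow_lt_one_of_one_lt_of_neg hlam
    have : 0 < 1 / (8 * (α + 1)) := by positivity
    linarith
  intro η hη
  set r := lam ^ (-(1 / (8 * (α + 1)))) with hr
  have hr0 : 0 < r := by positivity
  have hr8 : (r ^ 8) ^ (α + 1) = lam⁻¹ := by
    rw [← Real.rpow_natCast, hr, ← Real.rpow_mul hlam0.le, ← Real.rpow_mul hlam0.le]
    rw [← Real.rpow_neg_one]
    congr 1
    push_cast
    field_simp
  set θ := min (1 / 2) (η / 4) with hθ
  have hθ0 : 0 < θ := lt_min (by norm_num) (by positivity)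
  set k1 := K₁ / 2 ^ α with hk1
  have hk10 : 0 < k1 := by positivity
  set ε := θ * (k1 * C0) / (2 * K₂) with hε
  have hε0 : 0 < ε := by positivity
  refine ⟨ε ^ (1 / (α + 1)), by positivity, ?_⟩
  set κ := ε ^ (1 / (α + 1)) with hκ
  have hκ0 : 0 < κ := by positivity
  have hκα : κ ^ (α + 1) = ε := by
    rw [hκ, ← Real.rpow_mul hε0.le, one_div_mul_cancel hα1.ne', Real.rpow_one]
  intro s hs l hl y M R hy hyc h1 h2 h3 h4
  have hym := uIcc_sub_Icc S.uni.cmem hl hy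
  obtain ⟨s, rfl⟩ : ∃ k, s = k + 1 := ⟨s - 1, by omega⟩
  have f2 := S.F2 hl R hy hyc
  have dc := S.Dn_cs s
  have ll := S.lev_low hym
  have hd : 0 < |y - c| := abs_pos.2 (sub_ne_zero.2 hyc)
  have hq : 0 < |T^[s + 1] c - c| := abs_pos.2 (sub_ne_zero.2 (S.cs_ne (by omega)))
  rw [Real.div_rpow hd.le (by norm_num)] at ll
  have ll' : k1 * |y - c| ^ α ≤ lev T c y := by
    calc _ = K₁ * (|y - c| ^ α / 2 ^ α) := by rw [hk1]; ring
      _ ≤ _ := ll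
  set X := |T^[s + 1] l - T^[s + 1] y| with hX
  set I := |T^[s + 1] y - T^[s + 1] c|
  set q := |T^[s + 1] c - c|
  set d := |y - c|
  have hX0 : 0 ≤ X := abs_nonneg _
  have hI0 : 0 ≤ I := abs_nonneg _
  have hIM : I ≤ 2 * M := by
    have := abs_sub_le (T^[s + 1] y) c (T^[s + 1] c)
    rw [abs_sub_comm c] at this
    linarith
  have hM : 0 < M := by linarith
  set ρ := (r ^ 8) ^ (s + 1) with hρ
  have hρ0 : 0 < ρ := by positivity
  set Λ := κ / ρ with hΛ
  have hΛ1 : 1 ≤ Λ := by rw [hΛ, one_le_div hρ0]; exact h1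
  have hΛ0 : 0 < Λ := by linarith
  have hMd : M ≤ Λ * d := by
    rw [hΛ, div_mul_eq_mul_div, le_div_iff₀ hρ0]; exact h4
  have hΛα : Λ ^ α * Λ = ε * lam ^ (s + 1) := by
    rw [← Real.rpow_add_one hΛ0.ne', hΛ, Real.div_rpow hκ0.le hρ0.le, hκα, hρ, ← Real.rpow_natCast,
      ← Real.rpow_mul (by positivity), mul_comm ((s + 1 : ℕ) : ℝ), Real.rpow_mul (by positivity), hr8,
      Real.rpow_natCast, inv_pow, div_inv_eq_mul]
  -- main estimate
  have m1 : X * (k1 * d ^ α) * (C0 * lam ^ (s + 1)) ≤ 2 * K₂ * (2 * M + X) * (Λ ^ α * d ^ α) := by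
    calc X * (k1 * d ^ α) * (C0 * lam ^ (s + 1))
        ≤ X * lev T c y * (Dn T s (T c) * (K₂ * q ^ (α - 1))) := by
          have := IsUnimodal.lev_nonneg (T := T) (c := c) y
          gcongr
      _ = X * (lev T c y * Dn T s (T c)) * (K₂ * q ^ (α - 1)) := by ring
      _ ≤ I * (I + X) * (K₂ * q ^ (α - 1)) := by gcongr
      _ ≤ 2 * M * (2 * M + X) * (K₂ * M ^ (α - 1)) := by
          have : 0 ≤ α - 1 := by linarith
          gcongr
      _ = 2 * K₂ * (2 * M + X) * (M ^ (α - 1) * M) := by ring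
      _ = 2 * K₂ * (2 * M + X) * M ^ α := by
          rw [← Real.rpow_add_one hM.ne']; simp
      _ ≤ 2 * K₂ * (2 * M + X) * (Λ * d) ^ α := by gcongr
      _ = _ := by rw [Real.mul_rpow hΛ0.le hd.le]
  have m2 : X * (k1 * C0) * Λ ≤ 2 * K₂ * ε * (2 * M + X) := by
    have hpos : 0 < Λ ^ α * d ^ α := by positivity
    refine le_of_mul_le_mul_right ?_ hpos
    calc X * (k1 * C0) * Λ * (Λ ^ α * d ^ α) = X * (k1 * C0) * d ^ α * (Λ ^ α * Λ) := by ring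
      _ = ε * (X * (k1 * d ^ α) * (C0 * lam ^ (s + 1))) := by rw [hΛα]; ring
      _ ≤ ε * (2 * K₂ * (2 * M + X) * (Λ ^ α * d ^ α)) := by gcongr
      _ = _ := by ring
  have m3 : X * Λ ≤ θ * (2 * M + X) := by
    have hpos : 0 < k1 * C0 := by positivity
    refine le_of_mul_le_mul_left ?_ hpos
    calc k1 * C0 * (X * Λ) = X * (k1 * C0) * Λ := by ring
      _ ≤ _ := m2
      _ = _ := by rw [hε]; field_simp
  have hθ1 : θ ≤ 1 / 2 := min_le_left _ _
  have hθ2 : θ ≤ η / 4 := min_le_right _ _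
  have m4 : X * Λ ≤ η * M := fl_end m3 hθ1 hθ2 hΛ1 hX0 hM
  constructor
  · exact (le_mul_of_one_le_right hX0 hΛ1).trans m4
  · refine le_of_mul_le_mul_right (m4.trans ?_) hΛ0
    calc η * M ≤ η * (Λ * d) := by gcongr
      _ = _ := by ring

theorem c1_gt : c < T c := by
  by_contra hcon
  push Not at hcon
  have h := S.uni
  have hle : ∀ x ∈ Icc a b, T x ≤ T c := by
    intro x hx
    rcases le_total x c with h1 | h1
    · exact S.orient.1.monotoneOn ⟨hx.1, h1⟩ ⟨h.hac.le, le_rfl⟩ h1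
    · exact S.orient.2.antitoneOn ⟨le_rfl, h.hcb.le⟩ ⟨h1, hx.2⟩ h1
  refine S.no_ht h.bmem h.hcb.ne' (fun n k hk => ?_)
  rcases k with _ | k
  · exact SS.self_c b
  · left
    rw [Function.iterate_succ_apply', Function.iterate_succ_apply']
    exact ⟨(hle _ (S.itmem h.bmem k)).trans hcon, (hle _ (S.itmem h.cmem k)).trans hcon⟩

theorem bd_not {e : ℝ} (he : e = a ∨ e = b) (R : URel T c 2 e c) : False := by
  have h1 := R 1 (by omega)
  have hTe : T e = a := by rcases he with rfl | rfl; exacts [S.Ta, S.Tb]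
  simp only [Function.iterate_one, hTe] at h1
  have := S.c1_gt
  have := S.uni.hac
  unfold SS at h1; grind

/-- lower bound for the critical orbit -/
theorem cs_low (N : ℕ) : ∃ m, 0 < m ∧ ∀ s < N, 1 ≤ s → m ≤ |T^[s] c - c| :=
  unif_small (fun s m => 1 ≤ s → m ≤ |T^[s] c - c|) (fun n s t _ hst hP h1 => hst.trans (hP h1))
    (fun s => by
      rcases Nat.eq_zero_or_pos s with rfl | hs
      · exact ⟨1, one_pos, fun h => absurd h (by norm_num)⟩
      · exact ⟨_, abs_pos.2 (sub_ne_zero.2 (S.cs_ne hs)), fun _ => le_rfl⟩) N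

theorem Cs {G r κ : ℝ} (hG1 : 1 ≤ G)
    (hG : ∀ x ∈ Icc a b, ∀ y ∈ Icc a b, lev T c x ≤ lev T c y → |x - c| ≤ G * |y - c|)
    (hr : 0 < r) (hr1 : r < 1) (hκ : 0 < κ) (fl : FLP T a b c r κ (1 / (2 * G))) :
    ∃ C1, 0 < C1 ∧ ∀ s, 1 ≤ s → ∀ w ∈ Icc a b, w ≠ c → URel T c s w c → T^[s] w = c →
      |w - c| ≤ C1 * (r ^ 8) ^ s * |T^[s] c - c| := by
  have h := S.uni
  have hc := h.cmem
  have hr8 : r ^ 8 < 1 := pow_lt_one₀ hr.le hr1 (by norm_num)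
  obtain ⟨S0, hS0⟩ := exists_pow_lt_of_lt_one hκ hr8
  obtain ⟨m, hm, hml⟩ := S.cs_low (S0 + 2)
  have hab := S.hab
  refine ⟨max (1 / κ) ((b - a) / (m * (r ^ 8) ^ (S0 + 2))), lt_max_of_lt_left (by positivity), ?_⟩
  intro s hs w hw hwc R hsw
  have hcs := hml s
  rcases lt_or_ge s (S0 + 2) with hsS | hsS
  · have h1 := hml s hsS hs
    calc |w - c| ≤ b - a := abs_sub_le_of_mem hw hc
      _ = (b - a) / (m * (r ^ 8) ^ (S0 + 2)) * (r ^ 8) ^ (S0 + 2) * m := by field_simp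
      _ ≤ _ := by
        have h2 : (r ^ 8) ^ (S0 + 2) ≤ (r ^ 8) ^ s := pow_le_pow_of_le_one (by positivity) hr8.le hsS.le
        gcongr
        exact le_max_right _ _
  by_contra hcon
  push Not at hcon
  have hρ : (r ^ 8) ^ s ≤ κ := le_trans (pow_le_pow_of_le_one (by positivity) hr8.le (by omega)) hS0.le
  have hM : |T^[s] c - c| * (r ^ 8) ^ s ≤ κ * |w - c| := by
    have : 1 / κ * (r ^ 8) ^ s * |T^[s] c - c| ≤ |w - c| := by
      refine le_trans ?_ hcon.le
      gcongr; exact le_max_left _ _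
    calc _ = κ * (1 / κ * (r ^ 8) ^ s * |T^[s] c - c|) := by field_simp
      _ ≤ _ := by gcongr
  obtain ⟨e, he, hwe⟩ := h.side_e hw
  have hem := h.bd_mem he
  obtain ⟨l, hl, Rl, hli⟩ := h.extend hc R he hwe
  have hlm := uIcc_sub_Icc hem hw hl
  have hwl : w ∈ uIcc c l := by rw [mem_uIcc] at *; grind
  obtain ⟨-, x2⟩ := fl s hs l hlm w _ Rl hwl hwc hρ le_rfl (by rw [hsw]; simp) hM
  rw [hsw] at x2
  rcases hli with rfl | ⟨t, ht, htc⟩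
  · exact S.bd_not he (Rl.mono (by omega))
  have ht1 : 1 ≤ t := by
    by_contra h0
    obtain rfl : t = 0 := by omega
    simp at htc; subst htc
    simp at hwl; exact hwc hwl
  obtain ⟨s', rfl⟩ : ∃ k, s = t + k := ⟨s - t, by omega⟩
  have hs' : 1 ≤ s' := by omega
  have hsl : T^[t + s'] l = T^[s'] c := by rw [add_comm, Function.iterate_add_apply, htc]
  have hsw' : T^[s'] (T^[t] w) = c := by rw [← Function.iterate_add_apply, add_comm]; exact hsw
  rw [hsl] at x2
  have Rwl : URel T c (t + s') w l := (h.rel_left hlm hc Rl (uIcc_comm' hwl)).symm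
  have R1 : URel T c s' (T^[t] w) c := by
    have := (URel.add_iff.1 Rwl).2
    rwa [htc] at this
  have hwt : T^[t] w ≠ c := by
    intro e1
    rw [e1] at hsw'
    exact S.cs_ne hs' hsw'
  have hwtm := S.itmem hw t
  have g1 : lev T c (T^[t] w) < lev T c (T^[s'] c) := by
    by_contra hle
    push Not at hle
    refine S.nru hs' hwtm hwt R1 hle ?_ ?_
    · rw [hsw', IsUnimodal.lev_c]; exact IsUnimodal.lev_nonneg _
    · rw [hsw']; exact (SS.self_c _).symm
  have g2 : lev T c w ≤ lev T c (T^[t] w) := by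
    by_contra hlt
    push Not at hlt
    obtain ⟨w', hw', hss, hTw⟩ := h.mirror hw hwtm
    have hlw : lev T c w' = lev T c w := by unfold lev; rw [hTw]
    have R2 : URel T c (t + s') w' c := h.rel_lev hw' hw hlw.le R
    have hmem : T^[t] w ∈ uIcc c w' := h.mem_of_lev hwtm hw' hss.symm (by rw [hlw]; exact hlt.le)
    have hb := h.rel_between hc hw' R2.symm hmem (k := s') (by omega)
    have hs2 := R2 s' (by omega)
    rw [hsw'] at hb
    have hcs' := S.cs_ne hs'
    have : T^[s'] w' = c := by
      unfold SS at hs2; rw [mem_uIcc] at hb; grind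
    have : T^[t] w = w' := h.rel_inj hwtm hw' ((h.rel_left hc hw' R2.symm hmem).symm.via
      (h.rel_left hc hw' R2.symm hmem).symm |> fun _ => h.rel_right hc hw' R2.symm hmem) (k := s') (by omega)
      (by rw [hsw', this])
    rw [this, hlw] at hlt
    exact lt_irrefl _ hlt
  have g3 := hG w hw (T^[s'] c) (S.itmem hc s') (g2.trans g1.le)
  have hd : 0 < |w - c| := abs_pos.2 (sub_ne_zero.2 hwc)
  have : G * |T^[s'] c - c| ≤ G * (1 / (2 * G) * |w - c|) := by gcongr
  have e2 : G * (1 / (2 * G) * |w - c|) = |w - c| / 2 := by field_simp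
  linarith

end SCE


namespace SCE
variable {α K₁ K₂ C0 lam : ℝ} (S : SCE T a b c α K₁ K₂ C0 lam)
include S

/-- preimages of `c` of bounded order stay away from `c` -/
theorem pre_far (N : ℕ) : ∃ δ, 0 < δ ∧ ∀ t < N, 1 ≤ t → ∀ l ∈ Icc a b, T^[t] l = c → δ ≤ |l - c| := by
  refine unif_small (fun t δ => 1 ≤ t → ∀ l ∈ Icc a b, T^[t] l = c → δ ≤ |l - c|)
    (fun n s t _ hst hP h1 l hl he => hst.trans (hP h1 l hl he)) (fun t => ?_) N
  rcases Nat.eq_zero_or_pos t with rfl | ht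
  · exact ⟨1, one_pos, fun h => absurd h (by norm_num)⟩
  have ev := (S.uni.contIter t c S.uni.cmem).eventually_ne (S.cs_ne ht)
  obtain ⟨δ, hδ, hδ2⟩ := Metric.mem_nhdsWithin_iff.1 ev
  refine ⟨δ, hδ, fun _ l hl he => ?_⟩
  by_contra hcon
  push Not at hcon
  exact hδ2 ⟨by rw [Metric.mem_ball, Real.dist_eq]; exact hcon, hl⟩ he

theorem Ps : ∃ K r, 0 < K ∧ 0 < r ∧ r < 1 ∧ ∀ s, 1 ≤ s → ∀ y ∈ Icc a b, ∀ M, URel T c s y c →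
    |T^[s] c - c| ≤ M → |T^[s] y - c| ≤ M → |y - c| ≤ K * (r ^ 4) ^ s * M := by
  have h := S.uni
  have hc := h.cmem
  have hab := S.hab
  obtain ⟨G, hG1, hG⟩ := S.lev_dist
  obtain ⟨r, hr, hr1, hfl⟩ := S.FL
  obtain ⟨κ, hκ, fl⟩ := hfl (1 / (2 * G)) (by positivity)
  obtain ⟨C1, hC1, hCs⟩ := S.Cs hG1 hG hr hr1 hκ fl
  have hr8 : r ^ 8 < 1 := pow_lt_one₀ hr.le hr1 (by norm_num)
  have hr4 : r ^ 4 < 1 := pow_lt_one₀ hr.le hr1 (by norm_num)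
  have hr84 : r ^ 8 ≤ r ^ 4 := pow_le_pow_of_le_one hr.le hr1.le (by norm_num)
  obtain ⟨S0, hS0⟩ := exists_pow_lt_of_lt_one hκ hr8
  obtain ⟨N1, hN1⟩ := exists_pow_lt_of_lt_one (show 0 < 1 / (2 * C1) by positivity) hr4
  obtain ⟨δ, hδ, hδl⟩ := S.pre_far N1
  obtain ⟨N2, hN2⟩ := S.W0 hδ
  set N3 := max N2 (S0 + 2) with hN3
  obtain ⟨m, hm, hml⟩ := S.cs_low N3
  set K := max (1 / κ) ((b - a) / (m * (r ^ 4) ^ N3)) with hK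
  have hK0 : 0 < K := lt_max_of_lt_left (by positivity)
  refine ⟨K, r, hK0, hr, hr1, ?_⟩
  intro s
  induction s using Nat.strong_induction_on with
  | _ s ih =>
  intro hs y hy M R hM1 hM2
  have hM0 : 0 < M := lt_of_lt_of_le (abs_pos.2 (sub_ne_zero.2 (S.cs_ne hs))) hM1
  rcases lt_or_ge s N3 with hsS | hsS
  · have h1 := (hml s hsS hs).trans hM1
    calc |y - c| ≤ b - a := abs_sub_le_of_mem hy hc
      _ = (b - a) / (m * (r ^ 4) ^ N3) * (r ^ 4) ^ N3 * m := by field_simp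
      _ ≤ _ := by
        have h2 : (r ^ 4) ^ N3 ≤ (r ^ 4) ^ s := pow_le_pow_of_le_one (by positivity) hr4.le hsS.le
        gcongr
        exact le_max_right _ _
  have hsN2 : N2 ≤ s := (le_max_left _ _).trans hsS
  have hsS0 : S0 + 2 ≤ s := (le_max_right _ _).trans hsS
  by_cases hyc : y = c
  · subst hyc; simp; positivity
  have hρ : (r ^ 8) ^ s ≤ κ := le_trans (pow_le_pow_of_le_one (by positivity) hr8.le (by omega)) hS0.le
  by_contra hcon
  push Not at hcon
  have hMd : M * (r ^ 8) ^ s ≤ κ * |y - c| := by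
    have : 1 / κ * (r ^ 8) ^ s * M ≤ |y - c| := by
      refine le_trans ?_ hcon.le
      gcongr; exact le_max_left _ _
    calc _ = κ * (1 / κ * (r ^ 8) ^ s * M) := by field_simp
      _ ≤ _ := by gcongr
  obtain ⟨e, he, hye⟩ := h.side_e hy
  have hem := h.bd_mem he
  obtain ⟨l, hl, Rl, hli⟩ := h.extend hc R he hye
  have hlm := uIcc_sub_Icc hem hy hl
  have hyl : y ∈ uIcc c l := by rw [mem_uIcc] at *; grind
  obtain ⟨x1, -⟩ := fl s hs l hlm y M Rl hyl hyc hρ hM1 hM2 hMd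
  have hη : 1 / (2 * G) ≤ 1 := by rw [div_le_one (by positivity)]; linarith
  have hX : |T^[s] l - c| ≤ 2 * M := by
    have := abs_sub_le (T^[s] l) (T^[s] y) c
    have : 1 / (2 * G) * M ≤ 1 * M := by gcongr
    linarith
  rcases hli with rfl | ⟨t, ht, htc⟩
  · exact S.bd_not he (Rl.mono (by omega))
  have hlc : l ≠ c := by
    rintro rfl
    simp at hyl; exact hyc hyl
  have ht1 : 1 ≤ t := by
    by_contra h0
    obtain rfl : t = 0 := by omega
    exact hlc (by simpa using htc)
  have htN : N1 ≤ t := by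
    by_contra h0
    have h1 := hδl t (by omega) ht1 l hlm htc
    have h2 := hN2 l hlm (Rl.mono hsN2)
    linarith
  obtain ⟨s', rfl⟩ : ∃ k, s = t + k := ⟨s - t, by omega⟩
  have hs' : 1 ≤ s' := by omega
  have hsl : T^[t + s'] l = T^[s'] c := by rw [add_comm, Function.iterate_add_apply, htc]
  have hsc : T^[s'] (T^[t] c) = T^[t + s'] c := by rw [← Function.iterate_add_apply, add_comm]
  rw [hsl] at hX
  have R1 : URel T c s' (T^[t] c) c := by
    have := (URel.add_iff.1 Rl).2
    rw [htc] at this; exact this.symm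
  have i1 := ih s' (by omega) hs' (T^[t] c) (S.itmem hc t) (2 * M) R1 hX (by rw [hsc]; linarith)
  have i2 := hCs t ht1 l hlm hlc (Rl.mono (by omega)) htc
  have i3 : |y - c| ≤ |l - c| := abs_le_of_mem_uIcc hyl
  refine absurd hcon (not_lt.2 ?_)
  have i4 : 2 * C1 * (r ^ 4) ^ t ≤ 1 := by
    have : (r ^ 4) ^ t ≤ 1 / (2 * C1) := le_trans (pow_le_pow_of_le_one (by positivity) hr4.le htN) hN1.le
    rw [le_div_iff₀ (by positivity)] at this; linarith
  calc |y - c| ≤ C1 * (r ^ 8) ^ t * |T^[t] c - c| := i3.trans i2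
    _ ≤ C1 * (r ^ 8) ^ t * (K * (r ^ 4) ^ s' * (2 * M)) := by gcongr
    _ = (2 * C1 * (r ^ 4) ^ t) * (K * ((r ^ 4) ^ t * (r ^ 4) ^ s') * M) := by
      have : (r ^ 8) ^ t = (r ^ 4) ^ t * (r ^ 4) ^ t := by rw [← mul_pow]; ring
      rw [this]; ring
    _ ≤ 1 * (K * ((r ^ 4) ^ t * (r ^ 4) ^ s') * M) := by gcongr
    _ = _ := by rw [one_mul, pow_add]

end SCE


/-- endpoint of a maximal monotonicity interval -/
def EP (T : ℝ → ℝ) (a b c : ℝ) (n : ℕ) (l : ℝ) : Prop := (l = a ∨ l = b) ∨ ∃ i < n, T^[i] l = c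

theorem IsUnimodal.ext2 (h : IsUnimodal T a b c) {n : ℕ} {u v : ℝ} (hu : u ∈ Icc a b) (hv : v ∈ Icc a b)
    (R : URel T c n u v) : ∃ l ∈ Icc a b, ∃ r ∈ Icc a b, URel T c n l r ∧ u ∈ uIcc l r ∧ v ∈ uIcc u r ∧
      EP T a b c n l ∧ EP T a b c n r := by
  obtain ⟨e, f, he, hf, hue, hvf⟩ : ∃ e f, (e = a ∨ e = b) ∧ (f = a ∨ f = b) ∧ u ∈ uIcc e v ∧
      ∀ l ∈ uIcc e u, v ∈ uIcc f l := by
    rcases le_total u v with huv | huv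
    · refine ⟨a, b, Or.inl rfl, Or.inr rfl, ?_, ?_⟩
      · rw [mem_uIcc]; exact Or.inl ⟨hu.1, huv⟩
      · intro l hl
        rw [uIcc_of_le hu.1] at hl
        rw [mem_uIcc]; exact Or.inr ⟨hl.2.trans huv, hv.2⟩
    · refine ⟨b, a, Or.inr rfl, Or.inl rfl, ?_, ?_⟩
      · rw [mem_uIcc]; exact Or.inr ⟨huv, hu.2⟩
      · intro l hl
        rw [uIcc_of_ge hu.2] at hl
        rw [mem_uIcc]; exact Or.inl ⟨hv.1, huv.trans hl.1⟩
  obtain ⟨l, hl, Rl, hli⟩ := h.extend hv R he hue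
  have hlm := uIcc_sub_Icc (h.bd_mem he) hu hl
  have h2 := hvf l hl
  obtain ⟨r, hr, Rr, hri⟩ := h.extend hlm Rl.symm hf h2
  have hrm := uIcc_sub_Icc (h.bd_mem hf) hv hr
  refine ⟨l, hlm, r, hrm, Rr.symm, ?_, ?_, ?_, ?_⟩
  · rw [mem_uIcc] at *; grind
  · rw [mem_uIcc] at *; grind
  · rcases hli with rfl | h
    exacts [Or.inl he, Or.inr h]
  · rcases hri with rfl | h
    exacts [Or.inl hf, Or.inr h]

theorem abs_four {l u v r : ℝ} (hu : u ∈ uIcc l r) (hv : v ∈ uIcc u r) :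
    |u - v| ≤ |l - v| ∧ |u - v| ≤ |r - u| := by
  have h2 : u ∈ uIcc l v := by rw [mem_uIcc] at *; grind
  have e1 := abs_add_of_mem h2
  have e2 := abs_add_of_mem hv
  rw [abs_sub_comm r u]
  exact ⟨by linarith [abs_nonneg (l - u)], by linarith [abs_nonneg (v - r)]⟩

/-- constants for the B lemma -/
structure BC (T : ℝ → ℝ) (a b c Kp q : ℝ) (N : ℕ) (ρ0 : ℝ) : Prop where
  Kpos : 0 < Kp
  qpos : 0 < q
  qlt : q < 1
  P : ∀ s, 1 ≤ s → ∀ y ∈ Icc a b, ∀ M, URel T c s y c → |T^[s] c - c| ≤ M → |T^[s] y - c| ≤ M →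
    |y - c| ≤ Kp * (q ^ 4) ^ s * M
  hN : ∀ s, N ≤ s → 16 * Kp * (q ^ 2) ^ s ≤ 1
  ρpos : 0 < ρ0
  far : ∀ s, 1 ≤ s → s < N → 16 * ρ0 ≤ |T^[s] c - c|
  fa : 16 * ρ0 ≤ |a - c|
  fb : 16 * ρ0 ≤ |b - c|

namespace SCE
variable {α K₁ K₂ C0 lam : ℝ} (S : SCE T a b c α K₁ K₂ C0 lam)
include S

theorem exists_BC : ∃ Kp q N ρ0, BC T a b c Kp q N ρ0 := by
  obtain ⟨K, r, hK, hr, hr1, P⟩ := S.Ps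
  have hr2 : r ^ 2 < 1 := by nlinarith
  obtain ⟨N, hN⟩ := exists_pow_lt_of_lt_one (show 0 < 1 / (16 * K) by positivity) hr2
  obtain ⟨m, hm, hml⟩ := S.cs_low N
  have ha : 0 < |a - c| := abs_pos.2 (sub_ne_zero.2 (S.uni.bd_ne_c (Or.inl rfl)))
  have hb : 0 < |b - c| := abs_pos.2 (sub_ne_zero.2 (S.uni.bd_ne_c (Or.inr rfl)))
  refine ⟨K, r, N, min m (min |a - c| |b - c|) / 16, hK, hr, hr1, P, ?_, by positivity, ?_, ?_, ?_⟩
  · intro s hs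
    have : (r ^ 2) ^ s ≤ 1 / (16 * K) := le_trans (pow_le_pow_of_le_one (by positivity) hr2.le hs) hN.le
    rw [le_div_iff₀ (by positivity)] at this; linarith
  · intro s h1 hs
    have := hml s hs h1
    have := min_le_left m (min |a - c| |b - c|)
    linarith
  · have := (min_le_right m (min |a - c| |b - c|)).trans (min_le_left _ _)
    linarith
  · have := (min_le_right m (min |a - c| |b - c|)).trans (min_le_right _ _)
    linarith

set_option maxHeartbeats 800000 in
/-- the B lemma -/
theorem BH {Kp q ρ0 A m : ℝ} {N : ℕ} (B : BC T a b c Kp q N ρ0) (hA : 0 ≤ A) (hm : q ≤ m)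
    (hm1 : m ≤ 1) (k : ℕ) (es : ∀ j ≤ k, ∀ x ∈ Icc a b, ∀ y ∈ Icc a b, URel T c j x y → |x - y| ≤ A * m ^ j) :
    ∀ u ∈ Icc a b, ∀ v ∈ Icc a b, URel T c k u v → T^[k] u = c → ∀ t, 0 ≤ t → t ≤ 1 →
      |T^[k] v - c| ≤ t ^ 2 * ρ0 → |u - v| ≤ A * t * m ^ k := by
  have h := S.uni
  have hc := h.cmem
  have hρ0 := B.ρpos
  have hq := B.qpos
  have hq1 := B.qlt
  have hm0 : 0 < m := hq.trans_le hm
  have hK := B.Kpos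
  induction k using Nat.strong_induction_on with
  | _ k ih =>
  intro u hu v hv R huc t ht ht1 hvt
  rcases ht.eq_or_lt with rfl | ht
  · have : T^[k] v - c = 0 := abs_nonpos_iff.1 (by simpa using hvt)
    have : u = v := h.rel_inj hu hv R le_rfl (by rw [huc]; linarith)
    subst this; simp
  -- basic cut estimate
  have cut : ∀ z ∈ Icc a b, ∀ w ∈ Icc a b, URel T c k z w → ∀ i < k, T^[i] z = c → ∀ M,
      |T^[k] z - c| ≤ M → |T^[k] w - c| ≤ M → M < 16 * ρ0 → ∀ τ, 0 ≤ τ → τ ≤ 1 → M ≤ 16 * τ ^ 2 * ρ0 →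
      |z - w| ≤ A * τ * m ^ k := by
    intro z hz w hw Rz i hi hzi M h1 h2 h3 τ hτ hτ1 hM
    obtain ⟨s, rfl⟩ : ∃ s, k = i + s := ⟨k - i, by omega⟩
    have hs : 1 ≤ s := by omega
    have e1 : ∀ x, T^[i + s] x = T^[s] (T^[i] x) := fun x => by
      rw [← Function.iterate_add_apply, add_comm]
    rw [e1, hzi] at h1
    rw [e1] at h2
    have hsN : N ≤ s := by
      by_contra hcon
      have := B.far s hs (by omega)
      linarith
    have R2 := (URel.add_iff.1 Rz).2
    rw [hzi] at R2
    have p := B.P s hs _ (S.itmem hw i) M R2.symm h1 h2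
    have hN := B.hN s hsN
    have hM0 : 0 ≤ M := (abs_nonneg _).trans h1
    have p2 : |T^[i] w - c| ≤ (q ^ s * τ) ^ 2 * ρ0 := by
      calc |T^[i] w - c| ≤ _ := p
        _ = (16 * Kp * (q ^ 2) ^ s) * ((q ^ 2) ^ s * (M / 16)) := by
          have : (q ^ 4) ^ s = (q ^ 2) ^ s * (q ^ 2) ^ s := by rw [← mul_pow]; ring
          rw [this]; ring
        _ ≤ 1 * ((q ^ 2) ^ s * (τ ^ 2 * ρ0)) := by gcongr; linarith
        _ = _ := by rw [mul_pow, ← pow_mul, ← pow_mul, mul_comm 2 s]; ring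
    have hqs : q ^ s ≤ 1 := pow_le_one₀ hq.le hq1.le
    have := ih i hi (fun j hj => es j (by omega)) z hz w hw (URel.add_iff.1 Rz).1 hzi (q ^ s * τ)
      (by positivity) (mul_le_one₀ hqs hτ hτ1) p2
    calc |z - w| ≤ _ := this
      _ = A * τ * (q ^ s * m ^ i) := by ring
      _ ≤ A * τ * (m ^ s * m ^ i) := by gcongr
      _ = _ := by rw [pow_add]; ring
  have near : ∀ z ∈ Icc a b, ∀ w ∈ Icc a b, URel T c k z w → EP T a b c k z →
      |T^[k] z - c| ≤ 8 * (t ^ 2 * ρ0) → |T^[k] w - c| ≤ 8 * (t ^ 2 * ρ0) → |z - w| ≤ A * t * m ^ k := by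
    intro z hz w hw Rz hE h1 h2
    have ht2 : t ^ 2 ≤ 1 := by nlinarith
    have ht2' : t ^ 2 * ρ0 ≤ ρ0 := by nlinarith
    have ht3 : 0 < t ^ 2 * ρ0 := by positivity
    rcases hE with hE | ⟨i, hi, hzi⟩
    · exfalso
      rcases h.bd_iter hE k with e | e <;> rw [e] at h1
      · have := B.fa; linarith
      · have := B.fb; linarith
    · exact cut z hz w hw Rz i hi hzi _ h1 h2 (by linarith) t ht.le ht1 (by linarith)
  have tail : ∀ z ∈ Icc a b, ∀ w ∈ Icc a b, URel T c k z w → EP T a b c k z →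
      8 * (t ^ 2 * ρ0) < |T^[k] z - c| → |T^[k] w - c| ≤ |T^[k] z - c| → ∀ x,
      |T^[k] z - c| * x ≤ 4 * (t ^ 2 * ρ0) * |z - w| → x ≤ A * t * m ^ k := by
    intro z hz w hw Rz hE h1 h2 x hx
    have ht3 : 0 < t ^ 2 * ρ0 := by positivity
    set P0 := |T^[k] z - c| with hP0
    have hP : 0 < P0 := by linarith
    have hbig : 16 * ρ0 ≤ P0 → x ≤ A * t * m ^ k := by
      intro hb
      have := es k le_rfl z hz w hw Rz
      have h5 : P0 * x ≤ P0 * (A * t * m ^ k) := by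
        calc P0 * x ≤ 4 * (t ^ 2 * ρ0) * |z - w| := hx
          _ ≤ 4 * (t ^ 2 * ρ0) * (A * m ^ k) := by gcongr
          _ = (4 * ρ0 * t) * (A * t * m ^ k) := by ring
          _ ≤ P0 * (A * t * m ^ k) := by
            gcongr; nlinarith
      exact le_of_mul_le_mul_left h5 hP
    rcases hE with hE | ⟨i, hi, hzi⟩
    · apply hbig
      rcases h.bd_iter hE k with e | e <;> rw [hP0, e]
      exacts [B.fa, B.fb]
    · rcases le_or_gt (16 * ρ0) P0 with hb | hb
      · exact hbig hb
      set τ := Real.sqrt (P0 / (16 * ρ0)) with hτ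
      have hτ2 : τ ^ 2 = P0 / (16 * ρ0) := Real.sq_sqrt (by positivity)
      have hτ0 : 0 < τ := Real.sqrt_pos.2 (by positivity)
      have hPt : P0 = 16 * τ ^ 2 * ρ0 := by rw [hτ2]; field_simp
      have hτ1 : τ ≤ 1 := by
        rw [hτ, Real.sqrt_le_one, div_le_one (by positivity)]; exact hb.le
      have h4 := cut z hz w hw Rz i hi hzi P0 le_rfl h2 hb τ hτ0.le hτ1 hPt.le
      have ht4 : t ≤ 4 * τ := by
        have : t ^ 2 ≤ 2 * τ ^ 2 := by
          have : t ^ 2 * ρ0 ≤ (2 * τ ^ 2) * ρ0 := by linarith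
          exact le_of_mul_le_mul_right this hρ0
        refine abs_le_of_sq_le_sq' ?_ (by positivity) |>.2
        nlinarith
      have h5 : P0 * x ≤ P0 * (A * t * m ^ k) := by
        calc P0 * x ≤ 4 * (t ^ 2 * ρ0) * |z - w| := hx
          _ ≤ 4 * (t ^ 2 * ρ0) * (A * τ * m ^ k) := by gcongr
          _ = (4 * ρ0 * τ * t) * (A * t * m ^ k) := by ring
          _ ≤ P0 * (A * t * m ^ k) := by
            gcongr
            rw [hPt]
            have : 4 * ρ0 * τ * t ≤ 4 * ρ0 * τ * (4 * τ) := by gcongr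
            linarith
      exact le_of_mul_le_mul_left h5 hP
  obtain ⟨l, hl, r, hr, Rlr, hul, hvr, El, Er⟩ := h.ext2 hu hv R
  have hvlr : v ∈ uIcc l r := mem_uIcc_trans' hul hvr
  have ht3 : 0 < t ^ 2 * ρ0 := by positivity
  have Rlv := h.rel_left hl hr Rlr hvlr
  have Rur := h.rel_right hl hr Rlr hul
  obtain ⟨i1, i2⟩ := abs_four hul hvr
  rcases le_or_gt |T^[k] l - c| (8 * (t ^ 2 * ρ0)) with hp | hp
  · exact i1.trans (near l hl v hv Rlv El hp (by linarith))
  rcases le_or_gt |T^[k] r - c| (8 * (t ^ 2 * ρ0)) with hp' | hp'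
  · exact i2.trans (near r hr u hu Rur.symm Er hp' (by rw [huc, sub_self, abs_zero]; linarith))
  have hI : |T^[k] u - T^[k] v| ≤ t ^ 2 * ρ0 := by rw [huc, abs_sub_comm]; exact hvt
  have hvr2 : |T^[k] r - c| - t ^ 2 * ρ0 ≤ |T^[k] v - T^[k] r| := by
    have := abs_sub_le (T^[k] r) (T^[k] v) c
    rw [abs_sub_comm (T^[k] v)]; linarith
  rcases le_total |T^[k] l - c| |T^[k] r - c| with hpq | hpq
  · refine tail l hl v hv Rlv El hp (by linarith) _ ?_
    have := (S.koebe (m := 7/8 * |T^[k] l - c|) hl hr Rlr hul hvr (by positivity)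
      (by rw [huc]; linarith [abs_nonneg (T^[k] l - c)]) (by linarith)).1
    have h5 : 2 * |T^[k] u - T^[k] v| * |l - v| ≤ 2 * (t ^ 2 * ρ0) * |l - v| := by gcongr
    nlinarith [mul_nonneg ht3.le (abs_nonneg (l - v))]
  · refine tail r hr u hu Rur.symm Er hp' (by rw [huc, sub_self, abs_zero]; positivity) _ ?_
    have := (S.koebe (m := 7/8 * |T^[k] r - c|) hl hr Rlr hul hvr (by positivity)
      (by rw [huc]; linarith [abs_nonneg (T^[k] r - c)]) (by linarith)).2
    have h5 : 2 * |T^[k] u - T^[k] v| * |u - r| ≤ 2 * (t ^ 2 * ρ0) * |u - r| := by gcongr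
    rw [abs_sub_comm r u]
    nlinarith [mul_nonneg ht3.le (abs_nonneg (u - r))]

end SCE


theorem IsUnimodal.isCompact_ht (h : IsUnimodal T a b c) :
    IsCompact {p : ℝ × ℝ | p.1 ∈ Icc a b ∧ p.2 ∈ Icc a b ∧ ∀ n, URel T c n p.1 p.2} := by
  have : {p : ℝ × ℝ | p.1 ∈ Icc a b ∧ p.2 ∈ Icc a b ∧ ∀ n, URel T c n p.1 p.2} =
      ⋂ n, {p : ℝ × ℝ | p.1 ∈ Icc a b ∧ p.2 ∈ Icc a b ∧ URel T c n p.1 p.2} := by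
    ext p
    simp only [mem_setOf_eq, mem_iInter]
    exact ⟨fun hp n => ⟨hp.1, hp.2.1, hp.2.2 n⟩, fun hp => ⟨(hp 0).1, (hp 0).2.1, fun n => (hp n).2.2⟩⟩
  rw [this]
  exact (h.isCompact_rel 0).of_isClosed_subset (isClosed_iInter fun n => (h.isCompact_rel n).isClosed)
    (iInter_subset _ 0)

namespace SCE
variable {α K₁ K₂ C0 lam : ℝ} (S : SCE T a b c α K₁ K₂ C0 lam)
include S

theorem ht_ne {x y : ℝ} (hx : x ∈ Icc a b) (hy : y ∈ Icc a b) (R : ∀ n, URel T c n x y) (hxy : x ≠ y) (k : ℕ) :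
    T^[k] x ≠ c := by
  intro e
  refine S.no_ht (S.itmem hy k) ?_ (fun n => ?_)
  · intro e2
    exact hxy (S.uni.rel_inj hx hy (R k) le_rfl (by rw [e, e2]))
  · have := (URel.add_iff.1 (R (k + n))).2
    rw [e] at this; exact this.symm

theorem ht_shift {x y : ℝ} (R : ∀ n, URel T c n x y) (k : ℕ) : ∀ n, URel T c n (T^[k] x) (T^[k] y) :=
  fun n => (URel.add_iff.1 (R (k + n))).2

theorem ht_sep {ρ : ℝ} (hρ : 0 < ρ) : ∃ h0, 0 < h0 ∧ ∀ x ∈ Icc a b, ∀ y ∈ Icc a b, (∀ n, URel T c n x y) →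
    ρ ≤ |y - c| → h0 ≤ lev T c x := by
  have h := S.uni
  have hcl : IsClosed {p : ℝ × ℝ | ρ ≤ |p.2 - c|} := isClosed_le continuous_const (by fun_prop)
  have hK := h.isCompact_ht.inter_right hcl
  rcases ({p : ℝ × ℝ | p.1 ∈ Icc a b ∧ p.2 ∈ Icc a b ∧ ∀ n, URel T c n p.1 p.2} ∩
    {p : ℝ × ℝ | ρ ≤ |p.2 - c|}).eq_empty_or_nonempty with he | hne
  · refine ⟨1, one_pos, fun x hx y hy r hr => ?_⟩
    exfalso
    have : (x, y) ∈ ({p : ℝ × ℝ | p.1 ∈ Icc a b ∧ p.2 ∈ Icc a b ∧ ∀ n, URel T c n p.1 p.2} ∩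
      {p : ℝ × ℝ | ρ ≤ |p.2 - c|}) := ⟨⟨hx, hy, r⟩, hr⟩
    rw [he] at this; exact this
  · have hcont : ContinuousOn (fun p : ℝ × ℝ => lev T c p.1)
      ({p : ℝ × ℝ | p.1 ∈ Icc a b ∧ p.2 ∈ Icc a b ∧ ∀ n, URel T c n p.1 p.2} ∩ {p : ℝ × ℝ | ρ ≤ |p.2 - c|}) :=
      h.contLev.comp continuousOn_fst (fun p hp => hp.1.1)
    obtain ⟨z, hz, hmin⟩ := hK.exists_isMinOn hne hcont
    refine ⟨lev T c z.1, ?_, fun x hx y hy r hr => hmin (show (x, y) ∈ _ from ⟨⟨hx, hy, r⟩, hr⟩)⟩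
    apply h.lev_pos hz.1.1
    intro e
    refine S.no_ht hz.1.2.1 ?_ (fun n => ?_)
    · intro e2
      have := hz.2
      simp only [mem_setOf_eq, e2, sub_self, abs_zero] at this
      linarith
    · have := hz.1.2.2 n
      rw [e] at this; exact this.symm

theorem ht_rec {x y h0 t Kp q ρ0 : ℝ} {N : ℕ} (B : BC T a b c Kp q N ρ0) (hx : x ∈ Icc a b) (hy : y ∈ Icc a b)
    (R : ∀ n, URel T c n x y) (hxy : x ≠ y) (ht : t = |x - y| / (2 * (b - a)))
    (hs : ∀ x ∈ Icc a b, ∀ y ∈ Icc a b, (∀ n, URel T c n x y) → t ^ 2 * ρ0 ≤ |y - c| → h0 ≤ lev T c x)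
    {n : ℕ} (h1 : lev T c (T^[n] x) < h0) (h2 : lev T c (T^[n] x) ≤ lev T c (T^[n] y))
    (h3 : ∀ j < n, h0 ≤ lev T c (T^[j] x)) : False := by
  have h := S.uni
  have hab := S.hab
  have hd : 0 < |x - y| := abs_pos.2 (sub_ne_zero.2 hxy)
  have hxn := S.itmem hx n
  have hyn := S.itmem hy n
  have hne : T^[n] x ≠ T^[n] y := fun e => hxy (h.rel_inj hx hy (R n) le_rfl e)
  have hss := R (n + 1) n (Nat.lt_succ_self n)
  have hyc : |T^[n] y - c| < t ^ 2 * ρ0 := by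
    by_contra hcon
    push Not at hcon
    have := hs _ hxn _ hyn (S.ht_shift R n) hcon
    linarith
  have hxc : T^[n] x ∈ uIcc c (T^[n] y) := h.mem_of_lev hxn hyn hss h2
  obtain ⟨e, he, hxe⟩ : ∃ e, (e = a ∨ e = b) ∧ x ∈ uIcc e y := by
    rcases le_total x y with h1 | h1
    · exact ⟨a, Or.inl rfl, by rw [mem_uIcc]; exact Or.inl ⟨hx.1, h1⟩⟩
    · exact ⟨b, Or.inr rfl, by rw [mem_uIcc]; exact Or.inr ⟨h1, hx.2⟩⟩
  obtain ⟨l, hl, Rl, hli⟩ := h.extend hy (R n) he hxe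
  have hlm := uIcc_sub_Icc (h.bd_mem he) hx hl
  have hxly : x ∈ uIcc l y := by rw [mem_uIcc] at *; grind
  have hb := h.rel_between hlm hy Rl hxly le_rfl
  have hc : c ∈ uIcc (T^[n] l) (T^[n] x) := by
    by_contra hcon
    have hlx : T^[n] l ∈ uIcc c (T^[n] x) := by
      rw [mem_uIcc] at *; grind
    have hlev := h.lev_mono hxn hlx
    rcases hli with rfl | ⟨i, hi, hic⟩
    · have := h.lev_le_bd hyn (h.bd_iter he n)
      exact hne (h.lev_eq_ss hxn hyn hss (by linarith))
    · have e1 : ∀ z, T^[n] z = T^[n - i] (T^[i] z) := fun z => (iterate_sub_apply hi.le z).symm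
      have e2 : T^[n] l = T^[n - i] c := by rw [e1, hic]
      have R2 : URel T c (n - i) (T^[i] x) c := by
        have := (Rl.symm.mono le_rfl)
        have R3 := h.rel_left hlm hy Rl hxly
        rw [show n = i + (n - i) by omega] at R3
        have := (URel.add_iff.1 R3).2
        rw [hic] at this; exact this.symm
      have h4 := h3 i hi
      refine S.nru (by omega) (S.itmem hx i) (S.ht_ne hx hy R hxy i) R2 ?_ ?_ ?_
      · rw [← e2]; linarith
      · rw [← e1]; linarith
      · rw [← e1, ← e2]
        unfold SS
        rw [mem_uIcc] at hlx
        grind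
  obtain ⟨w, hw, hwc⟩ := h.ivt hlm hx hc
  have hwly : w ∈ uIcc l y := by rw [mem_uIcc] at *; grind
  have hwm := uIcc_sub_Icc hlm hx hw
  have hxwy : x ∈ uIcc w y := by rw [mem_uIcc] at *; grind
  have i1 := abs_add_of_mem hxwy
  have ht0 : 0 < t := by rw [ht]; positivity
  have ht1 : t ≤ 1 := by
    rw [ht, div_le_one (by positivity)]
    have := abs_sub_le_of_mem hx hy
    linarith
  have := S.BH (A := b - a) (m := 1) B hab.le B.qlt.le le_rfl n
    (fun j _ x hx y hy _ => by simpa using abs_sub_le_of_mem hx hy) w hwm y hy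
    (h.rel_right hlm hy Rl hwly) hwc t ht0.le ht1 hyc.le
  have e : (b - a) * t * 1 ^ n = |x - y| / 2 := by
    rw [ht, one_pow]; field_simp
  rw [e] at this
  have := abs_nonneg (w - x)
  linarith

theorem ht_far {x y : ℝ} (hx : x ∈ Icc a b) (hy : y ∈ Icc a b)
    (R : ∀ n, URel T c n x y) (hxy : x ≠ y) :
    ∃ h0, 0 < h0 ∧ ∀ n, h0 ≤ lev T c (T^[n] x) ∧ h0 ≤ lev T c (T^[n] y) := by
  obtain ⟨Kp, q, N, ρ0, B⟩ := S.exists_BC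
  have hab := S.hab
  have hd : 0 < |x - y| := abs_pos.2 (sub_ne_zero.2 hxy)
  have hρ := B.ρpos
  obtain ⟨h0, hh0, hs⟩ := S.ht_sep (ρ := (|x - y| / (2 * (b - a))) ^ 2 * ρ0) (by positivity)
  refine ⟨h0, hh0, ?_⟩
  intro n
  induction n using Nat.strong_induction_on with
  | _ n ih =>
  by_contra hcon
  rcases le_total (lev T c (T^[n] x)) (lev T c (T^[n] y)) with h1 | h1
  · refine S.ht_rec B hx hy R hxy rfl hs (n := n) ?_ h1 (fun j hj => (ih j hj).1)
    by_contra h2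
    push Not at h2
    exact hcon ⟨h2, h2.trans h1⟩
  · refine S.ht_rec B hy hx (fun n => (R n).symm) hxy.symm rfl ?_ (n := n) ?_ h1 (fun j hj => (ih j hj).2)
    · rw [abs_sub_comm y x]; exact hs
    by_contra h2
    push Not at h2
    exact hcon ⟨h2.trans h1, h2⟩

theorem Dn_bd (D : ℝ) : ∃ N, ∀ n, N ≤ n → ∀ e, (e = a ∨ e = b) → D ≤ Dn T n e := by
  have ha : ∀ n, Dn T n a = (deriv T a) ^ n := by
    intro n
    induction n with
    | zero => simp [Dn]
    | succ n ih => rw [Dn_succ', S.Ta, ih, abs_of_pos (by linarith [S.dTa]), pow_succ']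
  have hb : 0 < |deriv T b| := S.d_pos S.uni.bmem S.uni.hcb.ne'
  have ht := tendsto_pow_atTop_atTop_of_one_lt S.dTa
  obtain ⟨N1, h1⟩ := Filter.eventually_atTop.1 (ht.eventually_ge_atTop D)
  obtain ⟨N2, h2⟩ := Filter.eventually_atTop.1 (ht.eventually_ge_atTop (D / |deriv T b|))
  refine ⟨max N1 (N2 + 1), fun n hn e he => ?_⟩
  have hn1 := (le_max_left _ _).trans hn
  have hn2 := (le_max_right _ _).trans hn
  rcases he with rfl | rfl
  · rw [ha]; exact h1 n hn1
  · obtain ⟨k, rfl⟩ : ∃ k, n = k + 1 := ⟨n - 1, by omega⟩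
    rw [Dn_succ', S.Tb, ha]
    have := h2 k (by omega)
    rw [div_le_iff₀ hb] at this
    linarith

theorem nh {x y : ℝ} (hx : x ∈ Icc a b) (hy : y ∈ Icc a b) (R : ∀ n, URel T c n x y) : x = y := by
  by_contra hxy
  have h := S.uni
  have hab := S.hab
  have hd0 : 0 < |x - y| := abs_pos.2 (sub_ne_zero.2 hxy)
  obtain ⟨⟨u, v⟩, ⟨hu, hv, Ruv⟩, hmax⟩ := h.isCompact_ht.exists_isMaxOn (f := fun p : ℝ × ℝ => |p.1 - p.2|)
    ⟨(x, y), hx, hy, R⟩ (by fun_prop)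
  simp only at hu hv Ruv
  have hd : 0 < |u - v| := by
    have : |x - y| ≤ |u - v| := hmax (show (x, y) ∈ _ from ⟨hx, hy, R⟩)
    linarith
  have huv : u ≠ v := sub_ne_zero.1 (abs_pos.1 hd)
  obtain ⟨h0, hh0, hfar⟩ := S.ht_far hu hv Ruv huv
  obtain ⟨ρ, hρ, hlev⟩ : ∃ ρ, 0 < ρ ∧ ∀ y ∈ Icc a b, |y - c| ≤ ρ → lev T c y < h0 := by
    have := Metric.continuousOn_iff.1 h.contLev c h.cmem h0 hh0
    obtain ⟨δ, hδ, hh⟩ := this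
    refine ⟨δ / 2, by positivity, fun y hy hyc => ?_⟩
    have := hh y hy (by rw [Real.dist_eq]; linarith)
    rw [Real.dist_eq, IsUnimodal.lev_c, sub_zero] at this
    exact (le_abs_self _).trans_lt this
  obtain ⟨τ, hτ, hW⟩ := S.W0' hρ
  set D := 2 * (b - a) / |u - v| with hD
  have hD0 : 0 < D := by positivity
  obtain ⟨N1, hN1⟩ := S.Dn_bd D
  obtain ⟨N2, hN2⟩ : ∃ N, ∀ l ∈ Icc a b, ∀ r ∈ Icc a b, URel T c N l r → u ∈ uIcc l r → v ∈ uIcc u r →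
      |l - r| < |u - v| + τ / D := by
    by_contra hcon
    push Not at hcon
    have hcl : IsClosed {p : ℝ × ℝ | |u - v| + τ / D ≤ |p.1 - p.2|} := isClosed_le continuous_const (by fun_prop)
    obtain ⟨p, hp⟩ := IsCompact.nonempty_iInter_of_sequence_nonempty_isCompact_isClosed
      (fun n => {p : ℝ × ℝ | p.1 ∈ Icc a b ∧ p.2 ∈ Icc a b ∧ URel T c n p.1 p.2} ∩
        {p : ℝ × ℝ | |u - v| + τ / D ≤ |p.1 - p.2|})
      (fun n p hp => ⟨⟨hp.1.1, hp.1.2.1, hp.1.2.2.mono (Nat.le_succ n)⟩, hp.2⟩)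
      (fun n => by
        obtain ⟨l, hl, r, hr, Rlr, -, -, h3⟩ := hcon n
        exact ⟨(l, r), ⟨hl, hr, Rlr⟩, h3⟩)
      ((h.isCompact_rel 0).inter_right hcl) (fun n => (h.isCompact_rel n).isClosed.inter hcl)
    rw [mem_iInter] at hp
    have h1 : |p.1 - p.2| ≤ |u - v| := hmax (show p ∈ _ from
      ⟨(hp 0).1.1, (hp 0).1.2.1, fun n => (hp n).1.2.2⟩)
    have h2 : |u - v| + τ / D ≤ |p.1 - p.2| := (hp 0).2
    have : 0 < τ / D := by positivity
    linarith
  set n := max N1 N2 with hn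
  obtain ⟨l, hl, r, hr, Rlr, hul, hvr, El, Er⟩ := h.ext2 hu hv (Ruv n)
  have hlen := hN2 l hl r hr (Rlr.mono (le_max_right _ _)) hul hvr
  have a1 := abs_add_of_mem hul
  have a2 := abs_add_of_mem hvr
  -- one side
  have side : ∀ z ∈ Icc a b, ∀ w ∈ Icc a b, URel T c n z w → EP T a b c n z → |z - w| < τ / D →
      (∀ i, h0 ≤ lev T c (T^[i] w)) → ∃ ξ ∈ uIcc z w, D ≤ Dn T n ξ := by
    intro z hz w hw Rz hE hzw hlw
    rcases hE with hE | ⟨i, hi, hic⟩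
    · exact ⟨z, left_mem_uIcc, hN1 n (le_max_left _ _) z hE⟩
    · have e1 : ∀ z, T^[n] z = T^[n - i] (T^[i] z) := fun z => (iterate_sub_apply hi.le z).symm
      have R2 : URel T c (n - i) (T^[i] w) c := by
        rw [show n = i + (n - i) by omega] at Rz
        have := (URel.add_iff.1 Rz).2
        rw [hic] at this; exact this.symm
      have hsp : τ < |T^[n] z - T^[n] w| := by
        by_contra hcon
        push Not at hcon
        rw [e1 z, e1 w, hic, abs_sub_comm] at hcon
        have := hlev _ (S.itmem hw i) (hW _ _ (S.itmem hw i) R2 hcon)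
        linarith [hlw i]
      obtain ⟨ξ, hξ, e⟩ := S.mvt n hz hw
      refine ⟨ξ, hξ, ?_⟩
      rw [e] at hsp
      by_contra hcon
      push Not at hcon
      have : Dn T n ξ * |z - w| ≤ D * (τ / D) := by
        gcongr
      rw [mul_div_cancel₀ _ hD0.ne'] at this
      linarith
  have Rlu := h.rel_left hl hr Rlr hul
  have hvlr : v ∈ uIcc l r := mem_uIcc_trans' hul hvr
  have Rvr := h.rel_right hl hr Rlr hvlr
  obtain ⟨ξ, hξ, d1⟩ := side l hl u hu Rlu El (by linarith [abs_nonneg (v - r)]) (fun i => (hfar i).1)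
  obtain ⟨η, hη, d2⟩ := side r hr v hv Rvr.symm Er (by rw [abs_sub_comm]; linarith [abs_nonneg (l - u)]) (fun i => (hfar i).2)
  have hξm := uIcc_sub_Icc hl hu hξ
  have hηm := uIcc_sub_Icc hr hv hη
  have o1 : ξ ∈ uIcc l r := mem_uIcc_trans hul hξ
  have o2 : η ∈ uIcc l r := mem_uIcc_trans' hvlr (uIcc_comm' hη)
  have o3 : u ∈ uIcc ξ η := by rw [mem_uIcc] at *; grind
  have o4 : v ∈ uIcc ξ η := by rw [mem_uIcc] at *; grind
  have Rξη := h.rel_sub hl hr Rlr o1 o2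
  have du := (le_min d1 d2).trans (S.minp hξm hηm Rξη o3)
  have dv := (le_min d1 d2).trans (S.minp hξm hηm Rξη o4)
  have hE := S.En hu hv (Ruv n)
  have hI := abs_sub_le_of_mem (S.itmem hu n) (S.itmem hv n)
  have k1 : D * D * |u - v| ^ 2 ≤ Dn T n u * Dn T n v * (u - v) ^ 2 := by
    rw [sq_abs]
    gcongr
    exact Dn_nonneg _ _
  have k2 : D * D * |u - v| ^ 2 = 4 * (b - a) ^ 2 := by rw [hD]; field_simp; ring
  have k3 : (T^[n] u - T^[n] v) ^ 2 ≤ (b - a) ^ 2 := by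
    rw [← sq_abs]; gcongr
  nlinarith

/-- uniform smallness -/
theorem nh_unif {ε : ℝ} (hε : 0 < ε) : ∃ N, ∀ x ∈ Icc a b, ∀ y ∈ Icc a b, URel T c N x y → |x - y| < ε := by
  by_contra hcon
  push Not at hcon
  have h := S.uni
  have hcl : IsClosed {p : ℝ × ℝ | ε ≤ |p.1 - p.2|} := isClosed_le continuous_const (by fun_prop)
  obtain ⟨p, hp⟩ := IsCompact.nonempty_iInter_of_sequence_nonempty_isCompact_isClosed
    (fun n => {p : ℝ × ℝ | p.1 ∈ Icc a b ∧ p.2 ∈ Icc a b ∧ URel T c n p.1 p.2} ∩ {p : ℝ × ℝ | ε ≤ |p.1 - p.2|})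
    (fun n p hp => ⟨⟨hp.1.1, hp.1.2.1, hp.1.2.2.mono (Nat.le_succ n)⟩, hp.2⟩)
    (fun n => by
      obtain ⟨l, hl, r, hr, Rlr, h3⟩ := hcon n
      exact ⟨(l, r), ⟨hl, hr, Rlr⟩, h3⟩)
    ((h.isCompact_rel 0).inter_right hcl) (fun n => (h.isCompact_rel n).isClosed.inter hcl)
  rw [mem_iInter] at hp
  have := S.nh (hp 0).1.1 (hp 0).1.2.1 (fun n => (hp n).1.2.2)
  have h2 : ε ≤ |p.1 - p.2| := (hp 0).2
  rw [this, sub_self, abs_zero] at h2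
  linarith

end SCE


theorem local_exp {f : ℝ → ℝ} {d κ p : ℝ} (hf : HasDerivAt f d p) (hκ : κ < d) :
    ∃ η, 0 < η ∧ ∀ z, |z - p| ≤ η → κ * (z - p) ^ 2 ≤ (f z - f p) * (z - p) := by
  have h1 := (hasDerivAt_iff_tendsto_slope.1 hf).eventually_const_lt hκ
  rw [eventually_nhdsWithin_iff, Metric.eventually_nhds_iff] at h1
  obtain ⟨η, hη, h2⟩ := h1
  refine ⟨η / 2, by positivity, fun z hz => ?_⟩
  by_cases e : z = p
  · subst e; simp
  have h3 := h2 (show dist z p < η by rw [Real.dist_eq]; linarith) e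
  rw [slope_def_field] at h3
  have hne : z - p ≠ 0 := sub_ne_zero.2 e
  have hpos : 0 < (z - p) ^ 2 := by positivity
  have : κ * (z - p) ^ 2 ≤ (f z - f p) / (z - p) * (z - p) ^ 2 := by gcongr
  calc _ ≤ _ := this
    _ = _ := by field_simp

namespace SCE
variable {α K₁ K₂ C0 lam : ℝ} (S : SCE T a b c α K₁ K₂ C0 lam)
include S

theorem near_a : ∃ η ν, 0 < η ∧ 0 < ν ∧ ν < 1 ∧ ∀ n, ∀ y ∈ Icc a b, URel T c n a y → |T^[n] a - T^[n] y| ≤ η →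
    |a - y| ≤ η * ν ^ n := by
  have h := S.uni
  have hac := h.hac
  have hcb := h.hcb
  have hd := S.dTa
  obtain ⟨η0, hη0, hl⟩ := local_exp (S.diff a h.amem).hasDerivAt (show (1 + deriv T a) / 2 < deriv T a by linarith)
  set μ := (1 + deriv T a) / 2 with hμ
  have hμ1 : 1 < μ := by linarith
  set η := min η0 (c - a) with hη
  have hηpos : 0 < η := lt_min hη0 (by linarith)
  have hη1 : η ≤ η0 := min_le_left _ _
  have hη2 : η ≤ c - a := min_le_right _ _
  have hl2 : ∀ z, a ≤ z → z - a ≤ η → μ * (z - a) ≤ T z - a := by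
    intro z hz hz2
    rcases hz.eq_or_lt with rfl | hz
    · rw [S.Ta]; simp
    have := hl z (by rw [abs_of_nonneg (by linarith)]; linarith)
    rw [S.Ta] at this
    have hp : 0 < z - a := by linarith
    have : μ * (z - a) * (z - a) ≤ (T z - a) * (z - a) := by nlinarith
    exact le_of_mul_le_mul_right this hp
  have hit : ∀ n, T^[n] a = a := fun n => Function.iterate_fixed S.Ta n
  refine ⟨η, μ⁻¹, hηpos, by positivity, inv_lt_one_of_one_lt₀ hμ1, ?_⟩
  intro n
  induction n with
  | zero => intro y hy _ h1; simpa using h1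
  | succ n ih =>
    intro y hy R h1
    have hs := R 0 (Nat.succ_pos n)
    have hyc : y ≤ c := by
      rcases hs with hs | hs
      · exact hs.2
      · exact absurd hs.1 (not_le.2 hac)
    have R2 : URel T c n a (T y) := by
      have := (URel.add_iff.1 (show URel T c (1 + n) a y by rwa [add_comm])).2
      simpa [S.Ta] using this
    have h2 := ih (T y) (h.maps hy) R2 (by
      rw [Function.iterate_succ_apply, Function.iterate_succ_apply, S.Ta] at h1; exact h1)
    have hTy := (h.maps hy).1
    rw [abs_sub_comm, abs_of_nonneg (by linarith)] at h2
    rw [abs_sub_comm, abs_of_nonneg (by linarith [hy.1])]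
    have hν : μ⁻¹ ^ n ≤ 1 := pow_le_one₀ (by positivity) (inv_le_one_of_one_le₀ hμ1.le)
    have h3 : T y - a ≤ η := h2.trans (by nlinarith)
    have h4 : y - a ≤ η := by
      by_contra hcon
      push Not at hcon
      have h5 := hl2 (a + η) (by linarith) (by linarith)
      have h6 := S.orient.1 (show a + η ∈ Icc a c from ⟨by linarith, by linarith⟩)
        (show y ∈ Icc a c from ⟨hy.1, hyc⟩) (by linarith)
      have h7 : a + η - a = η := by ring
      rw [h7] at h5
      nlinarith
    have h5 := hl2 y hy.1 h4
    have : μ * (y - a) ≤ η * μ⁻¹ ^ n := h5.trans h2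
    rw [pow_succ]
    calc y - a = (μ * (y - a)) * μ⁻¹ := by field_simp
      _ ≤ η * μ⁻¹ ^ n * μ⁻¹ := by gcongr
      _ = _ := by ring

theorem near_b : ∃ Cb, 0 < Cb ∧ ∀ y ∈ Icc a b, c ≤ y → |b - y| ≤ Cb * |a - T y| := by
  have h := S.uni
  have hac := h.hac
  have hcb := h.hcb
  have hb : 0 < |deriv T b| := S.d_pos h.bmem hcb.ne'
  have hbn : deriv T b ≤ 0 := by
    by_contra hcon
    push Not at hcon
    obtain ⟨η, hη, hl⟩ := local_exp (S.diff b h.bmem).hasDerivAt hcon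
    set z := max c (b - η) with hz
    have hz1 : c ≤ z := le_max_left _ _
    have hz2 : b - η ≤ z := le_max_right _ _
    have hz3 : z < b := max_lt hcb (by linarith)
    have h1 := hl z (by rw [abs_of_neg (by linarith)]; linarith)
    have h2 := S.orient.2 ⟨hz1, hz3.le⟩ ⟨hcb.le, le_rfl⟩ hz3
    nlinarith
  have hbn' : deriv T b < 0 := lt_of_le_of_ne hbn (abs_pos.1 hb)
  obtain ⟨η0, hη0, hl⟩ := local_exp (S.diff b h.bmem).hasDerivAt.neg
    (show -deriv T b / 2 < -deriv T b by linarith)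
  set κ := -deriv T b / 2 with hκ
  have hκ0 : 0 < κ := by linarith
  set η := min η0 (b - c) with hη
  have hηpos : 0 < η := lt_min hη0 (by linarith)
  have hη1 : η ≤ η0 := min_le_left _ _
  have hη2 : η ≤ b - c := min_le_right _ _
  have hl2 : ∀ z, z ≤ b → b - z ≤ η → κ * (b - z) ≤ T z - a := by
    intro z hz hz2
    rcases hz.eq_or_lt with rfl | hz
    · rw [S.Tb]; simp
    have := hl z (by rw [abs_of_neg (by linarith)]; linarith)
    simp only [Pi.neg_apply, S.Tb] at this
    have hp : 0 < b - z := by linarith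
    have : κ * (b - z) * (b - z) ≤ (T z - a) * (b - z) := by nlinarith
    exact le_of_mul_le_mul_right this hp
  have hab := S.hab
  refine ⟨max (1 / κ) ((b - a) / (κ * η)), lt_max_of_lt_left (by positivity), ?_⟩
  intro y hy hyc
  have hTy := (h.maps hy).1
  rw [abs_of_nonneg (by linarith [hy.2]), abs_sub_comm, abs_of_nonneg (by linarith)]
  have hT0 : 0 ≤ T y - a := by linarith
  rcases le_or_gt (b - y) η with h1 | h1
  · have := hl2 y hy.2 h1
    calc b - y = 1 / κ * (κ * (b - y)) := by field_simp
      _ ≤ 1 / κ * (T y - a) := by gcongr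
      _ ≤ _ := by gcongr; exact le_max_left _ _
  · have h2 := hl2 (b - η) (by linarith) (by linarith)
    have h3 := S.orient.2 (show y ∈ Icc c b from ⟨hyc, hy.2⟩) (show b - η ∈ Icc c b from ⟨by linarith, by linarith⟩)
      (by linarith)
    have h4 : κ * η ≤ T y - a := by
      have : b - (b - η) = η := by ring
      rw [this] at h2; linarith
    calc b - y ≤ b - a := by linarith [hy.1]
      _ = (b - a) / (κ * η) * (κ * η) := by field_simp
      _ ≤ (b - a) / (κ * η) * (T y - a) := by gcongr
      _ ≤ _ := by gcongr; exact le_max_right _ _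

theorem near_bd : ∃ η ν Cb, 0 < η ∧ 0 < ν ∧ ν < 1 ∧ 0 < Cb ∧ ∀ n, ∀ e, (e = a ∨ e = b) → ∀ y ∈ Icc a b,
    URel T c n e y → |T^[n] e - T^[n] y| ≤ η → |e - y| ≤ Cb * ν ^ n := by
  obtain ⟨η, ν, hη, hν, hν1, h1⟩ := S.near_a
  obtain ⟨Cb, hCb, h2⟩ := S.near_b
  have h := S.uni
  have hab := S.hab
  refine ⟨η, ν, max (max η (b - a)) (Cb * η / ν), hη, hν, hν1, lt_max_of_lt_left (lt_max_of_lt_left hη), ?_⟩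
  intro n e he y hy R hn
  rcases he with rfl | rfl
  · refine (h1 n y hy R hn).trans ?_
    gcongr
    exact (le_max_left _ _).trans (le_max_left _ _)
  · rcases n with _ | n
    · have := abs_sub_le_of_mem h.bmem hy
      rw [pow_zero, mul_one]
      exact this.trans ((le_max_right _ _).trans (le_max_left _ _))
    · have hs := R 0 (Nat.succ_pos n)
      have hyc : c ≤ y := by
        rcases hs with hs | hs
        · exact absurd hs.1 (not_le.2 h.hcb)
        · exact hs.2
      have R2 : URel T c n a (T y) := by
        have := (URel.add_iff.1 (show URel T c (1 + n) e y by rwa [add_comm])).2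
        simpa [S.Tb] using this
      have h3 := h1 n (T y) (h.maps hy) R2 (by
        rw [Function.iterate_succ_apply, Function.iterate_succ_apply, S.Tb] at hn; exact hn)
      calc |e - y| ≤ Cb * |a - T y| := h2 y hy hyc
        _ ≤ Cb * (η * ν ^ n) := by gcongr
        _ = Cb * η / ν * ν ^ (n + 1) := by rw [pow_succ]; field_simp
        _ ≤ _ := by gcongr; exact le_max_right _ _

theorem es : ∃ C θ, 0 ≤ C ∧ 0 < θ ∧ θ < 1 ∧ ExpShrink T a b c C θ := by
  have h := S.uni
  have hab := S.hab
  obtain ⟨K, q, N, ρ0, B⟩ := S.exists_BC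
  obtain ⟨η, ν, Cb, hη, hν, hν1, hCb, hbd⟩ := S.near_bd
  have hρ0 := B.ρpos
  have hq := B.qpos
  have hq1 := B.qlt
  have hK := B.Kpos
  obtain ⟨τ1, hτ1, hW⟩ := S.W0' (show 0 < ρ0 / 4 by positivity)
  set τ := min τ1 η / 2 with hτ
  have hτ0 : 0 < τ := by positivity
  have hτa : 2 * τ ≤ τ1 := by have := min_le_left τ1 η; linarith
  have hτb : 2 * τ ≤ η := by have := min_le_right τ1 η; linarith
  obtain ⟨N4, hN4⟩ := S.nh_unif (show 0 < τ / 4 by positivity)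
  set N5 := N4 + 1 with hN5
  have hq2 : q ^ 2 < 1 := by nlinarith
  obtain ⟨σ0, hσ0⟩ := exists_pow_lt_of_lt_one (show 0 < ρ0 / 4 / (K * (b - a)) by positivity) hq2
  set M := σ0 + N5 with hM
  have hM0 : (0:ℝ) < M := by rw [hM, hN5]; push_cast; positivity
  have hM1 : (1:ℝ) ≤ M := by rw [hM, hN5]; push_cast; have : (0:ℝ) ≤ (σ0:ℝ) + N4 := by positivity
                             linarith
  set m := max (max q ν) (1 + -(1 / (2 * (M:ℝ)))) with hm
  have hmq : q ≤ m := (le_max_left _ _).trans (le_max_left _ _)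
  have hmν : ν ≤ m := (le_max_right _ _).trans (le_max_left _ _)
  have hm0 : 0 < m := hq.trans_le hmq
  have hm1 : m < 1 := by
    refine max_lt (max_lt hq1 hν1) ?_
    have : 0 < 1 / (2 * (M:ℝ)) := by positivity
    linarith
  have hmM : 1 / 2 ≤ m ^ M := by
    have h1 : 1 / (2 * (M:ℝ)) ≤ 1 := by rw [div_le_one (by positivity)]; linarith
    have h2 := one_add_mul_le_pow (show (-2:ℝ) ≤ -(1 / (2 * (M:ℝ))) by linarith) M
    have h3 : 1 + (M:ℝ) * -(1 / (2 * (M:ℝ))) = 1 / 2 := by field_simp; norm_num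
    rw [h3] at h2
    refine h2.trans ?_
    apply pow_le_pow_left₀ (by linarith) (le_max_right _ _)
  have hmj : ∀ j ≤ M, 1 / 2 ≤ m ^ j := fun j hj => hmM.trans (pow_le_pow_of_le_one hm0.le hm1.le hj)
  have hmN : 1 / 2 ≤ m ^ N5 := hmj N5 (by omega)
  set A := max (2 * (b - a)) (2 * Cb) with hA
  have hA0 : 0 < A := lt_max_of_lt_left (by linarith)
  have hA1 : 2 * (b - a) ≤ A := le_max_left _ _
  have hA2 : 2 * Cb ≤ A := le_max_right _ _
  refine ⟨A, m, hA0.le, hm0, hm1, ?_⟩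
  intro k
  induction k using Nat.strong_induction_on with
  | _ k ih =>
  intro x hx y hy R
  rcases lt_or_ge k N5 with hk | hk
  · have h1 := hmj k (by omega)
    have h2 := abs_sub_le_of_mem hx hy
    nlinarith
  obtain ⟨n, rfl⟩ : ∃ n, k = n + N5 := ⟨k - N5, by omega⟩
  obtain ⟨Rn, R5⟩ := URel.add_iff.1 R
  have hεn := hN4 _ (S.itmem hx n) _ (S.itmem hy n) (R5.mono (by omega))
  have near : ∀ z ∈ Icc a b, ∀ w ∈ Icc a b, URel T c n z w → EP T a b c n z →
      |T^[n] z - T^[n] w| ≤ 2 * τ → |z - w| ≤ A * m ^ (n + N5) := by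
    intro z hz w hw Rz hE hzw
    rcases hE with hE | ⟨i, hi, hic⟩
    · have h1 := hbd n z hE w hw Rz (hzw.trans hτb)
      calc |z - w| ≤ Cb * ν ^ n := h1
        _ ≤ Cb * m ^ n := by gcongr
        _ = (2 * Cb) * m ^ n * (1 / 2) := by ring
        _ ≤ A * m ^ n * m ^ N5 := by gcongr
        _ = _ := by rw [pow_add]; ring
    · obtain ⟨σ, rfl⟩ : ∃ σ, n = i + σ := ⟨n - i, by omega⟩
      have e1 : ∀ x, T^[i + σ] x = T^[σ] (T^[i] x) := fun x => by
        rw [← Function.iterate_add_apply, add_comm]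
      obtain ⟨Ri, Rσ⟩ := URel.add_iff.1 Rz
      rw [hic] at Rσ
      rw [e1, e1, hic, abs_sub_comm] at hzw
      have hwi := S.itmem hw i
      have p1 := hW σ _ hwi Rσ.symm (hzw.trans hτa)
      have p2 := B.P σ (by omega) _ hwi (b - a) Rσ.symm (abs_sub_le_of_mem (S.itmem h.cmem σ) h.cmem)
        (abs_sub_le_of_mem (S.itmem hwi σ) h.cmem)
      have p3 : |T^[i] w - c| ≤ (m ^ (σ + N5)) ^ 2 * ρ0 := by
        rcases le_or_gt σ σ0 with hσ | hσ
        · have := hmj (σ + N5) (by omega)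
          have : (1 / 2) ^ 2 ≤ (m ^ (σ + N5)) ^ 2 := by gcongr
          nlinarith
        · have h1 : (q ^ 2) ^ σ ≤ ρ0 / 4 / (K * (b - a)) :=
            (pow_le_pow_of_le_one (by positivity) hq2.le hσ.le).trans hσ0.le
          rw [le_div_iff₀ (by positivity)] at h1
          have h2 : (1 / 2) ^ 2 ≤ (m ^ N5) ^ 2 := by gcongr
          have h3 : (q ^ 2) ^ σ ≤ (m ^ σ) ^ 2 := by
            rw [← pow_mul, mul_comm, pow_mul]; gcongr
          calc |T^[i] w - c| ≤ _ := p2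
            _ = (q ^ 2) ^ σ * ((q ^ 2) ^ σ * (K * (b - a))) := by
              have : (q ^ 4) ^ σ = (q ^ 2) ^ σ * (q ^ 2) ^ σ := by rw [← mul_pow]; ring
              rw [this]; ring
            _ ≤ (m ^ σ) ^ 2 * (ρ0 / 4) := by gcongr
            _ = (m ^ σ) ^ 2 * (1 / 2) ^ 2 * ρ0 := by ring
            _ ≤ (m ^ σ) ^ 2 * (m ^ N5) ^ 2 * ρ0 := by gcongr
            _ = _ := by rw [pow_add]; ring
      have := S.BH B hA0.le hmq hm1.le i (fun j hj => ih j (by omega)) z hz w hw Ri hic (m ^ (σ + N5))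
        (by positivity) (pow_le_one₀ hm0.le hm1.le) p3
      calc |z - w| ≤ _ := this
        _ = _ := by rw [pow_add, pow_add, pow_add]; ring
  obtain ⟨l, hl, r, hr, Rlr, hul, hvr, El, Er⟩ := h.ext2 hx hy Rn
  have hvlr : y ∈ uIcc l r := mem_uIcc_trans' hul hvr
  have Rlv := h.rel_left hl hr Rlr hvlr
  have Rur := h.rel_right hl hr Rlr hul
  obtain ⟨i1, i2⟩ := abs_four hul hvr
  rcases le_or_gt |T^[n] l - T^[n] x| τ with c1 | c1
  · refine i1.trans (near l hl y hy Rlv El ?_)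
    have := abs_sub_le (T^[n] l) (T^[n] x) (T^[n] y)
    linarith
  rcases le_or_gt |T^[n] y - T^[n] r| τ with c2 | c2
  · refine i2.trans (near r hr x hx Rur.symm Er ?_)
    have := abs_sub_le (T^[n] r) (T^[n] y) (T^[n] x)
    rw [abs_sub_comm (T^[n] r) (T^[n] y), abs_sub_comm (T^[n] y) (T^[n] x)] at this
    linarith
  have hk := (S.koebe hl hr Rlr hul hvr hτ0.le c1.le c2.le).1
  have h1 := ih n (by omega) l hl y hy Rlv
  have h2 : τ * |x - y| ≤ τ * (A * m ^ n * (1 / 2)) := by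
    calc _ ≤ _ := hk
      _ ≤ 2 * (τ / 4) * (A * m ^ n) := by gcongr
      _ = _ := by ring
  calc |x - y| ≤ A * m ^ n * (1 / 2) := le_of_mul_le_mul_left h2 hτ0
    _ ≤ A * m ^ n * m ^ N5 := by gcongr
    _ = _ := by rw [pow_add]; ring

end SCE

/-- for a piecewise expanding unimodal map, or an S-unimodal map
satisfying the Collet–Eckmann condition, there is `C > 0` with
`γ(φ) ≤ C · lip(φ)` for every Lipschitz `φ`. -/
theorem stmt12 (T : ℝ → ℝ) (a b c : ℝ) (huni : IsUnimodal T a b c)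
    (hexp : PiecewiseExpanding T a b ∨ (SUnimodal T a b c ∧ ColletEckmann T c)) :
    ∃ C : ℝ, 0 < C ∧ ∀ (φ : ℝ → ℝ) (K : NNReal), LipschitzOnWith K φ (Icc a b) →
      ∀ n : ℕ, 1 ≤ n → ∀ x ∈ Icc a b,
        ∑ k ∈ Finset.range n, φ (T^[k] x) - n * betaOn T a b φ ≤ C * K := by
  rcases hexp with pe | ⟨su, ce⟩
  · obtain ⟨C, θ, hC, h0, h1, es⟩ := huni.es_of_pe pe
    exact huni.main_of_es hC h0 h1 es
  · obtain ⟨α, K₁, K₂, C0, lam, S⟩ := sce_of huni su ce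
    obtain ⟨C, θ, hC, h0, h1, es⟩ := S.es
    exact huni.main_of_es hC h0 h1 es
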